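/- Let p be a prime. Then the weighted class number of positive definite integral ternary quadratic forms of discriminant p, namely the sum of 1/#Aut(Q) over a set of representatives Q of the GL_3(ℤ)-equivalence classes of positive definite integral quadratic forms in 3 variables with disc Q = p, equals (p−1)/48. -/

import Mathlib

open scoped BigOperators

/-- The integral quadratic form `Q(x) = ∑_{i ≤ j} a_{ij} x_i x_j` attached to the
coefficient matrix `a` (only entries with `i ≤ j` are used). -/
def Qform {n : ℕ} (a : Matrix (Fin n) (Fin n) ℤ) (x : Fin n → ℤ) : ℤ :=
  ∑ i, ∑ j, if i ≤ j then a i j * x i * x j else 0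

/-- The associated bilinear form `T(x,y) = Q(x+y) - Q(x) - Q(y)`. -/
def Tbil {n : ℕ} (a : Matrix (Fin n) (Fin n) ℤ) (x y : Fin n → ℤ) : ℤ :=
  Qform a (x + y) - Qform a x - Qform a y

/-- The Gram matrix `[T] = (T(e_i, e_j))_{i,j}`. -/
def gram {n : ℕ} (a : Matrix (Fin n) (Fin n) ℤ) : Matrix (Fin n) (Fin n) ℤ :=
  Matrix.of fun i j => Tbil a (Pi.single i 1) (Pi.single j 1)

/-- `ε(n) = 0` if `n` is even, `1` if `n` is odd. -/
def eps (n : ℕ) : ℕ := if Even n then 0 else 1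

/-- `Q` has (half-)discriminant `d`, i.e. `det [T] = 2^{ε(n)} d`. -/
def HasDisc {n : ℕ} (a : Matrix (Fin n) (Fin n) ℤ) (d : ℤ) : Prop :=
  (gram a).det = 2 ^ (eps n) * d

/-- `Q` is positive definite: `Q(x) > 0` for all `x ≠ 0`. -/
def PosDef {n : ℕ} (a : Matrix (Fin n) (Fin n) ℤ) : Prop :=
  ∀ x : Fin n → ℤ, x ≠ 0 → 0 < Qform a x

/-- Two integral quadratic forms (as functions) are `GL_n(ℤ)`-equivalent:
`Q'(x) = Q(g⁻¹ x)` for some `g ∈ GL_n(ℤ)`. -/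
def FormEquiv {n : ℕ} (Q Q' : (Fin n → ℤ) → ℤ) : Prop :=
  ∃ g : GL (Fin n) ℤ, ∀ x, Q' x = Q (Matrix.mulVec (↑(g⁻¹) : Matrix (Fin n) (Fin n) ℤ) x)

/-- The automorphism group of the quadratic form `Q = Qform a`:
elements `g ∈ GL_n(ℤ)` with `Q(g⁻¹ x) = Q(x)` for all `x`. -/
def AutGrp {n : ℕ} (a : Matrix (Fin n) (Fin n) ℤ) : Type :=
  {g : GL (Fin n) ℤ // ∀ x, Qform a (Matrix.mulVec (↑(g⁻¹) : Matrix (Fin n) (Fin n) ℤ) x) = Qform a x}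

namespace MF
open Module MeasureTheory Filter Topology Submodule

/-- Hamilton quaternions. -/
abbrev H := Quaternion ℝ

noncomputable instance instMeasH : MeasurableSpace H := borel H
instance instBorelH : BorelSpace H := ⟨rfl⟩

/-- full lattices in `H` -/
structure IsLat (K : Submodule ℤ H) : Prop where
  disc : DiscreteTopology K
  top : span ℝ (K : Set H) = ⊤

theorem IsLat.zl {K : Submodule ℤ H} (h : IsLat K) : @IsZLattice ℝ _ H _ _ K h.disc := by
  let _ := h.disc
  exact ⟨h.top⟩

/-- covolume -/
noncomputable def cov (K : Submodule ℤ H) : ℝ := ZLattice.covolume K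

theorem finrankH : finrank ℝ H = 4 := Quaternion.finrank_eq_four

theorem isLat_span (b : Basis (Fin 4) ℝ H) : IsLat (span ℤ (Set.range b)) :=
  ⟨inferInstance, (inferInstance : IsZLattice ℝ (span ℤ (Set.range b))).span_top⟩

theorem IsLat.of_le {A K B : Submodule ℤ H} (hA : IsLat A) (hB : IsLat B) (h1 : A ≤ K) (h2 : K ≤ B) :
    IsLat K := by
  refine ⟨?_, ?_⟩
  · have := hB.disc
    exact DiscreteTopology.of_subset (s := (B : Set H)) this h2
  · rw [eq_top_iff, ← hA.top]
    exact span_mono h1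

theorem IsLat.cov_pos {K : Submodule ℤ H} (h : IsLat K) : 0 < cov K := by
  have := h.disc; have := h.zl
  exact ZLattice.covolume_pos K volume

theorem IsLat.cov_eq {A B : Submodule ℤ H} (hA : IsLat A) (hB : IsLat B) (h : A ≤ B) :
    cov A = A.toAddSubgroup.relIndex B.toAddSubgroup * cov B := by
  have := hA.disc; have := hA.zl
  have := hB.disc; have := hB.zl
  have h1 := ZLattice.covolume_div_covolume_eq_relIndex' A B h
  rw [← h1]
  have := hB.cov_pos.ne'
  unfold cov at *
  field_simp

theorem IsLat.eq_of_cov {A B : Submodule ℤ H} (hA : IsLat A) (hB : IsLat B) (h : A ≤ B)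
    (hc : cov A = cov B) : A = B := by
  have h1 := hA.cov_eq hB h
  have hB0 := hB.cov_pos
  have : (A.toAddSubgroup.relIndex B.toAddSubgroup : ℝ) = 1 := by
    rw [hc] at h1
    exact mul_right_cancel₀ hB0.ne' (by linarith)
  have h2 : A.toAddSubgroup.relIndex B.toAddSubgroup = 1 := by exact_mod_cast this
  rw [AddSubgroup.relIndex_eq_one] at h2
  exact le_antisymm h h2

/-- image of a lattice under a real linear map -/
noncomputable abbrev lmap (f : H →ₗ[ℝ] H) (K : Submodule ℤ H) : Submodule ℤ H := K.map (f.restrictScalars ℤ)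

theorem IsLat.basis_ex {K : Submodule ℤ H} (h : IsLat K) :
    ∃ b : Basis (Fin 4) ℝ H, K = span ℤ (Set.range b) := by
  have := h.disc; have := h.zl
  have : Module.Free ℤ K := ZLattice.module_free ℝ K
  have : Module.Finite ℤ K := ZLattice.module_finite ℝ K
  have hr : finrank ℤ K = 4 := by rw [ZLattice.rank ℝ K, finrankH]
  let b : Basis (Fin 4) ℤ K := Module.finBasisOfFinrankEq ℤ K hr
  refine ⟨b.ofZLatticeBasis ℝ K, ?_⟩
  exact (b.ofZLatticeBasis_span ℝ).symm

theorem lmap_span (f : H →ₗ[ℝ] H) (v : Fin 4 → H) :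
    lmap f (span ℤ (Set.range v)) = span ℤ (Set.range (f ∘ v)) := by
  rw [lmap, Submodule.map_span, Set.range_comp]
  rfl

theorem cov_span_aux (b b₀ : Basis (Fin 4) ℝ H) :
    cov (span ℤ (Set.range b)) = |b₀.det b| * volume.real (ZSpan.fundamentalDomain b₀) := by
  have h := ZLattice.covolume_eq_det_mul_measureReal (span ℤ (Set.range b)) volume
    (b.restrictScalars ℤ) b₀
  rw [cov, h]
  congr 3
  ext1 i
  simp

theorem IsLat.map {K : Submodule ℤ H} (h : IsLat K) (f : H ≃ₗ[ℝ] H) : IsLat (lmap f K) := by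
  obtain ⟨b, rfl⟩ := h.basis_ex
  rw [lmap_span]
  exact isLat_span (b.map f)

theorem IsLat.cov_map {K : Submodule ℤ H} (h : IsLat K) (f : H ≃ₗ[ℝ] H) :
    cov (lmap f K) = |LinearMap.det (f : H →ₗ[ℝ] H)| * cov K := by
  obtain ⟨b, rfl⟩ := h.basis_ex
  rw [lmap_span]
  have h1 := cov_span_aux (b.map f) b
  have h2 := cov_span_aux b b
  rw [h2]
  have : (⇑(f : H →ₗ[ℝ] H) ∘ ⇑b) = b.map f := by ext1 i; simp
  rw [this, h1]
  have : ⇑(b.map f) = (f : H →ₗ[ℝ] H) ∘ ⇑b := by ext1 i; simp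
  rw [this, Basis.det_comp, abs_mul, mul_assoc]

/-- coordinates -/
def coo (x : H) : Fin 4 → ℝ := ![x.re, x.imI, x.imJ, x.imK]

/-- standard orthonormal basis -/
noncomputable def ob : OrthonormalBasis (Fin 4) ℝ H :=
  OrthonormalBasis.ofRepr Quaternion.linearIsometryEquivTuple

theorem ob_repr (x : H) (i : Fin 4) : ob.toBasis.repr x i = coo x i := by
  rw [OrthonormalBasis.coe_toBasis_repr_apply]
  change (Quaternion.linearIsometryEquivTuple x) i = _
  rw [Quaternion.linearIsometryEquivTuple_apply]
  rfl

theorem cov_span (v : Fin 4 → H) (hv : (Matrix.of fun i j => coo (v i) j).det ≠ 0) :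
    IsLat (span ℤ (Set.range v)) ∧
    cov (span ℤ (Set.range v)) = |(Matrix.of fun i j => coo (v i) j).det| := by
  have hd : ob.toBasis.det v = (Matrix.of fun i j => coo (v i) j).det := by
    rw [Basis.det_apply, ← Matrix.det_transpose]
    congr 1
  have hu : IsUnit (ob.toBasis.det v) := by rw [hd]; exact isUnit_iff_ne_zero.2 hv
  obtain ⟨h1, h2⟩ := (Module.Basis.is_basis_iff_det ob.toBasis).2 hu
  let b : Basis (Fin 4) ℝ H := Basis.mk h1 h2.ge
  have hb : ⇑b = v := Basis.coe_mk _ _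
  have := cov_span_aux b ob.toBasis
  rw [← hb]
  refine ⟨isLat_span b, ?_⟩
  rw [this, hb, hd]
  have : volume.real (ZSpan.fundamentalDomain ob.toBasis) = 1 := by
    rw [measureReal_congr (ZSpan.fundamentalDomain_ae_parallelepiped ob.toBasis volume)]
    rw [measureReal_def, OrthonormalBasis.coe_toBasis, OrthonormalBasis.volume_parallelepiped]
    simp
  rw [this, mul_one]

theorem volume_ballH (r : ℝ) (hr : 0 ≤ r) :
    volume (Metric.ball (0 : H) r) = ENNReal.ofReal (Real.pi ^ 2 / 2 * r ^ 4) := by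
  rw [InnerProductSpace.volume_ball_of_dim_even (k := 2) (by rw [finrankH]), finrankH]
  rw [← ENNReal.ofReal_pow hr, ← ENNReal.ofReal_mul (by positivity)]
  congr 1
  norm_num [Nat.factorial]
  ring

theorem IsLat.minkowski {K : Submodule ℤ H} (h : IsLat K) {r : ℝ} (hr : 0 ≤ r)
    (hc : 16 * cov K < Real.pi ^ 2 / 2 * r ^ 4) : ∃ x ∈ K, x ≠ 0 ∧ ‖x‖ < r := by
  obtain ⟨b, rfl⟩ := h.basis_ex
  have fund := ZSpan.isAddFundamentalDomain b (volume : Measure H)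
  have hcov : cov (span ℤ (Set.range b)) = volume.real (ZSpan.fundamentalDomain b) := by
    have := cov_span_aux b b
    rw [this, Basis.det_self]; simp
  have hne : volume (ZSpan.fundamentalDomain b) ≠ ⊤ :=
    (Bornology.IsBounded.measure_lt_top (ZSpan.fundamentalDomain_isBounded b)).ne
  have : Countable (span ℤ (Set.range b)).toAddSubgroup :=
    (inferInstance : Countable (span ℤ (Set.range b)))
  have key := exists_ne_zero_mem_lattice_of_measure_mul_two_pow_lt_measure
    (s := Metric.ball (0 : H) r) (μ := volume) (L := (span ℤ (Set.range b)).toAddSubgroup) fund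
    (by intro x hx; simpa using hx) (convex_ball _ _)
    (by
      rw [volume_ballH r hr, finrankH, ← ENNReal.ofReal_toReal hne]
      rw [hcov, measureReal_def] at hc
      have : (2 : ENNReal) ^ 4 = ENNReal.ofReal 16 := by
        rw [show (16 : ℝ) = 2 ^ 4 by norm_num, ENNReal.ofReal_pow (by norm_num)]
        norm_num
      rw [this, ← ENNReal.ofReal_mul ENNReal.toReal_nonneg]
      rw [ENNReal.ofReal_lt_ofReal_iff_of_nonneg (by positivity)]
      linarith)
  obtain ⟨x, hx0, hx⟩ := key
  refine ⟨x, x.2, ?_, by simpa using hx⟩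
  intro h0; exact hx0 (Subtype.ext h0)

/-- number of lattice points of norm at most `X` -/
noncomputable def cnt (K : Submodule ℤ H) (X : ℝ) : ℕ :=
  Nat.card {x : H // x ∈ K ∧ Quaternion.normSq x ≤ X}

theorem IsLat.finite {K : Submodule ℤ H} (h : IsLat K) (X : ℝ) :
    {x : H | x ∈ K ∧ Quaternion.normSq x ≤ X}.Finite := by
  have := h.disc
  have h1 : IsClosed (K.toAddSubgroup : Set H) := by
    have : DiscreteTopology K.toAddSubgroup := h.disc
    exact AddSubgroup.isClosed_of_discrete
  have h2 := Metric.finite_isBounded_inter_isClosed (K := Metric.closedBall (0 : H) (Real.sqrt X))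
    (s := (K.toAddSubgroup : Set H)) ⟨h.disc⟩ Metric.isBounded_closedBall h1
  refine h2.subset ?_
  rintro x ⟨hx, hxX⟩
  refine ⟨?_, hx⟩
  rw [mem_closedBall_zero_iff]
  rw [Quaternion.normSq_eq_norm_mul_self] at hxX
  exact Real.le_sqrt_of_sq_le (by rw [sq]; exact hxX)

theorem IsLat.asym {K : Submodule ℤ H} (h : IsLat K) :
    Tendsto (fun X : ℝ => (cnt K X : ℝ) / X ^ 2) atTop (𝓝 (Real.pi ^ 2 / 2 / cov K)) := by
  have := h.disc; have := h.zl
  have hset : {x : H | x ∈ (Set.univ : Set H) ∧ ‖x‖ ^ 4 ≤ 1} = Metric.closedBall 0 1 := by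
    ext x
    simp only [Set.mem_univ, true_and, Set.mem_ofPred_eq, mem_closedBall_zero_iff]
    exact pow_le_one_iff_of_nonneg (norm_nonneg x) (by norm_num)
  have key := ZLattice.covolume.tendsto_card_le_div' K (X := Set.univ) (F := fun x : H => ‖x‖ ^ 4)
    (by intros; trivial) (by intro x r hr; rw [norm_smul, mul_pow, finrankH, Real.norm_of_nonneg hr])
    (by rw [hset]; exact Metric.isBounded_closedBall)
    (by rw [hset]; exact Metric.isClosed_closedBall.measurableSet)
    (by rw [hset, frontier_closedBall _ one_ne_zero]; exact Measure.addHaar_sphere _ _ _)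
  have hv : volume.real {x : H | x ∈ (Set.univ : Set H) ∧ ‖x‖ ^ 4 ≤ 1} = Real.pi ^ 2 / 2 := by
    rw [hset, measureReal_def, Measure.addHaar_closedBall_eq_addHaar_ball, volume_ballH 1 (by norm_num),
      ENNReal.toReal_ofReal (by positivity)]
    ring
  rw [hv] at key
  have h2 : Tendsto (fun X : ℝ => X ^ 2) atTop atTop := tendsto_pow_atTop (by norm_num)
  refine (key.comp h2).congr' ?_
  filter_upwards [eventually_ge_atTop 0] with X hX
  simp only [Function.comp, cnt]
  congr 2
  refine Nat.card_congr (Equiv.subtypeEquivRight ?_)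
  intro x
  simp only [Set.mem_univ, true_and, Set.mem_inter_iff, Set.mem_ofPred_eq, SetLike.mem_coe]
  rw [and_comm]
  refine and_congr_right fun _ => ?_
  rw [Quaternion.normSq_eq_norm_mul_self, show ‖x‖ ^ 4 = (‖x‖ * ‖x‖) ^ 2 by ring]
  exact pow_le_pow_iff_left₀ (by positivity) hX (by norm_num)

end MF

namespace MF
open Module MeasureTheory Filter Topology Submodule

/-- the lattice spanned by one element -/
noncomputable abbrev sp (x : H) : Submodule ℤ H := span ℤ {x}

theorem sp_mul_sp (x y : H) : sp x * sp y = sp (x * y) := by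
  rw [sp, sp, span_mul_span, Set.singleton_mul_singleton]

theorem sp_one : sp 1 = 1 := (Submodule.one_eq_span).symm

theorem mem_sp (x : H) : x ∈ sp x := mem_span_singleton_self x

theorem mem_sp_mul {x y : H} {K : Submodule ℤ H} : y ∈ sp x * K ↔ ∃ z ∈ K, x * z = y :=
  mem_span_singleton_mul

theorem mem_mul_sp {x y : H} {K : Submodule ℤ H} : y ∈ K * sp x ↔ ∃ z ∈ K, z * x = y :=
  mem_mul_span_singleton

theorem real_comm (r : ℝ) (x : H) : (r : H) * x = x * (r : H) := Quaternion.coe_commutes r x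

theorem sp_comm (r : ℝ) (K : Submodule ℤ H) : sp (r : H) * K = K * sp (r : H) := by
  ext x
  rw [mem_sp_mul, mem_mul_sp]
  simp only [real_comm]

theorem sp_inv_mul {x : H} (hx : x ≠ 0) : sp x⁻¹ * sp x = 1 := by
  rw [sp_mul_sp, inv_mul_cancel₀ hx, sp_one]

theorem sp_mul_inv {x : H} (hx : x ≠ 0) : sp x * sp x⁻¹ = 1 := by
  rw [sp_mul_sp, mul_inv_cancel₀ hx, sp_one]

theorem sp_le {x : H} {K : Submodule ℤ H} : sp x ≤ K ↔ x ∈ K := span_singleton_le_iff_mem x K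

/-- conjugate lattice -/
noncomputable def cj (K : Submodule ℤ H) : Submodule ℤ H :=
  K.map (starAddEquiv (R := H)).toAddMonoidHom.toIntLinearMap

theorem mem_cj {K : Submodule ℤ H} {x : H} : x ∈ cj K ↔ star x ∈ K := by
  unfold cj
  rw [Submodule.mem_map]
  constructor
  · rintro ⟨y, hy, rfl⟩
    change star (star y) ∈ K
    rwa [star_star]
  · intro h
    exact ⟨star x, h, star_star x⟩

theorem star_mem_cj {K : Submodule ℤ H} {x : H} (h : x ∈ K) : star x ∈ cj K := by
  rw [mem_cj, star_star]; exact h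

@[simp] theorem cj_cj (K : Submodule ℤ H) : cj (cj K) = K := by
  ext x; rw [mem_cj, mem_cj, star_star]

theorem cj_mono {K M : Submodule ℤ H} (h : K ≤ M) : cj K ≤ cj M := by
  intro x hx; rw [mem_cj] at *; exact h hx

theorem cj_mul_le (K M : Submodule ℤ H) : cj (K * M) ≤ cj M * cj K := by
  have : K * M ≤ cj (cj M * cj K) := by
    rw [mul_le]
    intro a ha b hb
    rw [mem_cj, star_mul]
    exact mul_mem_mul (star_mem_cj hb) (star_mem_cj ha)
  simpa using cj_mono this

theorem cj_mul (K M : Submodule ℤ H) : cj (K * M) = cj M * cj K := by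
  refine le_antisymm (cj_mul_le K M) ?_
  have := cj_mono (cj_mul_le (cj M) (cj K))
  simpa using this

theorem cj_sp (x : H) : cj (sp x) = sp (star x) := by
  refine le_antisymm ?_ ?_
  · have : sp x ≤ cj (sp (star x)) := by rw [sp_le, mem_cj]; exact mem_sp _
    simpa using cj_mono this
  · rw [sp_le]; exact star_mem_cj (mem_sp x)

theorem cj_sp_real (r : ℝ) : cj (sp (r : H)) = sp (r : H) := by
  rw [cj_sp, Quaternion.star_coe]

/-- the standard vectors -/
def qb : Fin 4 → H := ![⟨1, 0, 0, 0⟩, ⟨0, 1, 0, 0⟩, ⟨0, 0, 1, 0⟩, ⟨0, 0, 0, 1⟩]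

theorem det4 (M : Matrix (Fin 4) (Fin 4) ℝ) : M.det =
    M 0 0 * (M 1 1 * (M 2 2 * M 3 3 - M 2 3 * M 3 2) - M 1 2 * (M 2 1 * M 3 3 - M 2 3 * M 3 1) + M 1 3 * (M 2 1 * M 3 2 - M 2 2 * M 3 1))
    - M 0 1 * (M 1 0 * (M 2 2 * M 3 3 - M 2 3 * M 3 2) - M 1 2 * (M 2 0 * M 3 3 - M 2 3 * M 3 0) + M 1 3 * (M 2 0 * M 3 2 - M 2 2 * M 3 0))
    + M 0 2 * (M 1 0 * (M 2 1 * M 3 3 - M 2 3 * M 3 1) - M 1 1 * (M 2 0 * M 3 3 - M 2 3 * M 3 0) + M 1 3 * (M 2 0 * M 3 1 - M 2 1 * M 3 0))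
    - M 0 3 * (M 1 0 * (M 2 1 * M 3 2 - M 2 2 * M 3 1) - M 1 1 * (M 2 0 * M 3 2 - M 2 2 * M 3 0) + M 1 2 * (M 2 0 * M 3 1 - M 2 1 * M 3 0)) := by
  rw [Matrix.det_succ_row_zero]
  simp only [Fin.sum_univ_succ, Matrix.det_fin_three, Matrix.submatrix_apply]
  simp [Fin.succAbove, Fin.lt_def]
  ring

theorem abs_det_eq (f : H ≃ₗ[ℝ] H) (d : ℝ)
    (h : (Matrix.of fun i j => coo (f (qb i)) j).det = d) (hd : d ≠ 0) :
    |LinearMap.det (f : H →ₗ[ℝ] H)| = |d| := by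
  have h1 : (Matrix.of fun i j => coo (qb i) j).det = 1 := by
    rw [det4]; simp [coo, qb]
  obtain ⟨h2, h3⟩ := cov_span qb (by rw [h1]; norm_num)
  obtain ⟨h4, h5⟩ := cov_span (f ∘ qb) (by simp only [Function.comp, h]; exact hd)
  have h6 := h2.cov_map f
  rw [lmap_span] at h6
  rw [h3, h1] at h6
  simp only [LinearEquiv.coe_coe] at h6
  rw [h5] at h6
  simp only [Function.comp, h, abs_one, mul_one] at h6
  exact h6.symm

/-- left multiplication by a nonzero element -/
noncomputable def mulL (x : H) (hx : x ≠ 0) : H ≃ₗ[ℝ] H where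
  toFun y := x * y
  invFun y := x⁻¹ * y
  map_add' := mul_add x
  map_smul' r y := by simp
  left_inv y := by simp [← mul_assoc, inv_mul_cancel₀ hx]
  right_inv y := by simp [← mul_assoc, mul_inv_cancel₀ hx]

/-- right multiplication by a nonzero element -/
noncomputable def mulR (x : H) (hx : x ≠ 0) : H ≃ₗ[ℝ] H where
  toFun y := y * x
  invFun y := y * x⁻¹
  map_add' a b := add_mul a b x
  map_smul' r y := by simp
  left_inv y := by simp [mul_assoc, mul_inv_cancel₀ hx]
  right_inv y := by simp [mul_assoc, inv_mul_cancel₀ hx]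

/-- conjugation as linear equiv -/
noncomputable def starL : H ≃ₗ[ℝ] H where
  toFun y := star y
  invFun y := star y
  map_add' a b := star_add a b
  map_smul' r y := by simp
  left_inv y := star_star y
  right_inv y := star_star y

theorem lmap_mulL (x : H) (hx : x ≠ 0) (K : Submodule ℤ H) : lmap (mulL x hx) K = sp x * K := by
  ext y; rw [mem_sp_mul, Submodule.mem_map]; rfl

theorem lmap_mulR (x : H) (hx : x ≠ 0) (K : Submodule ℤ H) : lmap (mulR x hx) K = K * sp x := by
  ext y; rw [mem_mul_sp, Submodule.mem_map]; rfl

theorem lmap_star (K : Submodule ℤ H) : lmap starL K = cj K := by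
  ext y; rw [cj, Submodule.mem_map, Submodule.mem_map]; rfl

theorem normSq_pos {x : H} (hx : x ≠ 0) : 0 < Quaternion.normSq x :=
  lt_of_le_of_ne (Quaternion.normSq_nonneg) (Ne.symm (by rwa [Ne, Quaternion.normSq_eq_zero]))

theorem det_mulL (x : H) (hx : x ≠ 0) :
    |LinearMap.det (mulL x hx : H →ₗ[ℝ] H)| = Quaternion.normSq x ^ 2 := by
  rw [abs_det_eq (mulL x hx) (Quaternion.normSq x ^ 2) _ (pow_pos (normSq_pos hx) 2).ne', abs_of_nonneg (by positivity)]
  rw [det4, Quaternion.normSq_def']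
  simp [coo, qb, mulL]
  ring

theorem det_mulR (x : H) (hx : x ≠ 0) :
    |LinearMap.det (mulR x hx : H →ₗ[ℝ] H)| = Quaternion.normSq x ^ 2 := by
  rw [abs_det_eq (mulR x hx) (Quaternion.normSq x ^ 2) _ (pow_pos (normSq_pos hx) 2).ne', abs_of_nonneg (by positivity)]
  rw [det4, Quaternion.normSq_def']
  simp [coo, qb, mulR]
  ring

theorem det_starL : |LinearMap.det (starL : H →ₗ[ℝ] H)| = 1 := by
  rw [abs_det_eq starL (-1) _ (by norm_num)]
  · simp
  · rw [det4]
    simp [coo, qb, starL]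

theorem IsLat.spL {K : Submodule ℤ H} (h : IsLat K) {x : H} (hx : x ≠ 0) :
    IsLat (sp x * K) ∧ cov (sp x * K) = Quaternion.normSq x ^ 2 * cov K := by
  rw [← lmap_mulL x hx, ← det_mulL x hx]
  exact ⟨h.map _, h.cov_map _⟩

theorem IsLat.spR {K : Submodule ℤ H} (h : IsLat K) {x : H} (hx : x ≠ 0) :
    IsLat (K * sp x) ∧ cov (K * sp x) = Quaternion.normSq x ^ 2 * cov K := by
  rw [← lmap_mulR x hx, ← det_mulR x hx]
  exact ⟨h.map _, h.cov_map _⟩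

theorem IsLat.cjL {K : Submodule ℤ H} (h : IsLat K) : IsLat (cj K) ∧ cov (cj K) = cov K := by
  rw [← lmap_star]
  refine ⟨h.map _, ?_⟩
  rw [h.cov_map, det_starL, one_mul]

end MF

namespace MF
open Module MeasureTheory Filter Topology Submodule

local notation "N" => Quaternion.normSq

/-- twice the inner product of two pure quaternions -/
noncomputable def T2 (x y : H) : ℝ := -2 * (x * y).re

theorem nsq (a : H) : N a = a.re * a.re + a.imI * a.imI + a.imJ * a.imJ + a.imK * a.imK := by
  rw [Quaternion.normSq_def']; ring

section ident
variable {f1 f2 f3 : H}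

theorem id_sq (h1 : f1.re = 0) : f1 * f1 = -((N f1 : ℝ) : H) := by
  ext <;> simp [h1, nsq] <;> ring

theorem id_anti (h1 : f1.re = 0) (h2 : f2.re = 0) : f2 * f1 = -((T2 f1 f2 : ℝ) : H) - f1 * f2 := by
  ext <;> simp [T2, h1, h2] <;> ring

theorem T2_comm (x y : H) : T2 x y = T2 y x := by
  simp [T2]; ring

theorem id_ii (h2 : f2.re = 0) (h3 : f3.re = 0) :
    (f2 * f3) * (f2 * f3) = -((N f2 * N f3 : ℝ) : H) - ((T2 f2 f3 : ℝ) : H) * (f2 * f3) := by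
  ext <;> simp [T2, h2, h3, nsq] <;> ring

theorem id_ij (h1 : f1.re = 0) (h2 : f2.re = 0) (h3 : f3.re = 0) :
    (f2 * f3) * (f3 * f1) = ((N f3 * T2 f1 f2 : ℝ) : H) + ((N f3 : ℝ) : H) * (f1 * f2) := by
  ext <;> simp [T2, h1, h2, h3, nsq] <;> ring

theorem id_ji (h1 : f1.re = 0) (h2 : f2.re = 0) (h3 : f3.re = 0) :
    (f3 * f1) * (f2 * f3) = -((T2 f2 f3 * T2 f1 f3 : ℝ) : H) - ((T2 f1 f3 : ℝ) : H) * (f2 * f3)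
      - ((T2 f2 f3 : ℝ) : H) * (f3 * f1) - ((N f3 : ℝ) : H) * (f1 * f2) := by
  ext <;> simp [T2, h1, h2, h3, nsq] <;> ring

theorem id_e1w (h1 : f1.re = 0) :
    f1 * (f1 * f2 * f3) = -((N f1 : ℝ) : H) * (f2 * f3) := by
  rw [mul_assoc f1 f2 f3, ← mul_assoc f1 f1, id_sq h1]

theorem id_e2w (h1 : f1.re = 0) (h2 : f2.re = 0) (h3 : f3.re = 0) :
    f2 * (f1 * f2 * f3) = -((N f2 * T2 f1 f3 : ℝ) : H) - ((T2 f1 f2 : ℝ) : H) * (f2 * f3)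
      - ((N f2 : ℝ) : H) * (f3 * f1) := by
  ext <;> simp [T2, h1, h2, h3, nsq] <;> ring

theorem id_we2 (h1 : f1.re = 0) (h2 : f2.re = 0) (h3 : f3.re = 0) :
    (f1 * f2 * f3) * f2 = -((N f2 * T2 f1 f3 : ℝ) : H) - ((T2 f2 f3 : ℝ) : H) * (f1 * f2)
      - ((N f2 : ℝ) : H) * (f3 * f1) := by
  ext <;> simp [T2, h1, h2, h3, nsq] <;> ring

theorem id_we3 (h3 : f3.re = 0) :
    (f1 * f2 * f3) * f3 = -((N f3 : ℝ) : H) * (f1 * f2) := by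
  rw [mul_assoc, id_sq h3, ← Quaternion.coe_neg, real_comm]

theorem id_ww (h1 : f1.re = 0) (h2 : f2.re = 0) (h3 : f3.re = 0) :
    (f1 * f2 * f3) * (f1 * f2 * f3) =
      ((N f1 * N f2 * N f3 + T2 f2 f3 * T2 f1 f3 * T2 f1 f2 - N f2 * (T2 f1 f3 * T2 f1 f3) : ℝ) : H)
      + ((N f1 * T2 f2 f3 : ℝ) : H) * (f2 * f3)
      + ((T2 f2 f3 * T2 f1 f2 - N f2 * T2 f1 f3 : ℝ) : H) * (f3 * f1)
      + ((N f3 * T2 f1 f2 : ℝ) : H) * (f1 * f2) := by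
  ext <;> simp [T2, h1, h2, h3, nsq] <;> ring

theorem id_disc (h1 : f1.re = 0) (h2 : f2.re = 0) (h3 : f3.re = 0) :
    (2 * (f1 * f2 * f3).re) ^ 2 = 4 * N f1 * N f2 * N f3 + T2 f2 f3 * T2 f1 f3 * T2 f1 f2
      - N f1 * T2 f2 f3 ^ 2 - N f2 * T2 f1 f3 ^ 2 - N f3 * T2 f1 f2 ^ 2 := by
  simp [Quaternion.normSq_def', T2, h1, h2, h3]; ring

theorem id_dual (h1 : f1.re = 0) (h2 : f2.re = 0) (h3 : f3.re = 0) (x : H) :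
    ((2 * (f1 * f2 * f3).re : ℝ) : H) * x = ((2 * x.re : ℝ) : H) * (f1 * f2 * f3 + ((T2 f2 f3 : ℝ) : H) * f1
      + ((T2 f1 f2 : ℝ) : H) * f3) + ((2 * (x * (f2 * f3)).re : ℝ) : H) * f1
      + ((2 * (x * (f3 * f1)).re : ℝ) : H) * f2 + ((2 * (x * (f1 * f2)).re : ℝ) : H) * f3 := by
  ext <;> simp [T2, h1, h2, h3] <;> ring

theorem id_tsum (h1 : f1.re = 0) (h2 : f2.re = 0) (h3 : f3.re = 0) (x : H) :
    ((2 * (f1 * f2 * f3).re * (2 * x.re) : ℝ) : H) = x * (f1 * f2 * f3 + ((T2 f2 f3 : ℝ) : H) * f1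
      + ((T2 f1 f2 : ℝ) : H) * f3) + (f2 * f3) * x * f1
      + (f3 * f1) * x * f2 + (f1 * f2) * x * f3 := by
  ext <;> simp [T2, h1, h2, h3] <;> ring

theorem id_tr_ei (h1 : f1.re = 0) (h2 : f2.re = 0) (h3 : f3.re = 0) :
    (f1 * (f2 * f3)).re = (f1 * f2 * f3).re ∧ (f2 * (f3 * f1)).re = (f1 * f2 * f3).re ∧
    (f3 * (f1 * f2)).re = (f1 * f2 * f3).re ∧ (f1 * (f3 * f1)).re = 0 ∧ (f1 * (f1 * f2)).re = 0 ∧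
    (f2 * (f2 * f3)).re = 0 ∧ (f2 * (f1 * f2)).re = 0 ∧ (f3 * (f2 * f3)).re = 0 ∧
    (f3 * (f3 * f1)).re = 0 := by
  refine ⟨?_, ?_, ?_, ?_, ?_, ?_, ?_, ?_, ?_⟩ <;> simp [h1, h2, h3] <;> ring

theorem id_cov (h1 : f1.re = 0) (h2 : f2.re = 0) (h3 : f3.re = 0) :
    (Matrix.of fun i j => coo ((![1, f2 * f3, f3 * f1, f1 * f2] : Fin 4 → H) i) j).det
      = (f1 * f2 * f3).re ^ 2 := by
  rw [det4]
  simp [coo, h1, h2, h3, Quaternion.re_one, Quaternion.imI_one, Quaternion.imJ_one, Quaternion.imK_one]; ring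

end ident

end MF

namespace MF
open Module MeasureTheory Filter Topology Submodule

local notation "N" => Quaternion.normSq

/-- a positive ternary lattice of pure quaternions of discriminant `p` -/
structure TL (p : ℕ) where
  e1 : H
  e2 : H
  e3 : H
  h1 : e1.re = 0
  h2 : e2.re = 0
  h3 : e3.re = 0
  a : ℤ
  b : ℤ
  c : ℤ
  u : ℤ
  v : ℤ
  w : ℤ
  ha : N e1 = a
  hb : N e2 = b
  hc : N e3 = c
  hu : T2 e2 e3 = u
  hv : T2 e1 e3 = v
  hw : T2 e1 e2 = w
  hor : 2 * (e1 * e2 * e3).re = √(p : ℝ)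

/-- the quaternion order package attached to a ternary lattice -/
structure Ord (p : ℕ) (O C : Submodule ℤ H) : Prop where
  one_mem : (1 : H) ∈ O
  OO : O * O = O
  cjO : cj O = O
  int : ∀ r : ℝ, (r : H) ∈ O → ∃ n : ℤ, r = n
  trO : ∀ x ∈ O, ∃ n : ℤ, 2 * x.re = n
  tr1 : ∃ x ∈ O, 2 * x.re = 1
  memC : ∀ x, x ∈ C ↔ ∀ o ∈ O, ∃ m : ℤ, 2 * (x * o).re = √(p : ℝ) * m
  OC : O * C = C
  CO : C * O = C
  cjC : cj C = C
  CC : C * C = O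
  sqC : ((√(p : ℝ) : ℝ) : H) ∈ C
  tsum : ∀ t : H, ((√(p : ℝ) * (2 * t.re) : ℝ) : H) ∈ O * sp t * C
  lat : IsLat O
  covO : cov O = p / 4

theorem mem4 (v0 v1 v2 v3 x : H) : x ∈ span ℤ (Set.range (![v0, v1, v2, v3] : Fin 4 → H)) ↔
    ∃ n0 n1 n2 n3 : ℤ, x = n0 * v0 + n1 * v1 + n2 * v2 + n3 * v3 := by
  rw [mem_span_range_iff_exists_fun]
  constructor
  · rintro ⟨c, rfl⟩
    refine ⟨c 0, c 1, c 2, c 3, ?_⟩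
    simp [Fin.sum_univ_four]
  · rintro ⟨n0, n1, n2, n3, rfl⟩
    refine ⟨![n0, n1, n2, n3], ?_⟩
    simp [Fin.sum_univ_four]

theorem int_mul_mem {K : Submodule ℤ H} {x : H} (n : ℤ) (h : x ∈ K) : (n : H) * x ∈ K := by
  rw [← zsmul_eq_mul]; exact K.smul_mem n h

theorem re_cycl (x y : H) : (x * y).re = (y * x).re := by
  simp; ring

namespace TL
variable {p : ℕ} (t : TL p)

/-- the order -/
noncomputable def O : Submodule ℤ H :=
  span ℤ (Set.range (![1, t.e2 * t.e3, t.e3 * t.e1, t.e1 * t.e2] : Fin 4 → H))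

/-- the dual lattice -/
noncomputable def C : Submodule ℤ H :=
  span ℤ (Set.range (![t.e1, t.e2, t.e3, t.e1 * t.e2 * t.e3] : Fin 4 → H))

/-- the ternary lattice -/
noncomputable def L : Submodule ℤ H :=
  span ℤ (Set.range (![t.e1, t.e2, t.e3] : Fin 3 → H))

theorem mem_O {x : H} : x ∈ t.O ↔ ∃ n0 n1 n2 n3 : ℤ,
    x = n0 * 1 + n1 * (t.e2 * t.e3) + n2 * (t.e3 * t.e1) + n3 * (t.e1 * t.e2) := mem4 _ _ _ _ _

theorem mem_C {x : H} : x ∈ t.C ↔ ∃ n0 n1 n2 n3 : ℤ,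
    x = n0 * t.e1 + n1 * t.e2 + n2 * t.e3 + n3 * (t.e1 * t.e2 * t.e3) := mem4 _ _ _ _ _

theorem mem_L {x : H} : x ∈ t.L ↔ ∃ n0 n1 n2 : ℤ, x = n0 * t.e1 + n1 * t.e2 + n2 * t.e3 := by
  rw [L, mem_span_range_iff_exists_fun]
  constructor
  · rintro ⟨c, rfl⟩
    refine ⟨c 0, c 1, c 2, ?_⟩
    simp [Fin.sum_univ_three]
  · rintro ⟨n0, n1, n2, rfl⟩
    refine ⟨![n0, n1, n2], ?_⟩
    simp [Fin.sum_univ_three]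

theorem one_O : (1 : H) ∈ t.O := t.mem_O.2 ⟨1, 0, 0, 0, by simp⟩
theorem i_O : t.e2 * t.e3 ∈ t.O := t.mem_O.2 ⟨0, 1, 0, 0, by simp⟩
theorem j_O : t.e3 * t.e1 ∈ t.O := t.mem_O.2 ⟨0, 0, 1, 0, by simp⟩
theorem k_O : t.e1 * t.e2 ∈ t.O := t.mem_O.2 ⟨0, 0, 0, 1, by simp⟩
theorem e1_C : t.e1 ∈ t.C := t.mem_C.2 ⟨1, 0, 0, 0, by simp⟩
theorem e2_C : t.e2 ∈ t.C := t.mem_C.2 ⟨0, 1, 0, 0, by simp⟩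
theorem e3_C : t.e3 ∈ t.C := t.mem_C.2 ⟨0, 0, 1, 0, by simp⟩
theorem w_C : t.e1 * t.e2 * t.e3 ∈ t.C := t.mem_C.2 ⟨0, 0, 0, 1, by simp⟩

theorem int_O (n : ℤ) : (n : H) ∈ t.O := t.mem_O.2 ⟨n, 0, 0, 0, by simp⟩

theorem nat_disc : (4 * t.a * t.b * t.c + t.u * t.v * t.w - t.a * t.u ^ 2 - t.b * t.v ^ 2
    - t.c * t.w ^ 2 : ℤ) = p := by
  have h := id_disc t.h1 t.h2 t.h3
  rw [t.hor, t.ha, t.hb, t.hc, t.hu, t.hv, t.hw, Real.sq_sqrt (by positivity)] at h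
  exact_mod_cast h.symm

theorem mul_mem_of4 {A K : Submodule ℤ H} {v0 v1 v2 v3 : H}
    (h : A = span ℤ (Set.range (![v0, v1, v2, v3] : Fin 4 → H))) {x : H}
    (k0 : v0 * x ∈ K) (k1 : v1 * x ∈ K) (k2 : v2 * x ∈ K) (k3 : v3 * x ∈ K) :
    ∀ y ∈ A, y * x ∈ K := by
  intro y hy
  rw [h, mem4] at hy
  obtain ⟨n0, n1, n2, n3, rfl⟩ := hy
  simp only [add_mul, mul_assoc]
  exact K.add_mem (K.add_mem (K.add_mem (int_mul_mem _ k0) (int_mul_mem _ k1)) (int_mul_mem _ k2))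
    (int_mul_mem _ k3)

theorem mul_mem_of4' {A K : Submodule ℤ H} {v0 v1 v2 v3 : H}
    (h : A = span ℤ (Set.range (![v0, v1, v2, v3] : Fin 4 → H))) {x : H}
    (k0 : x * v0 ∈ K) (k1 : x * v1 ∈ K) (k2 : x * v2 ∈ K) (k3 : x * v3 ∈ K) :
    ∀ y ∈ A, x * y ∈ K := by
  intro y hy
  rw [h, mem4] at hy
  obtain ⟨n0, n1, n2, n3, rfl⟩ := hy
  simp only [mul_add, ← mul_assoc, ← Int.cast_comm]
  simp only [mul_assoc]
  exact K.add_mem (K.add_mem (K.add_mem (int_mul_mem _ k0) (int_mul_mem _ k1)) (int_mul_mem _ k2))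
    (int_mul_mem _ k3)

theorem icoe (n : ℤ) : (((n : ℤ) : ℝ) : H) = (n : H) := by norm_cast

theorem OO_le : t.O * t.O ≤ t.O := by
  have hN : ∀ n : ℤ, ∀ x ∈ t.O, (n : H) * x ∈ t.O := fun n x hx => int_mul_mem n hx
  have hI := t.int_O
  have ii := id_ii t.h2 t.h3
  have jj := id_ii t.h3 t.h1
  have kk := id_ii t.h1 t.h2
  have ij := id_ij t.h1 t.h2 t.h3
  have jk := id_ij t.h2 t.h3 t.h1
  have ki := id_ij t.h3 t.h1 t.h2
  have ji := id_ji t.h1 t.h2 t.h3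
  have kj := id_ji t.h2 t.h3 t.h1
  have ik := id_ji t.h3 t.h1 t.h2
  simp only [T2_comm t.e2 t.e1, T2_comm t.e3 t.e1, T2_comm t.e3 t.e2, t.ha, t.hb, t.hc, t.hu, t.hv,
    t.hw, Quaternion.coe_mul, icoe, ← Int.cast_mul, ← Int.cast_neg] at ii jj kk ij jk ki ji kj ik
  have i := t.i_O
  have j := t.j_O
  have k := t.k_O
  have add : ∀ {x y}, x ∈ t.O → y ∈ t.O → x + y ∈ t.O := fun hx hy => t.O.add_mem hx hy
  have sub : ∀ {x y}, x ∈ t.O → y ∈ t.O → x - y ∈ t.O := fun hx hy => t.O.sub_mem hx hy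
  rw [mul_le]
  intro m hm n hn
  refine mul_mem_of4 rfl ?_ ?_ ?_ ?_ m hm
  · rwa [one_mul]
  · refine mul_mem_of4' rfl (by rwa [mul_one]) ?_ ?_ ?_ n hn
    · rw [ii]; exact sub (hI _) (hN _ _ i)
    · rw [ij]; exact add (hI _) (hN _ _ k)
    · rw [ik]; exact sub (sub (sub (hI _) (hN _ _ k)) (hN _ _ i)) (hN _ _ j)
  · refine mul_mem_of4' rfl (by rwa [mul_one]) ?_ ?_ ?_ n hn
    · rw [ji]; exact sub (sub (sub (hI _) (hN _ _ i)) (hN _ _ j)) (hN _ _ k)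
    · rw [jj]; exact sub (hI _) (hN _ _ j)
    · rw [jk]; exact add (hI _) (hN _ _ i)
  · refine mul_mem_of4' rfl (by rwa [mul_one]) ?_ ?_ ?_ n hn
    · rw [ki]; exact add (hI _) (hN _ _ j)
    · rw [kj]; exact sub (sub (sub (hI _) (hN _ _ j)) (hN _ _ k)) (hN _ _ i)
    · rw [kk]; exact sub (hI _) (hN _ _ k)

theorem anti : t.e2 * t.e1 = -(t.w : H) - t.e1 * t.e2 ∧ t.e3 * t.e2 = -(t.u : H) - t.e2 * t.e3 ∧
    t.e1 * t.e3 = -(t.v : H) - t.e3 * t.e1 := by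
  refine ⟨?_, ?_, ?_⟩
  · rw [id_anti t.h1 t.h2, t.hw, icoe]
  · rw [id_anti t.h2 t.h3, t.hu, icoe]
  · rw [id_anti t.h3 t.h1, T2_comm, t.hv, icoe]

theorem sqs : t.e1 * t.e1 = -(t.a : H) ∧ t.e2 * t.e2 = -(t.b : H) ∧ t.e3 * t.e3 = -(t.c : H) := by
  refine ⟨?_, ?_, ?_⟩
  · rw [id_sq t.h1, t.ha, icoe]
  · rw [id_sq t.h2, t.hb, icoe]
  · rw [id_sq t.h3, t.hc, icoe]

theorem CC_le : t.C * t.C ≤ t.O := by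
  have hN : ∀ n : ℤ, ∀ x ∈ t.O, (n : H) * x ∈ t.O := fun n x hx => int_mul_mem n hx
  have hI := t.int_O
  obtain ⟨s1, s2, s3⟩ := t.sqs
  obtain ⟨a21, a32, a13⟩ := t.anti
  have e1w := id_e1w (f2 := t.e2) (f3 := t.e3) t.h1
  have e2w := id_e2w t.h1 t.h2 t.h3
  have e3w := id_ji t.h1 t.h2 t.h3
  have we1 := id_ji t.h2 t.h3 t.h1
  have we2 := id_we2 t.h1 t.h2 t.h3
  have we3 := id_we3 (f1 := t.e1) (f2 := t.e2) t.h3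
  have ww := id_ww t.h1 t.h2 t.h3
  rw [mul_assoc t.e3, ← mul_assoc t.e1] at e3w
  rw [← mul_assoc (t.e1 * t.e2)] at we1
  simp only [T2_comm t.e2 t.e1, T2_comm t.e3 t.e1, T2_comm t.e3 t.e2, t.ha, t.hb, t.hc, t.hu, t.hv,
    t.hw, Quaternion.coe_mul, Quaternion.coe_add, Quaternion.coe_sub, icoe, ← Int.cast_mul,
    ← Int.cast_neg, ← Int.cast_add, ← Int.cast_sub] at *
  have i := t.i_O
  have j := t.j_O
  have k := t.k_O
  have add : ∀ {x y}, x ∈ t.O → y ∈ t.O → x + y ∈ t.O := fun hx hy => t.O.add_mem hx hy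
  have sub : ∀ {x y}, x ∈ t.O → y ∈ t.O → x - y ∈ t.O := fun hx hy => t.O.sub_mem hx hy
  rw [mul_le]
  intro m hm n hn
  refine mul_mem_of4 rfl ?_ ?_ ?_ ?_ m hm
  · refine mul_mem_of4' rfl ?_ k ?_ ?_ n hn
    · rw [s1]; exact hI _
    · rw [a13]; exact sub (hI _) j
    · rw [e1w]; exact hN _ _ i
  · refine mul_mem_of4' rfl ?_ ?_ i ?_ n hn
    · rw [a21]; exact sub (hI _) k
    · rw [s2]; exact hI _
    · rw [e2w]; exact sub (sub (hI _) (hN _ _ i)) (hN _ _ j)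
  · refine mul_mem_of4' rfl j ?_ ?_ ?_ n hn
    · rw [a32]; exact sub (hI _) i
    · rw [s3]; exact hI _
    · rw [e3w]; exact sub (sub (sub (hI _) (hN _ _ i)) (hN _ _ j)) (hN _ _ k)
  · refine mul_mem_of4' rfl ?_ ?_ ?_ ?_ n hn
    · rw [we1]; exact sub (sub (sub (hI _) (hN _ _ j)) (hN _ _ k)) (hN _ _ i)
    · rw [we2]; exact sub (sub (hI _) (hN _ _ k)) (hN _ _ j)
    · rw [we3]; exact hN _ _ k
    · rw [ww]; exact add (add (add (hI _) (hN _ _ i)) (hN _ _ j)) (hN _ _ k)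


theorem OO : t.O * t.O = t.O := by
  refine le_antisymm t.OO_le ?_
  intro x hx
  rw [← one_mul x]
  exact mul_mem_mul t.one_O hx

theorem trs (n0 n1 n2 n3 : ℤ) : let x : H := n0 * 1 + n1 * (t.e2 * t.e3) + n2 * (t.e3 * t.e1) + n3 * (t.e1 * t.e2)
    2 * x.re = (2 * n0 - n1 * t.u - n2 * t.v - n3 * t.w : ℤ) := by
  have hu := t.hu
  have hv := t.hv
  have hw := t.hw
  rw [T2_comm] at hv
  simp only [T2] at hu hv hw
  push_cast
  rw [← hu, ← hv, ← hw, ← icoe, ← icoe, ← icoe, ← icoe]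
  simp only [Quaternion.re_add, Quaternion.coe_mul_eq_smul, Quaternion.re_smul, Quaternion.re_one, smul_eq_mul]
  ring

theorem cjO_le : t.O ≤ cj t.O := by
  intro x hx
  rw [mem_cj]
  have h : star x = ((2 * x.re : ℝ) : H) - x := by
    ext <;> simp
    ring
  rw [h]
  refine t.O.sub_mem ?_ hx
  obtain ⟨n0, n1, n2, n3, rfl⟩ := t.mem_O.1 hx
  rw [t.trs, icoe]
  exact t.int_O _

theorem cjO : cj t.O = t.O := by
  refine le_antisymm ?_ t.cjO_le
  simpa using cj_mono t.cjO_le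

theorem tr_e (n0 n1 n2 n3 : ℤ) : let x : H := n0 * 1 + n1 * (t.e2 * t.e3) + n2 * (t.e3 * t.e1) + n3 * (t.e1 * t.e2)
    2 * (t.e1 * x).re = √(p : ℝ) * n1 ∧ 2 * (t.e2 * x).re = √(p : ℝ) * n2 ∧
    2 * (t.e3 * x).re = √(p : ℝ) * n3 := by
  obtain ⟨k1, k2, k3, k4, k5, k6, k7, k8, k9⟩ := id_tr_ei t.h1 t.h2 t.h3
  have hor := t.hor
  intro x
  have hx : x = (n0 : ℝ) • (1 : H) + (n1 : ℝ) • (t.e2 * t.e3) + (n2 : ℝ) • (t.e3 * t.e1) + (n3 : ℝ) • (t.e1 * t.e2) := by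
    simp only [← Quaternion.coe_mul_eq_smul, icoe]; rfl
  rw [hx]
  simp only [mul_add, mul_smul_comm, Quaternion.re_add, Quaternion.re_smul, smul_eq_mul, k1, k2, k3, k4, k5, k6,
    k7, k8, k9, mul_one, t.h1, t.h2, t.h3, ← hor]
  refine ⟨?_, ?_, ?_⟩ <;> ring

theorem p_pos [Fact p.Prime] : 0 < √(p : ℝ) := Real.sqrt_pos.2 (by exact_mod_cast (Fact.out : p.Prime).pos)

theorem int' [Fact p.Prime] (r : ℝ) (hr : (r : H) ∈ t.O) : ∃ n : ℤ, r = n := by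
  obtain ⟨n0, n1, n2, n3, h⟩ := t.mem_O.1 hr
  obtain ⟨k1, k2, k3⟩ := t.tr_e n0 n1 n2 n3
  have k0 := t.trs n0 n1 n2 n3
  have hp := p_pos (p := p)
  rw [← h] at k1 k2 k3 k0
  simp only [← real_comm, Quaternion.coe_mul_eq_smul, Quaternion.re_smul, t.h1, t.h2, t.h3, smul_zero, mul_zero,
    zero_eq_mul, hp.ne', false_or] at k1 k2 k3
  norm_cast at k1 k2 k3
  subst k1 k2 k3
  refine ⟨n0, ?_⟩
  push_cast at k0
  rw [Quaternion.re_coe] at k0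
  linarith

theorem tr1 [hp : Fact p.Prime] : ∃ x ∈ t.O, 2 * x.re = 1 := by
  have key : ∀ n0 n1 n2 n3 : ℤ, 2 * n0 - n1 * t.u - n2 * t.v - n3 * t.w = 1 → ∃ x ∈ t.O, 2 * x.re = 1 := by
    intro n0 n1 n2 n3 h
    refine ⟨_, t.mem_O.2 ⟨n0, n1, n2, n3, rfl⟩, ?_⟩
    rw [t.trs, h]; simp
  rcases Int.even_or_odd' t.u with ⟨u', hu | hu⟩
  swap
  · exact key (u' + 1) 1 0 0 (by rw [hu]; ring)
  rcases Int.even_or_odd' t.v with ⟨v', hv | hv⟩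
  swap
  · exact key (v' + 1) 0 1 0 (by rw [hv]; ring)
  rcases Int.even_or_odd' t.w with ⟨w', hw | hw⟩
  swap
  · exact key (w' + 1) 0 0 1 (by rw [hw]; ring)
  exfalso
  have hd := t.nat_disc
  rw [hu, hv, hw] at hd
  have h4 : (4 : ℤ) ∣ (p : ℤ) := by
    rw [← hd]
    exact ⟨t.a * t.b * t.c + 2 * u' * v' * w' - t.a * u' ^ 2 - t.b * v' ^ 2 - t.c * w' ^ 2, by ring⟩
  have h4' : 2 * 2 ∣ p := by exact_mod_cast h4
  have h2 : 2 ∣ p := dvd_trans (dvd_mul_right 2 2) h4'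
  have := (Nat.prime_dvd_prime_iff_eq Nat.prime_two hp.out).1 h2
  subst this
  omega

theorem memC [Fact p.Prime] (x : H) : x ∈ t.C ↔ ∀ o ∈ t.O, ∃ m : ℤ, 2 * (x * o).re = √(p : ℝ) * m := by
  have hp := p_pos (p := p)
  constructor
  · intro hx o ho
    obtain ⟨n0, n1, n2, n3, rfl⟩ := t.mem_O.1 ho
    obtain ⟨k1, k2, k3⟩ := t.tr_e n0 n1 n2 n3
    -- omega times o
    have h4 : t.e2 * t.e3 * (n0 * 1 + n1 * (t.e2 * t.e3) + n2 * (t.e3 * t.e1) + n3 * (t.e1 * t.e2)) ∈ t.O :=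
      t.OO_le (mul_mem_mul t.i_O ho)
    obtain ⟨q0, q1, q2, q3, hq⟩ := t.mem_O.1 h4
    have k4 := (t.tr_e q0 q1 q2 q3).1
    rw [← hq] at k4
    generalize (n0 * 1 + n1 * (t.e2 * t.e3) + n2 * (t.e3 * t.e1) + n3 * (t.e1 * t.e2) : H) = o at *
    obtain ⟨m0, m1, m2, m3, rfl⟩ := t.mem_C.1 hx
    refine ⟨m0 * n1 + m1 * n2 + m2 * n3 + m3 * q1, ?_⟩
    have e : (m0 * t.e1 + m1 * t.e2 + m2 * t.e3 + m3 * (t.e1 * t.e2 * t.e3)) * o =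
      (m0 : ℝ) • (t.e1 * o) + (m1 : ℝ) • (t.e2 * o) + (m2 : ℝ) • (t.e3 * o) +
        (m3 : ℝ) • (t.e1 * (t.e2 * t.e3 * o)) := by
      simp only [← Quaternion.coe_mul_eq_smul, icoe]
      noncomm_ring
    rw [e]
    simp only [Quaternion.re_add, Quaternion.re_smul, smul_eq_mul]
    push_cast
    linear_combination m0 * k1 + m1 * k2 + m2 * k3 + m3 * k4
  · intro h
    obtain ⟨m0, k0⟩ := h _ t.one_O
    obtain ⟨m1, k1⟩ := h _ t.i_O
    obtain ⟨m2, k2⟩ := h _ t.j_O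
    obtain ⟨m3, k3⟩ := h _ t.k_O
    rw [mul_one] at k0
    have := id_dual t.h1 t.h2 t.h3 x
    rw [t.hor, k0, k1, k2, k3, t.hu, t.hw] at this
    simp only [Quaternion.coe_mul, icoe, mul_assoc, ← mul_add] at this
    have h0 : ((√(p : ℝ) : ℝ) : H) ≠ 0 := by
      intro h; exact hp.ne' (congrArg (fun q : H => q.re) h)
    have := mul_left_cancel₀ h0 this
    refine t.mem_C.2 ⟨m1 + m0 * t.u, m2, m3 + m0 * t.w, m0, ?_⟩
    rw [this]
    push_cast
    noncomm_ring

theorem ord [hp : Fact p.Prime] : Ord p t.O t.C := by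
  have hpp := p_pos (p := p)
  have hsq : √(p : ℝ) * √(p : ℝ) = p := Real.mul_self_sqrt (by positivity)
  have trO : ∀ x ∈ t.O, ∃ n : ℤ, 2 * x.re = n := by
    intro x hx
    obtain ⟨n0, n1, n2, n3, rfl⟩ := t.mem_O.1 hx
    exact ⟨_, t.trs n0 n1 n2 n3⟩
  have sqC : ((√(p : ℝ) : ℝ) : H) ∈ t.C := by
    rw [t.memC]
    intro o ho
    obtain ⟨n, hn⟩ := trO o ho
    refine ⟨n, ?_⟩
    rw [Quaternion.coe_mul_eq_smul, Quaternion.re_smul, smul_eq_mul, ← hn]; ring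
  have OC : t.O * t.C = t.C := by
    refine le_antisymm ?_ ?_
    · rw [mul_le]
      intro o ho x hx
      rw [t.memC] at hx ⊢
      intro o' ho'
      obtain ⟨m, hm⟩ := hx (o' * o) (t.OO_le (mul_mem_mul ho' ho))
      refine ⟨m, ?_⟩
      rw [← hm, re_cycl (o * x) o', ← mul_assoc, re_cycl]
    · intro x hx
      rw [← one_mul x]
      exact mul_mem_mul t.one_O hx
  have CO : t.C * t.O = t.C := by
    refine le_antisymm ?_ ?_
    · rw [mul_le]
      intro x hx o ho
      rw [t.memC] at hx ⊢
      intro o' ho'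
      obtain ⟨m, hm⟩ := hx (o * o') (t.OO_le (mul_mem_mul ho ho'))
      refine ⟨m, ?_⟩
      rw [← hm, mul_assoc]
    · intro x hx
      rw [← mul_one x]
      exact mul_mem_mul hx t.one_O
  have cjC1 : t.C ≤ cj t.C := by
    intro x hx
    rw [mem_cj]
    rw [t.memC] at hx ⊢
    intro o ho
    obtain ⟨m, hm⟩ := hx (star o) (by rw [← mem_cj, t.cjO]; exact ho)
    refine ⟨m, ?_⟩
    rw [← hm, re_cycl x, ← star_star x, ← star_mul, Quaternion.re_star, star_star]
  have CC : t.C * t.C = t.O := by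
    refine le_antisymm t.CC_le ?_
    have i : t.e2 * t.e3 ∈ t.C * t.C := mul_mem_mul t.e2_C t.e3_C
    have j : t.e3 * t.e1 ∈ t.C * t.C := mul_mem_mul t.e3_C t.e1_C
    have k : t.e1 * t.e2 ∈ t.C * t.C := mul_mem_mul t.e1_C t.e2_C
    have one : (1 : H) ∈ t.C * t.C := by
      obtain ⟨s1, s2, s3⟩ := t.sqs
      obtain ⟨a21, a32, a13⟩ := t.anti
      let I : AddSubgroup ℤ := (t.C * t.C).toAddSubgroup.comap (Int.castAddHom H)
      have hI : ∀ n : ℤ, n ∈ I ↔ (n : H) ∈ t.C * t.C := fun n => Iff.rfl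
      have ga : t.a ∈ I := by
        rw [hI, ← neg_mem_iff, ← s1]; exact mul_mem_mul t.e1_C t.e1_C
      have gb : t.b ∈ I := by
        rw [hI, ← neg_mem_iff, ← s2]; exact mul_mem_mul t.e2_C t.e2_C
      have gc : t.c ∈ I := by
        rw [hI, ← neg_mem_iff, ← s3]; exact mul_mem_mul t.e3_C t.e3_C
      have gu : t.u ∈ I := by
        rw [hI, ← neg_mem_iff, show -(t.u : H) = t.e3 * t.e2 + t.e2 * t.e3 by rw [a32]; abel]
        exact add_mem (mul_mem_mul t.e3_C t.e2_C) i
      have gv : t.v ∈ I := by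
        rw [hI, ← neg_mem_iff, show -(t.v : H) = t.e1 * t.e3 + t.e3 * t.e1 by rw [a13]; abel]
        exact add_mem (mul_mem_mul t.e1_C t.e3_C) j
      have gw : t.w ∈ I := by
        rw [hI, ← neg_mem_iff, show -(t.w : H) = t.e2 * t.e1 + t.e1 * t.e2 by rw [a21]; abel]
        exact add_mem (mul_mem_mul t.e2_C t.e1_C) k
      obtain ⟨g, hg⟩ := Int.subgroup_cyclic I
      rw [hg] at ga gb gc gu gv gw
      simp only [AddSubgroup.mem_closure_singleton, smul_eq_mul] at ga gb gc gu gv gw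
      obtain ⟨a', ha'⟩ := ga
      obtain ⟨b', hb'⟩ := gb
      obtain ⟨c', hc'⟩ := gc
      obtain ⟨u', hu'⟩ := gu
      obtain ⟨v', hv'⟩ := gv
      obtain ⟨w', hw'⟩ := gw
      have hd := t.nat_disc
      rw [← ha', ← hb', ← hc', ← hu', ← hv', ← hw'] at hd
      have hg3 : g * g ∣ (p : ℤ) := by
        rw [← hd]
        exact ⟨g * (4 * a' * b' * c' + u' * v' * w' - a' * u' ^ 2 - b' * v' ^ 2 - c' * w' ^ 2), by ring⟩
      have hgu : IsUnit g := by
        have hs : Squarefree (p : ℤ) := (Nat.prime_iff_prime_int.1 hp.out).squarefree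
        exact hs g hg3
      have h1 : (1 : ℤ) ∈ I := by
        rw [hg, AddSubgroup.mem_closure_singleton]
        obtain ⟨u, rfl⟩ := hgu
        exact ⟨((u⁻¹ : ℤˣ) : ℤ), by simp⟩
      simpa using (hI 1).1 h1
    intro x hx
    obtain ⟨n0, n1, n2, n3, rfl⟩ := t.mem_O.1 hx
    exact add_mem (add_mem (add_mem (int_mul_mem _ one) (int_mul_mem _ i)) (int_mul_mem _ j)) (int_mul_mem _ k)
  have hdet := id_cov t.h1 t.h2 t.h3
  have hdet2 : (t.e1 * t.e2 * t.e3).re ^ 2 = p / 4 := by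
    have := t.hor
    have h2 : (t.e1 * t.e2 * t.e3).re = √(p : ℝ) / 2 := by linarith
    rw [h2, div_pow, sq, hsq]; norm_num
  have hp0 : (0 : ℝ) < p / 4 := by
    have : (0 : ℝ) < p := by exact_mod_cast hp.out.pos
    positivity
  obtain ⟨hl, hc⟩ := cov_span (![1, t.e2 * t.e3, t.e3 * t.e1, t.e1 * t.e2] : Fin 4 → H)
    (by rw [hdet, hdet2]; exact hp0.ne')
  refine ⟨t.one_O, t.OO, t.cjO, t.int', trO, t.tr1, t.memC, OC, CO, ?_, CC, sqC, ?_, hl, ?_⟩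
  · refine le_antisymm ?_ cjC1
    simpa using cj_mono cjC1
  · intro x
    have h := id_tsum t.h1 t.h2 t.h3 x
    rw [t.hor, t.hu, t.hw, icoe, icoe] at h
    rw [h]
    have mm : ∀ o ∈ t.O, ∀ c ∈ t.C, o * x * c ∈ t.O * sp x * t.C :=
      fun o ho c hc => mul_mem_mul (mul_mem_mul ho (mem_sp x)) hc
    refine add_mem (add_mem (add_mem ?_ (mm _ t.i_O _ t.e1_C)) (mm _ t.j_O _ t.e2_C)) (mm _ t.k_O _ t.e3_C)
    have := mm 1 t.one_O (t.e1 * t.e2 * t.e3 + t.u * t.e1 + t.w * t.e3)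
      (add_mem (add_mem t.w_C (int_mul_mem _ t.e1_C)) (int_mul_mem _ t.e3_C))
    rwa [one_mul] at this
  · change cov (span ℤ _) = _
    rw [hc, hdet, hdet2, abs_of_pos hp0]

end TL
end MF

namespace MF
open Module MeasureTheory Filter Topology Submodule

local notation "N" => Quaternion.normSq

/-- `K` is an invertible unimodular connecting lattice from `O` to `O'` -/
structure Conn (O O' K : Submodule ℤ H) : Prop where
  oneL : (1 : H) ∈ O
  oneR : (1 : H) ∈ O'
  L : K * cj K = O
  R : cj K * K = O'
  OK : O * K = K
  KO : K * O' = K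

theorem trace_swap {A B : Submodule ℤ H} {x : H} (hx : x ∈ A * B) : ∃ y ∈ B * A, y.re = x.re := by
  induction hx using Submodule.mul_induction_on' with
  | mem_mul_mem m hm n hn => exact ⟨n * m, mul_mem_mul hn hm, re_cycl _ _⟩
  | add x hx y hy ihx ihy =>
    obtain ⟨x', hx', ex⟩ := ihx
    obtain ⟨y', hy', ey⟩ := ihy
    exact ⟨x' + y', add_mem hx' hy', by simp [ex, ey]⟩

theorem normSq_add' (a b : H) : N (a + b) = N a + N b + 2 * (a * star b).re := by
  simp [Quaternion.normSq_def']; ring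

theorem mul_one_le {A B : Submodule ℤ H} (h : (1 : H) ∈ B) : A ≤ A * B := by
  intro x hx; rw [← mul_one x]; exact mul_mem_mul hx h

theorem one_mul_le {A B : Submodule ℤ H} (h : (1 : H) ∈ B) : A ≤ B * A := by
  intro x hx; rw [← one_mul x]; exact mul_mem_mul h hx

namespace Conn
variable {O O' O'' K M : Submodule ℤ H}

theorem cj (h : Conn O O' K) : Conn O' O (cj K) := by
  have hO : MF.cj O = O := by rw [← h.L, cj_mul, cj_cj]
  have hO' : MF.cj O' = O' := by rw [← h.R, cj_mul, cj_cj]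
  refine ⟨h.oneR, h.oneL, ?_, ?_, ?_, ?_⟩
  · rw [cj_cj, h.R]
  · rw [cj_cj, h.L]
  · conv_lhs => rw [← hO', ← cj_mul, h.KO]
  · conv_lhs => rw [← hO, ← cj_mul, h.OK]

theorem mul (h : Conn O O' K) (g : Conn O' O'' M) : Conn O O'' (K * M) := by
  refine ⟨h.oneL, g.oneR, ?_, ?_, ?_, ?_⟩
  · rw [cj_mul, mul_assoc, ← mul_assoc M, g.L, h.cj.OK, h.L]
  · rw [cj_mul, mul_assoc, ← mul_assoc _ K, h.R, g.OK, g.R]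
  · rw [← mul_assoc, h.OK]
  · rw [mul_assoc, g.KO]

theorem exists_ne (h : Conn O O' K) : ∃ x ∈ K, x ≠ 0 := by
  by_contra! hc
  have : K = ⊥ := by
    rw [eq_bot_iff]; intro x hx; simpa using hc x hx
  have h1 := h.oneL
  rw [← h.L, this] at h1
  simp at h1

theorem nrm (h : Conn O O' K) {x : H} (hx : x ∈ K) : ((N x : ℝ) : H) ∈ O := by
  rw [← Quaternion.self_mul_star, ← h.L]
  exact mul_mem_mul hx (star_mem_cj hx)

theorem Oa_le (h : Conn O O' K) {x : H} (hx : x ∈ K) : O * sp x ≤ K := by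
  conv_rhs => rw [← h.OK]
  exact mul_le_mul_right (sp_le.2 hx) O

theorem Ka_le (h : Conn O O' K) {x : H} (hx : x ∈ K) : K * sp (star x) ≤ O := by
  rw [← h.L]
  exact mul_le_mul_right (sp_le.2 (star_mem_cj hx)) K

theorem lat (h : Conn O O' K) (hO : IsLat O) : IsLat K := by
  obtain ⟨a, ha, ha0⟩ := h.exists_ne
  have hs : star a ≠ 0 := star_ne_zero.2 ha0
  refine IsLat.of_le (hO.spR ha0).1 (hO.spR (inv_ne_zero hs)).1 (h.Oa_le ha) ?_
  calc K = K * sp (star a) * sp (star a)⁻¹ := by rw [mul_assoc, sp_mul_inv hs, mul_one]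
    _ ≤ _ := mul_le_mul_left (h.Ka_le ha) _

theorem lat' (h : Conn O O' K) (hO : IsLat O) : IsLat O' := by
  have hK := h.lat hO
  obtain ⟨a, ha, ha0⟩ := h.exists_ne
  have hK' := hK.cjL.1
  refine IsLat.of_le (hK'.spR ha0).1 (hK.spL (inv_ne_zero ha0)).1 ?_ ?_
  · rw [← h.R]
    exact mul_le_mul_right (sp_le.2 ha) _
  · calc O' = sp a⁻¹ * (sp a * O') := by rw [← mul_assoc, sp_inv_mul ha0, one_mul]
      _ ≤ sp a⁻¹ * (K * O') := mul_le_mul_right (mul_le_mul_left (sp_le.2 ha) _) _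
      _ = _ := by rw [h.KO]

theorem prim (h : Conn O O' K) (hintg : ∀ r : ℝ, (r : H) ∈ O → ∃ n : ℤ, r = n)
    (tr1 : ∃ x ∈ O, 2 * x.re = 1) (l : ℕ) (hl : l.Prime) :
    ∃ x ∈ K, ∃ n : ℤ, N x = n ∧ ¬ (l : ℤ) ∣ n := by
  by_contra! hc
  obtain ⟨x, hx, hx1⟩ := tr1
  have key : ∀ y ∈ K * MF.cj K, ∃ m : ℤ, 2 * y.re = l * m := by
    intro y hy
    induction hy using Submodule.mul_induction_on' with
    | mem_mul_mem a ha b hb =>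
      rw [mem_cj] at hb
      have e := normSq_add' a (star b)
      rw [star_star] at e
      obtain ⟨n1, h1⟩ := hintg _ (h.nrm ha)
      obtain ⟨n2, h2⟩ := hintg _ (h.nrm hb)
      obtain ⟨n3, h3⟩ := hintg _ (h.nrm (add_mem ha hb))
      obtain ⟨m1, k1⟩ := hc _ ha _ h1
      obtain ⟨m2, k2⟩ := hc _ hb _ h2
      obtain ⟨m3, k3⟩ := hc _ (add_mem ha hb) _ h3
      refine ⟨m3 - m1 - m2, ?_⟩
      rw [h1, h2, h3, k1, k2, k3] at e
      push_cast at e ⊢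
      linarith
    | add x hx y hy ihx ihy =>
      obtain ⟨m1, h1⟩ := ihx
      obtain ⟨m2, h2⟩ := ihy
      refine ⟨m1 + m2, ?_⟩
      push_cast
      rw [Quaternion.re_add]
      linarith
  rw [← h.L] at hx
  obtain ⟨m, hm⟩ := key x hx
  rw [hx1] at hm
  have : (1 : ℤ) = l * m := by exact_mod_cast hm
  have h2 : (l : ℤ) ∣ 1 := ⟨m, this⟩
  have h3 : l ∣ 1 := by exact_mod_cast h2
  exact hl.one_lt.ne' (Nat.dvd_one.1 h3)

theorem cov_eq (h : Conn O O' K) (hO : IsLat O) (hintg : ∀ r : ℝ, (r : H) ∈ O → ∃ n : ℤ, r = n)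
    (tr1 : ∃ x ∈ O, 2 * x.re = 1) : cov K = cov O := by
  have hK := h.lat hO
  have pO := hO.cov_pos
  have pK := hK.cov_pos
  have main : ∀ ρ : ℝ, (∀ x ∈ K, x ≠ 0 → ∃ k : ℤ, ρ * N x ^ 2 = k) → ∃ k : ℤ, ρ = k := by
    intro ρ hρ
    let I : AddSubgroup ℤ := (Int.castAddHom ℝ).range.comap ((AddMonoidHom.mulLeft ρ).comp (Int.castAddHom ℝ))
    have hI : ∀ n : ℤ, n ∈ I ↔ ∃ k : ℤ, (k : ℝ) = ρ * n := fun n => Iff.rfl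
    obtain ⟨g, hg⟩ := Int.subgroup_cyclic I
    have hg' : ∀ n : ℤ, n ∈ I ↔ g ∣ n := by
      intro n
      rw [hg, AddSubgroup.mem_closure_singleton]
      constructor
      · rintro ⟨m, rfl⟩; exact ⟨m, by simp [mul_comm]⟩
      · rintro ⟨m, rfl⟩; exact ⟨m, by simp [mul_comm]⟩
    have hgx : ∀ x ∈ K, ∀ n : ℤ, N x = n → g ∣ n ^ 2 := by
      intro x hx n hn
      by_cases hx0 : x = 0
      · subst hx0
        have : n = 0 := by
          have : (0 : ℝ) = n := by simpa using hn
          exact_mod_cast this.symm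
        rw [this]; simp
      · rw [← hg', hI]
        obtain ⟨k, hk⟩ := hρ x hx hx0
        refine ⟨k, ?_⟩
        rw [← hk, hn]; push_cast; rfl
    have hg1 : g.natAbs = 1 := by
      by_contra hne
      obtain ⟨l, hl, hlg⟩ := Nat.exists_prime_and_dvd hne
      obtain ⟨x, hx, n, hn, hnl⟩ := h.prim hintg tr1 l hl
      have := (Int.natCast_dvd.2 hlg).trans (hgx x hx n hn)
      exact hnl ((Nat.prime_iff_prime_int.1 hl).dvd_of_dvd_pow this)
    have h1 : (1 : ℤ) ∈ I := by
      rw [hg', ← Int.natAbs_dvd, hg1]; simp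
    obtain ⟨k, hk⟩ := (hI 1).1 h1
    exact ⟨k, by simpa using hk.symm⟩
  obtain ⟨k1, h1⟩ := main (cov K / cov O) (by
    intro x hx hx0
    have hs : star x ≠ 0 := star_ne_zero.2 hx0
    have e1 := (hK.spR hs).2
    have e2 := (hK.spR hs).1.cov_eq hO (h.Ka_le hx)
    rw [e1, Quaternion.normSq_star] at e2
    refine ⟨((K * sp (star x)).toAddSubgroup.relIndex O.toAddSubgroup : ℕ), ?_⟩
    push_cast
    field_simp
    linarith)
  obtain ⟨k2, h2⟩ := main (cov O / cov K) (by
    intro x hx hx0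
    have e1 := (hO.spR hx0).2
    have e2 := (hO.spR hx0).1.cov_eq hK (h.Oa_le hx)
    rw [e1] at e2
    refine ⟨((O * sp x).toAddSubgroup.relIndex K.toAddSubgroup : ℕ), ?_⟩
    push_cast
    field_simp
    linarith)
  have p1 : (0 : ℝ) < k1 := by rw [← h1]; positivity
  have h12 : (k1 : ℝ) * k2 = 1 := by rw [← h1, ← h2]; field_simp
  have h12' : k1 * k2 = 1 := by exact_mod_cast h12
  have p1' : 0 < k1 := by exact_mod_cast p1
  have : k1 = 1 := by
    rcases Int.eq_one_or_neg_one_of_mul_eq_one h12' with h | h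
    · exact h
    · omega
  rw [this] at h1
  field_simp at h1
  simpa using h1

end Conn

namespace Ord
variable {p : ℕ} {O C O' K : Submodule ℤ H}

theorem conn_C (h : Ord p O C) : Conn O O C :=
  ⟨h.one_mem, h.one_mem, by rw [h.cjC, h.CC], by rw [h.cjC, h.CC], h.OC, h.CO⟩

theorem conn_O (h : Ord p O C) : Conn O O O :=
  ⟨h.one_mem, h.one_mem, by rw [h.cjO, h.OO], by rw [h.cjO, h.OO], h.OO, h.OO⟩

theorem nrm (h : Ord p O C) (g : Conn O O' K) {x : H} (hx : x ∈ K) : ∃ n : ℕ, N x = n := by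
  obtain ⟨n, hn⟩ := h.int _ (g.nrm hx)
  have : (0 : ℝ) ≤ n := by rw [← hn]; exact Quaternion.normSq_nonneg
  have h0 : 0 ≤ n := by exact_mod_cast this
  refine ⟨n.toNat, ?_⟩
  rw [hn]
  exact_mod_cast (Int.toNat_of_nonneg h0).symm

theorem trC (h : Ord p O C) {x : H} (hx : x ∈ C) : ∃ n : ℤ, 2 * x.re = √(p : ℝ) * n := by
  have := (h.memC x).1 hx 1 h.one_mem
  rwa [mul_one] at this

/-- transport of the order package along a connecting lattice -/
theorem conn (h : Ord p O C) (g : Conn O O' K) : Ord p O' (cj K * C * K) := by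
  have int' : ∀ r : ℝ, (r : H) ∈ O' → ∃ n : ℤ, r = n := by
    intro r hr
    refine h.int r ?_
    have h1 : sp (r : H) * K ≤ K := by
      rw [sp_comm]
      conv_rhs => rw [← g.KO]
      exact mul_le_mul_right (sp_le.2 hr) _
    have h2 : sp (r : H) * O ≤ O := by
      rw [← g.L, ← mul_assoc]
      exact mul_le_mul_left h1 _
    have := h2 (mul_mem_mul (mem_sp _) h.one_mem)
    rwa [mul_one] at this
  have tr1' : ∃ x ∈ O', 2 * x.re = 1 := by
    obtain ⟨x, hx, hx1⟩ := h.tr1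
    rw [← g.L] at hx
    obtain ⟨y, hy, e⟩ := trace_swap hx
    rw [g.R] at hy
    exact ⟨y, hy, by rw [e, hx1]⟩
  have CO' : cj K * C * K * O' = cj K * C * K := by rw [mul_assoc, g.KO]
  have OC' : O' * (cj K * C * K) = cj K * C * K := by
    rw [← mul_assoc, ← mul_assoc, g.cj.OK]
  refine ⟨g.oneR, ?_, ?_, int', ?_, tr1', ?_, OC', CO', ?_, ?_, ?_, ?_, g.lat' h.lat, ?_⟩
  · rw [← g.R, mul_assoc, ← mul_assoc K, g.L, g.OK]
  · rw [← g.R, cj_mul, cj_cj]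
  · intro x hx
    rw [← g.R] at hx
    obtain ⟨y, hy, e⟩ := trace_swap hx
    rw [g.L] at hy
    rw [← e]
    exact h.trO y hy
  · intro x
    constructor
    · intro hx o ho
      have h1 : x * o ∈ cj K * C * K := by rw [← CO']; exact mul_mem_mul hx ho
      rw [mul_assoc] at h1
      obtain ⟨y, hy, e⟩ := trace_swap h1
      rw [mul_assoc, g.L, h.CO] at hy
      rw [← e]
      exact h.trC hy
    · intro hx
      have key : K * sp x * cj K ≤ C := by
        intro z hz
        rw [h.memC]
        intro o ho
        have h1 : z * o ∈ K * (sp x * cj K) := by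
          have := mul_mem_mul hz ho
          rwa [mul_assoc, g.cj.KO, mul_assoc] at this
        obtain ⟨y, hy, e⟩ := trace_swap h1
        rw [mul_assoc, g.R, mem_sp_mul] at hy
        obtain ⟨o', ho', rfl⟩ := hy
        rw [← e]
        exact hx o' ho'
      have h2 : O' * sp x * O' ≤ cj K * C * K := by
        calc O' * sp x * O' = cj K * (K * sp x * cj K) * K := by
              rw [← g.R]; simp only [mul_assoc]
          _ ≤ _ := mul_le_mul_left (mul_le_mul_right key _) _
      refine h2 ?_
      have := mul_mem_mul (mul_mem_mul g.oneR (mem_sp x)) g.oneR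
      rwa [one_mul, mul_one] at this
  · rw [cj_mul, cj_mul, cj_cj, h.cjC, mul_assoc]
  · calc cj K * C * K * (cj K * C * K) = cj K * C * (K * cj K) * C * K := by simp only [mul_assoc]
      _ = O' := by rw [g.L, mul_assoc _ C O, h.CO, mul_assoc _ C C, h.CC, g.cj.KO, g.R]
  · have h1 : sp ((√(p : ℝ) : ℝ) : H) * O' ≤ cj K * C * K := by
      rw [← g.R, ← mul_assoc, sp_comm]
      exact mul_le_mul_left (mul_le_mul_right (sp_le.2 h.sqC) _) _
    have := h1 (mul_mem_mul (mem_sp _) g.oneR)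
    rwa [mul_one] at this
  · intro t
    have h0 : ∀ a ∈ K, ∀ b ∈ K, ∀ c ∈ K, ∀ d ∈ K,
        ((√(p : ℝ) * (2 * (star b * a * t).re) : ℝ) : H) * (star c * d) ∈ O' * sp t * (cj K * C * K) := by
      intro a ha b hb c hc d hd
      have h1 := h.tsum (a * t * star b)
      have e1 : (a * t * star b).re = (star b * a * t).re := by
        rw [re_cycl, ← mul_assoc]
      rw [e1] at h1
      have h2 : O * sp (a * t * star b) * C ≤ K * sp t * cj K * C := by
        refine mul_le_mul_left ?_ _
        rw [← sp_mul_sp, ← sp_mul_sp, ← mul_assoc, ← mul_assoc]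
        exact mul_le_mul' (mul_le_mul_left (g.Oa_le ha) _) (sp_le.2 (star_mem_cj hb))
      have h3 := mul_mem_mul (mul_mem_mul (star_mem_cj hc) (h2 h1)) hd
      rw [← real_comm] at h3
      have e2 : cj K * (K * sp t * cj K * C) * K = O' * sp t * (cj K * C * K) := by
        rw [← g.R]; simp only [mul_assoc]
      rw [e2] at h3
      rwa [← mul_assoc _ (star c) d]
    have h1 : ∀ x ∈ O', ∀ y ∈ O', ((√(p : ℝ) * (2 * (x * t).re) : ℝ) : H) * y ∈ O' * sp t * (cj K * C * K) := by
      intro x hx y hy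
      rw [← g.R] at hx hy
      induction hx using Submodule.mul_induction_on' with
      | mem_mul_mem b hb a ha =>
        induction hy using Submodule.mul_induction_on' with
        | mem_mul_mem c hc d hd =>
          rw [mem_cj] at hb hc
          simpa using h0 a ha _ hb _ hc d hd
        | add y1 _ y2 _ ih1 ih2 =>
          rw [mul_add]; exact add_mem ih1 ih2
      | add x1 _ x2 _ ih1 ih2 =>
        have := add_mem ih1 ih2
        rw [← add_mul, ← Quaternion.coe_add, ← mul_add, ← mul_add, ← Quaternion.re_add, ← add_mul] at this
        exact this
    have := h1 1 g.oneR 1 g.oneR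
    rwa [one_mul, mul_one] at this
  · rw [← h.covO, ← g.cov_eq h.lat h.int h.tr1, ← (g.lat h.lat).cjL.2]
    exact (g.cj.cov_eq (g.lat' h.lat) int' tr1').symm

end Ord
end MF

namespace MF
open Module MeasureTheory Filter Topology Submodule

local notation "N" => Quaternion.normSq

theorem sqrtp_pos (p : ℕ) [hp : Fact p.Prime] : 0 < √(p : ℝ) := TL.p_pos

theorem sqrtp_sq (p : ℕ) : √(p : ℝ) * √(p : ℝ) = p := Real.mul_self_sqrt (by positivity)

theorem id_cov2 {e1 e2 e3 w : H} (h1 : e1.re = 0) (h2 : e2.re = 0) (h3 : e3.re = 0) :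
    (Matrix.of fun i j => coo ((![e1, e2, e3, w] : Fin 4 → H) i) j).det = w.re * (e1 * e2 * e3).re := by
  rw [det4]
  simp [coo, h1, h2, h3]
  ring

theorem det_ne_of_lat (v : Fin 4 → H) (hl : IsLat (span ℤ (Set.range v))) :
    (Matrix.of fun i j => coo (v i) j).det ≠ 0 := by
  have hd : ob.toBasis.det v = (Matrix.of fun i j => coo (v i) j).det := by
    rw [Basis.det_apply, ← Matrix.det_transpose]
    congr 1
  have ht : span ℝ (Set.range v) = ⊤ := by
    have := hl.top
    rwa [Submodule.span_span_of_tower] at this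
  have hli := linearIndependent_of_top_le_span_of_card_eq_finrank ht.ge (by rw [finrankH]; simp)
  rw [← hd]
  exact ((Module.Basis.is_basis_iff_det ob.toBasis).1 ⟨hli, ht⟩).ne_zero

namespace Ord
variable {p : ℕ} [hp : Fact p.Prime] {O C O' K : Submodule ℤ H}

theorem latC (h : Ord p O C) : IsLat C := h.conn_C.lat h.lat

theorem covC (h : Ord p O C) : cov C = p / 4 := by
  rw [h.conn_C.cov_eq h.lat h.int h.tr1, h.covO]

theorem C_unique {C' : Submodule ℤ H} (h : Ord p O C) (h' : Ord p O C') : C = C' := by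
  ext x; rw [h.memC, h'.memC]

theorem nrmC (h : Ord p O C) {x : H} (hx : x ∈ C) : ∃ n : ℤ, N x = n := h.int _ (h.conn_C.nrm hx)

theorem TC (h : Ord p O C) {x y : H} (hx : x ∈ C) (hy : y ∈ C) : ∃ n : ℤ, T2 x y = n := by
  have : x * y ∈ O := by rw [← h.CC]; exact mul_mem_mul hx hy
  obtain ⟨n, hn⟩ := h.trO _ this
  refine ⟨-n, ?_⟩
  rw [T2]; push_cast; linarith

/-- an order package comes from a ternary lattice -/
theorem exists_TL (h : Ord p O C) : ∃ t : TL p, t.O = O ∧ t.C = C := by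
  have hs := sqrtp_pos p
  have hs2 := sqrtp_sq p
  choose! τ hτ using fun x => h.trC (x := x)
  have hτu : ∀ x ∈ C, ∀ m : ℤ, 2 * x.re = √(p : ℝ) * m → τ x = m := by
    intro x hx m hm
    rw [hτ x hx] at hm
    exact_mod_cast mul_left_cancel₀ hs.ne' hm
  let f : C →ₗ[ℤ] ℤ := (AddMonoidHom.mk' (fun x : C => τ x) (by
    intro x y
    refine hτu _ (add_mem x.2 y.2) _ ?_
    have h1 := hτ x x.2
    have h2 := hτ y y.2
    push_cast
    rw [Quaternion.re_add]
    linarith)).toIntLinearMap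
  have hf : ∀ x : C, f x = τ x := fun x => rfl
  have hCl := h.latC
  have := hCl.disc
  have := hCl.zl
  have rk : finrank ℤ C = 4 := by rw [ZLattice.rank ℝ C, finrankH]
  have : Module.Free ℤ C := ZLattice.module_free ℝ C
  have : Module.Finite ℤ C := ZLattice.module_finite ℝ C
  obtain ⟨g, hg⟩ := (IsPrincipalIdealRing.principal (LinearMap.range f)).principal
  have hfs : f ⟨_, h.sqC⟩ = 2 := by
    rw [hf]
    refine hτu _ h.sqC _ ?_
    rw [Quaternion.re_coe]; push_cast; ring
  have hg0 : g ≠ 0 := by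
    rintro rfl
    have : f ⟨_, h.sqC⟩ ∈ LinearMap.range f := ⟨_, rfl⟩
    rw [hg, hfs] at this
    simp at this
  have rkr : finrank ℤ (LinearMap.range f) = 1 := by
    rw [hg]
    have := (LinearEquiv.toSpanNonzeroSingleton ℤ ℤ g hg0).finrank_eq
    rw [← this]; simp
  have rkk : finrank ℤ (LinearMap.ker f) = 3 := by
    have := Submodule.finrank_quotient_add_finrank (LinearMap.ker f)
    rw [rk, (LinearMap.quotKerEquivRange f).finrank_eq, rkr] at this
    omega
  let b := Module.finBasisOfFinrankEq ℤ (LinearMap.ker f) rkk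
  obtain ⟨w, hw⟩ : g ∈ LinearMap.range f := by rw [hg]; exact mem_span_singleton_self g
  have hre : ∀ i, ((b i : C) : H).re = 0 := by
    intro i
    have h1 := hτ _ (b i : C).2
    have h2 : f (b i) = 0 := (b i).2
    rw [hf] at h2
    rw [h2] at h1
    simp at h1
    exact h1
  have hwre : 2 * (w : H).re = √(p : ℝ) * g := by
    rw [hτ _ w.2, ← hf, hw]
  have hspan : C = span ℤ (Set.range (![(b 0 : C), (b 1 : C), (b 2 : C), w] : Fin 4 → H)) := by
    ext x
    rw [mem4]
    constructor
    · intro hx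
      have : f ⟨x, hx⟩ ∈ LinearMap.range f := ⟨_, rfl⟩
      rw [hg, mem_span_singleton] at this
      obtain ⟨m, hm⟩ := this
      have hk : (⟨x, hx⟩ - m • w : C) ∈ LinearMap.ker f := by
        rw [LinearMap.mem_ker, map_sub, map_smul, hw, hm, sub_self]
      have := b.sum_repr ⟨_, hk⟩
      have h2 := congrArg (fun z : LinearMap.ker f => ((z : C) : H)) this
      simp only [Fin.sum_univ_three] at h2
      refine ⟨b.repr ⟨_, hk⟩ 0, b.repr ⟨_, hk⟩ 1, b.repr ⟨_, hk⟩ 2, m, ?_⟩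
      simp only [← zsmul_eq_mul]
      exact sub_eq_iff_eq_add.1 h2.symm
    · rintro ⟨n0, n1, n2, n3, rfl⟩
      exact add_mem (add_mem (add_mem (int_mul_mem _ (b 0 : C).2) (int_mul_mem _ (b 1 : C).2))
        (int_mul_mem _ (b 2 : C).2)) (int_mul_mem _ w.2)
  have m0 := (b 0 : C).2
  have m1 := (b 1 : C).2
  have m2 := (b 2 : C).2
  have r0 := hre 0
  have r1 := hre 1
  have r2 := hre 2
  generalize ((b 0 : C) : H) = e1 at *
  generalize ((b 1 : C) : H) = e2 at *
  generalize ((b 2 : C) : H) = e3 at *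
  obtain ⟨a1, ha1⟩ := h.nrmC m0
  obtain ⟨a2, ha2⟩ := h.nrmC m1
  obtain ⟨a3, ha3⟩ := h.nrmC m2
  obtain ⟨u, hu⟩ := h.TC m1 m2
  obtain ⟨v, hv⟩ := h.TC m0 m2
  obtain ⟨z, hz⟩ := h.TC m0 m1
  have hd := id_disc r0 r1 r2
  rw [ha1, ha2, ha3, hu, hv, hz] at hd
  have hcc := id_cov2 (w := w) r0 r1 r2
  have hne := det_ne_of_lat _ (hspan ▸ hCl)
  have hcv := (cov_span _ hne).2
  rw [← hspan, h.covC, hcc, eq_comm, abs_eq (by positivity)] at hcv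
  have hD : (w : H).re * (e1 * e2 * e3).re * ((w : H).re * (e1 * e2 * e3).re) = (p / 4) * (p / 4) := by
    rcases hcv with h | h <;> rw [h] <;> ring
  have hp0 : (0 : ℝ) < p := by exact_mod_cast hp.out.pos
  have hD2 : (g : ℝ) * g * (2 * (e1 * e2 * e3).re) ^ 2 = p := by
    have e : (p : ℝ) * ((g : ℝ) * g * (2 * (e1 * e2 * e3).re) ^ 2) = p * p := by
      calc _ = (√(p : ℝ) * g) * (√(p : ℝ) * g) * (2 * (e1 * e2 * e3).re) ^ 2 := by
            linear_combination (-((g : ℝ) * g * (2 * (e1 * e2 * e3).re) ^ 2)) * hs2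
        _ = _ := by rw [← hwre]; linarith
    exact mul_left_cancel₀ hp0.ne' e
  have hD3 : g * g ∣ (p : ℤ) := by
    rw [hd] at hD2
    refine ⟨4 * a1 * a2 * a3 + u * v * z - a1 * u ^ 2 - a2 * v ^ 2 - a3 * z ^ 2, ?_⟩
    exact_mod_cast hD2.symm
  have hgu : g * g = 1 := by
    have hs : Squarefree (p : ℤ) := (Nat.prime_iff_prime_int.1 hp.out).squarefree
    exact Int.isUnit_mul_self (hs g hD3)
  have hor : (2 * (e1 * e2 * e3).re) ^ 2 = √(p : ℝ) ^ 2 := by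
    have : (g : ℝ) * g = 1 := by exact_mod_cast hgu
    rw [this, one_mul] at hD2
    rw [hD2, sq, hs2]
  have fin : ∀ t : TL p, t.e1 ∈ C → t.e2 ∈ C → t.e3 ∈ C → t.O = O ∧ t.C = C := by
    intro t h1 h2 h3
    have ho := t.ord
    have e : t.O = O := by
      refine ho.lat.eq_of_cov h.lat ?_ (by rw [ho.covO, h.covO])
      intro x hx
      obtain ⟨n0, n1, n2, n3, rfl⟩ := t.mem_O.1 hx
      have hm : ∀ {x y}, x ∈ C → y ∈ C → x * y ∈ O := fun hx hy => h.CC ▸ mul_mem_mul hx hy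
      exact add_mem (add_mem (add_mem (int_mul_mem _ h.one_mem) (int_mul_mem _ (hm h2 h3)))
        (int_mul_mem _ (hm h3 h1))) (int_mul_mem _ (hm h1 h2))
    refine ⟨e, ?_⟩
    rw [e] at ho
    exact ho.C_unique h
  rcases sq_eq_sq_iff_eq_or_eq_neg.1 hor with ho | ho
  · exact ⟨⟨e1, e2, e3, r0, r1, r2, a1, a2, a3, u, v, z, ha1, ha2, ha3, hu, hv, hz, ho⟩, fin _ m0 m1 m2⟩
  · refine ⟨⟨-e1, -e2, -e3, by simp [r0], by simp [r1], by simp [r2], a1, a2, a3, u, v, z, by simp [ha1],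
      by simp [ha2], by simp [ha3], by simp only [← hu, T2, neg_mul_neg], by simp only [← hv, T2, neg_mul_neg],
      by simp only [← hz, T2, neg_mul_neg], ?_⟩,
      fin _ (neg_mem m0) (neg_mem m1) (neg_mem m2)⟩
    rw [neg_mul_neg, mul_neg, Quaternion.re_neg, mul_neg, ho, neg_neg]

end Ord
end MF

namespace MF
open Module MeasureTheory Filter Topology Submodule

local notation "N" => Quaternion.normSq

theorem re_coe_mul (r : ℝ) (x : H) : ((r : H) * x).re = r * x.re := by
  rw [Quaternion.coe_mul_eq_smul, Quaternion.re_smul, smul_eq_mul]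

theorem coeH_ne {r : ℝ} (h : r ≠ 0) : (r : H) ≠ 0 := fun h' => h (congrArg (fun q : H => q.re) h')

theorem normSq_coe' (r : ℝ) : N (r : H) = r * r := by
  rw [Quaternion.normSq_coe]; ring

namespace Ord
variable {p : ℕ} [hp : Fact p.Prime] {O C O' K T : Submodule ℤ H}

theorem sqrt_not_mem (h : Ord p O C) : ((√(p : ℝ) : ℝ) : H) ∉ O := by
  intro hc
  obtain ⟨n, hn⟩ := h.int _ hc
  have h1 := sqrtp_sq p
  rw [hn] at h1
  have h2 : n * n = p := by exact_mod_cast h1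
  have hs : Squarefree (p : ℤ) := (Nat.prime_iff_prime_int.1 hp.out).squarefree
  have h3 := hs n ⟨1, by rw [mul_one, h2]⟩
  have h4 := Int.isUnit_mul_self h3
  rw [h2] at h4
  exact hp.out.one_lt.ne' (by exact_mod_cast h4)

theorem O_ne_C (h : Ord p O C) : O ≠ C := fun e => h.sqrt_not_mem (e ▸ h.sqC)

/-- the real elements of a connecting lattice -/
theorem exists_real (h : Ord p O C) (g : Conn O O' T) (g' : Conn O O (T * C)) :
    ∃ r : ℝ, r ≠ 0 ∧ (r : H) ∈ T * C := by
  obtain ⟨t, ht, ht0⟩ := g.exists_ne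
  have hs := sqrtp_pos p
  by_cases hc : ∀ o ∈ O, (o * t).re = 0
  · exfalso
    let f : H →ₗ[ℝ] ℝ := 
      { toFun := fun x => (x * t).re
        map_add' := fun x y => by rw [add_mul, Quaternion.re_add]
        map_smul' := fun r x => by rw [smul_mul_assoc, Quaternion.re_smul]; rfl }
    have hk : span ℝ (O : Set H) ≤ LinearMap.ker f := by
      rw [span_le]; intro x hx; exact hc x hx
    rw [h.lat.top] at hk
    have : f (star t) = 0 := hk mem_top
    have h2 : (star t * t).re = 0 := this
    rw [Quaternion.star_mul_self, Quaternion.re_coe] at h2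
    exact (normSq_pos ht0).ne' h2
  · push Not at hc
    obtain ⟨o, ho, hne⟩ := hc
    refine ⟨√(p : ℝ) * (2 * (o * t).re), mul_ne_zero hs.ne' (mul_ne_zero two_ne_zero hne), ?_⟩
    have h1 := h.tsum (o * t)
    have h2 : O * sp (o * t) ≤ T := g.Oa_le (by rw [← g.OK]; exact mul_mem_mul ho ht)
    exact mul_le_mul_left h2 C h1

theorem real_gen (h : Ord p O C) (g : Conn O O' T) (hr : ∃ r : ℝ, r ≠ 0 ∧ (r : H) ∈ T) :
    ∃ r : ℝ, r ≠ 0 ∧ ∀ s : ℝ, (s : H) ∈ T ↔ ∃ m : ℤ, s = m * r := by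
  let G : AddSubgroup ℝ := T.toAddSubgroup.comap (algebraMap ℝ H).toAddMonoidHom
  have hG : ∀ s : ℝ, s ∈ G ↔ (s : H) ∈ T := fun s => Iff.rfl
  obtain ⟨r, hr'⟩ := AddSubgroup.cyclic_of_isolated_zero (H := G) (a := 1) one_pos (by
    rw [Set.disjoint_left]
    intro s hs hs2
    obtain ⟨n, hn⟩ := h.nrm g ((hG s).1 hs)
    rw [normSq_coe'] at hn
    obtain ⟨s0, s1⟩ := hs2
    have h1 : (0 : ℝ) < n := by rw [← hn]; positivity
    have h2 : (n : ℝ) < 1 := by rw [← hn]; nlinarith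
    have h1' : 0 < n := by exact_mod_cast h1
    have h2' : n < 1 := by exact_mod_cast h2
    omega)
  have key : ∀ s : ℝ, (s : H) ∈ T ↔ ∃ m : ℤ, s = m * r := by
    intro s
    rw [← hG, hr', AddSubgroup.mem_closure_singleton]
    simp only [zsmul_eq_mul, eq_comm]
  refine ⟨r, ?_, key⟩
  rintro rfl
  obtain ⟨s, hs, hs'⟩ := hr
  obtain ⟨m, hm⟩ := (key s).1 hs'
  simp at hm; exact hs hm

theorem F3a (h : Ord p O C) (g : Conn O O T) {r r' : ℝ} (hr0 : r ≠ 0)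
    (hr : ∀ s : ℝ, (s : H) ∈ T ↔ ∃ m : ℤ, s = m * r)
    (hr' : ∀ s : ℝ, (s : H) ∈ T * C ↔ ∃ m : ℤ, s = m * r') {a : ℤ} (ha : a * a = 1)
    (har : r * √(p : ℝ) = a * r') : T = O ∨ T = C := by
  have hs := sqrtp_pos p
  have hs2 := sqrtp_sq p
  have hrT : (r : H) ∈ T := (hr r).2 ⟨1, by simp⟩
  have hra : r' = a * (r * √(p : ℝ)) := by
    have : (a : ℝ) * a = 1 := by exact_mod_cast ha
    rw [har, ← mul_assoc, this, one_mul]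
  have htr : ∀ t ∈ T, ∃ m : ℤ, 2 * t.re = r * m := by
    intro t ht
    have h1 : ((√(p : ℝ) * (2 * t.re) : ℝ) : H) ∈ T * C := mul_le_mul_left (g.Oa_le ht) C (h.tsum t)
    obtain ⟨m, hm⟩ := (hr' _).1 h1
    refine ⟨m * a, ?_⟩
    refine mul_left_cancel₀ hs.ne' ?_
    rw [hm, hra]; push_cast; ring
  have hle : sp ((√(p : ℝ) / r : ℝ) : H) * T ≤ C := by
    intro x hx
    rw [mem_sp_mul] at hx
    obtain ⟨t, ht, rfl⟩ := hx
    rw [h.memC]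
    intro o ho
    obtain ⟨m, hm⟩ := htr (t * o) (by rw [← g.KO]; exact mul_mem_mul ht ho)
    refine ⟨m, ?_⟩
    rw [mul_assoc, re_coe_mul, ← mul_assoc, mul_comm 2, mul_assoc, hm]
    field_simp
  have hO : ((p / (r * r) : ℝ) : H) ∈ O := by
    have h1 : (sp ((√(p : ℝ) / r : ℝ) : H) * T) * cj (sp ((√(p : ℝ) / r : ℝ) : H) * T) ≤ O := by
      rw [← h.CC]
      refine mul_le_mul' hle ?_
      rw [← h.cjC]; exact cj_mono hle
    rw [cj_mul, cj_sp_real, mul_assoc, ← mul_assoc T, g.L, ← sp_comm, ← mul_assoc, sp_mul_sp] at h1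
    have h2 := h1 (mul_mem_mul (mem_sp _) h.one_mem)
    rw [mul_one, ← Quaternion.coe_mul] at h2
    convert h2 using 2
    field_simp
    rw [sq, hs2]
  obtain ⟨m, hm⟩ := h.int _ hO
  obtain ⟨n, hn⟩ := h.nrm g hrT
  rw [normSq_coe'] at hn
  rw [hn] at hm
  have hn0 : (n : ℝ) ≠ 0 := by rw [← hn]; positivity
  have hd : (n : ℤ) ∣ p := by
    refine ⟨m, ?_⟩
    field_simp at hm
    exact_mod_cast hm
  have hd' : n ∣ p := by exact_mod_cast hd
  rcases (Nat.dvd_prime hp.out).1 hd' with h1 | h1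
  · left
    have one : (1 : H) ∈ T := by
      have : r * r = 1 := by rw [hn, h1]; simp
      rcases mul_self_eq_one_iff.1 this with e | e
      · rw [e] at hrT; simpa using hrT
      · rw [e] at hrT; simpa using neg_mem hrT
    refine le_antisymm ?_ ?_
    · have : (1 : H) ∈ cj T := by rw [mem_cj, star_one]; exact one
      rw [← g.L]; exact mul_one_le this
    · conv_rhs => rw [← g.OK]
      exact mul_one_le one
  · right
    have hT : T ≤ C := by
      have e : (√(p : ℝ) / r) * (√(p : ℝ) / r) = 1 := by
        rw [div_mul_div_comm, hs2, hn, h1]; rw [h1] at hn0; field_simp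
      intro t ht
      have := hle (mul_mem_mul (mem_sp _) ht)
      rcases mul_self_eq_one_iff.1 e with e | e
      · rw [e] at this; simpa using this
      · rw [e] at this; simpa using neg_mem this
    refine le_antisymm hT ?_
    calc C = T * cj T * C := by rw [g.L, h.OC]
      _ ≤ T * C * C := mul_le_mul_left (mul_le_mul_right (h.cjC ▸ cj_mono hT) _) _
      _ = T := by rw [mul_assoc, h.CC, g.KO]

theorem F3 (h : Ord p O C) (g : Conn O O T) : T = O ∨ T = C := by
  have g' := g.mul h.conn_C
  have eT : T * C * C = T := by rw [mul_assoc, h.CC, g.KO]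
  have e1 := h.exists_real g g'
  have e2 := h.exists_real g' (by rw [eT]; exact g)
  rw [eT] at e2
  obtain ⟨r', hr'0, hr'⟩ := h.real_gen g' e1
  obtain ⟨r, hr0, hr⟩ := h.real_gen g e2
  have hs := sqrtp_pos p
  have hs2 := sqrtp_sq p
  obtain ⟨a, ha⟩ := (hr' (r * √(p : ℝ))).1 (by
    rw [Quaternion.coe_mul]; exact mul_mem_mul ((hr r).2 ⟨1, by simp⟩) h.sqC)
  obtain ⟨b, hb⟩ := (hr (r' * √(p : ℝ))).1 (by
    rw [Quaternion.coe_mul, ← eT]; exact mul_mem_mul ((hr' r').2 ⟨1, by simp⟩) h.sqC)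
  have hab : a * b = p := by
    have : (p : ℝ) * r = (a * b) * r := by
      calc (p : ℝ) * r = (r * √(p : ℝ)) * √(p : ℝ) := by rw [← hs2, Real.sqrt_mul_self hs.le]; ring
        _ = a * (r' * √(p : ℝ)) := by rw [ha]; ring
        _ = _ := by rw [hb]; ring
    exact_mod_cast (mul_right_cancel₀ hr0 this).symm
  have hirr := (Nat.prime_iff_prime_int.1 hp.out).irreducible
  rcases hirr.isUnit_or_isUnit hab.symm with hu | hu
  · exact h.F3a g hr0 hr hr' (Int.isUnit_mul_self hu) ha
  · have := h.F3a g' hr'0 hr' (by rw [eT]; exact hr) (Int.isUnit_mul_self hu) hb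
    rcases this with e | e
    · right; rw [← eT, e, h.OC]
    · left; rw [← eT, e, h.CC]

theorem conn_CK (h : Ord p O C) (g : Conn O O' K) : Conn O O' (C * K) := h.conn_C.mul g

theorem conn_two (h : Ord p O C) (g : Conn O O' K) (g2 : Conn O O' T) : T = K ∨ T = C * K := by
  have := h.F3 (g2.mul g.cj)
  have e : T = T * cj K * K := by rw [mul_assoc, g.R, g2.KO]
  rcases this with h1 | h1
  · left; rw [e, h1, g.OK]
  · right; rw [e, h1]

theorem K_ne_CK (h : Ord p O C) (g : Conn O O' K) : K ≠ C * K := by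
  intro e
  have : K * cj K = C * (K * cj K) := by rw [← mul_assoc, ← e]
  rw [g.L, h.CO] at this
  exact h.O_ne_C this

theorem nrm_dvd_of_mem (h : Ord p O C) (g : Conn O O' K) {x : H}
    (hx : x ∈ sp ((√(p : ℝ) : ℝ) : H) * (C * K)) : ∃ n : ℕ, N x = p * n := by
  rw [mem_sp_mul] at hx
  obtain ⟨y, hy, rfl⟩ := hx
  obtain ⟨n, hn⟩ := h.nrm (h.conn_CK g) hy
  refine ⟨n, ?_⟩
  rw [map_mul, normSq_coe', sqrtp_sq, hn]

theorem P_le (h : Ord p O C) (g : Conn O O' K) : sp ((√(p : ℝ) : ℝ) : H) * (C * K) ≤ K := by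
  calc _ ≤ C * (C * K) := mul_le_mul_left (sp_le.2 h.sqC) _
    _ = K := by rw [← mul_assoc, h.CC, g.OK]

theorem aniso (h : Ord p O C) {x : H} (hx : x ∈ O) {n : ℕ} (hn : N x = p * n) :
    x ∈ sp ((√(p : ℝ) : ℝ) : H) * C := by
  have hs := sqrtp_pos p
  have hs2 := sqrtp_sq p
  by_contra hxP
  set P := sp ((√(p : ℝ) : ℝ) : H) * C with hP
  have hPO : P ≤ O := by
    rw [hP, ← h.CC]; exact mul_le_mul_left (sp_le.2 h.sqC) _
  have hPl := h.latC.spL (coeH_ne hs.ne')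
  rw [← hP, normSq_coe', hs2] at hPl
  set I := O * sp x ⊔ P with hI
  have hPI : P ≤ I := le_sup_right
  have hIleO : I ≤ O := by
    refine sup_le ?_ hPO
    conv_rhs => rw [← h.OO]
    exact mul_le_mul_right (sp_le.2 hx) _
  have hxI : x ∈ I := (le_sup_left : O * sp x ≤ I) (by
    have := mul_mem_mul h.one_mem (mem_sp x); rwa [one_mul] at this)
  have hIl : IsLat I := IsLat.of_le hPl.1 h.lat hPI hIleO
  have hnI : ∀ y ∈ I, ∃ m : ℤ, N y = p * m := by
    intro y hy
    rw [hI, Submodule.mem_sup] at hy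
    obtain ⟨y1, hy1, q, hq, rfl⟩ := hy
    rw [mem_mul_sp] at hy1
    obtain ⟨o, ho, rfl⟩ := hy1
    rw [hP, mem_sp_mul] at hq
    obtain ⟨c, hc, rfl⟩ := hq
    rw [normSq_add']
    obtain ⟨n1, h1⟩ := h.nrm h.conn_O ho
    obtain ⟨n2, h2⟩ := h.nrm h.conn_C hc
    have hm : (o * x) * star c ∈ C := by
      rw [← h.OC]
      refine mul_mem_mul (by rw [← h.OO]; exact mul_mem_mul ho hx) ?_
      rw [← mem_cj, h.cjC]; exact hc
    obtain ⟨n3, h3⟩ := h.trC hm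
    refine ⟨n1 * n + n2 + n3, ?_⟩
    have e : o * x * star (((√(p : ℝ) : ℝ) : H) * c) = ((√(p : ℝ) : ℝ) : H) * (o * x * star c) := by
      rw [star_mul, Quaternion.star_coe, ← mul_assoc (o * x), ← real_comm]
    rw [map_mul, map_mul, normSq_coe', hs2, h1, hn, h2, e, re_coe_mul]
    push_cast
    linear_combination √(p : ℝ) * h3 + n3 * hs2
  have hp0 : (0 : ℝ) < p := by exact_mod_cast hp.out.pos
  -- indices
  have c1 := hPl.1.cov_eq hIl hPI
  have c2 := hIl.cov_eq h.lat hIleO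
  set i1 := P.toAddSubgroup.relIndex I.toAddSubgroup
  set i2 := I.toAddSubgroup.relIndex O.toAddSubgroup
  rw [hPl.2, h.covC] at c1
  rw [h.covO] at c2
  have hii : i1 * i2 = p ^ 2 := by
    rw [c2] at c1
    have : (i1 * i2 : ℝ) * (p / 4) = p ^ 2 * (p / 4) := by linarith
    exact_mod_cast mul_right_cancel₀ (by positivity) this
  have hi2 : i2 ≠ 1 := by
    intro e
    have e2 : I = O := hIl.eq_of_cov h.lat hIleO (by rw [c2, e, h.covO]; simp)
    obtain ⟨m, hm⟩ := hnI 1 (by rw [e2]; exact h.one_mem)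
    rw [map_one] at hm
    have : (p : ℤ) ∣ 1 := ⟨m, by exact_mod_cast hm⟩
    have : p ∣ 1 := by exact_mod_cast this
    exact hp.out.one_lt.ne' (Nat.dvd_one.1 this)
  have hi1 : i1 ≠ 1 := by
    intro e
    have e2 : P = I := hPl.1.eq_of_cov hIl hPI (by rw [hPl.2, h.covC, c1, e]; simp)
    exact hxP (e2 ▸ hxI)
  have hi : i2 = p := by
    have hd : i2 ∣ p ^ 2 := ⟨i1, by rw [← hii, mul_comm]⟩
    rw [Nat.dvd_prime_pow hp.out] at hd
    obtain ⟨k, hk, hk2⟩ := hd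
    interval_cases k
    · simp at hk2; exact absurd hk2 hi2
    · simpa using hk2
    · exfalso
      rw [hk2] at hii
      exact hi1 (Nat.eq_of_mul_eq_mul_right (pow_pos hp.out.pos 2) (by rw [hii, one_mul]))
  obtain ⟨y, hy, hy0, hyn⟩ := hIl.minkowski hs.le (by
    rw [c2, hi]
    have e : √(p : ℝ) ^ 4 = p * p := by
      calc √(p : ℝ) ^ 4 = (√(p : ℝ) * √(p : ℝ)) * (√(p : ℝ) * √(p : ℝ)) := by ring
        _ = _ := by rw [hs2]
    rw [e]
    have := Real.pi_gt_three
    have h9 : 9 < Real.pi ^ 2 := by nlinarith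
    nlinarith [mul_lt_mul_of_pos_right h9 (mul_pos hp0 hp0), mul_pos hp0 hp0])
  obtain ⟨m, hm⟩ := hnI y hy
  have h1 : N y < p := by
    rw [Quaternion.normSq_eq_norm_mul_self, ← hs2]
    exact mul_self_lt_mul_self (norm_nonneg _) hyn
  have h2 := normSq_pos hy0
  rw [hm] at h1 h2
  have h3 : (0 : ℝ) < m := by
    by_contra hc; push Not at hc; nlinarith
  have h4 : (m : ℝ) < 1 := by
    by_contra hc; push Not at hc; nlinarith
  have h3' : 0 < m := by exact_mod_cast h3
  have h4' : m < 1 := by exact_mod_cast h4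
  omega

theorem anisoK (h : Ord p O C) (g : Conn O O' K) {x : H} (hx : x ∈ K) {n : ℕ} (hn : N x = p * n) :
    x ∈ sp ((√(p : ℝ) : ℝ) : H) * (C * K) := by
  have h1 : sp x * cj K ≤ sp ((√(p : ℝ) : ℝ) : H) * C := by
    intro y hy
    rw [mem_sp_mul] at hy
    obtain ⟨z, hz, rfl⟩ := hy
    rw [mem_cj] at hz
    obtain ⟨m, hm⟩ := h.nrm g hz
    rw [Quaternion.normSq_star] at hm
    refine h.aniso (n := n * m) ?_ ?_
    · rw [← g.L]; exact mul_mem_mul hx (mem_cj.2 hz)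
    · rw [map_mul, hn, hm]; push_cast; ring
  have h2 := mul_le_mul_left h1 K
  rw [mul_assoc, g.R, mul_assoc] at h2
  refine h2 ?_
  have := mul_mem_mul (mem_sp x) g.oneR
  rwa [mul_one] at this

end Ord
end MF

namespace MF
open Module MeasureTheory Filter Topology Submodule

local notation "N" => Quaternion.normSq

theorem id_vwv {v w : H} (h1 : v.re = 0) (h2 : w.re = 0) :
    v * w * v = -((T2 v w : ℝ) : H) * v + ((N v : ℝ) : H) * w := by
  ext <;> simp [T2, h1, h2, nsq] <;> ring

theorem id_yxy (x y : H) : y * x * y = ((2 * (x * y).re : ℝ) : H) * y - ((N y : ℝ) : H) * star x := by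
  ext <;> simp [nsq] <;> ring

theorem id_nbeta {v w : H} (h1 : v.re = 0) (h2 : w.re = 0) (s a b d : ℝ) :
    N ((a : H) * (-(v * w)) + (b : H) * ((s : H) * v) + (d : H) * (-(w * v))) =
      (a ^ 2 + d ^ 2) * (N v * N w) + b ^ 2 * (s * s * N v) + a * d * (T2 v w ^ 2 - 2 * (N v * N w)) := by
  simp [T2, h1, h2, Quaternion.normSq_def']; ring

theorem id_tre {v w : H} (h1 : v.re = 0) (h2 : w.re = 0) (s a b : ℝ) :
    2 * (((a : H) * (-(v * w)) + (b : H) * ((s : H) * v)) * (-(v * w))).re =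
      a * (T2 v w ^ 2 - 2 * (N v * N w)) := by
  simp [T2, h1, h2, Quaternion.normSq_def']; ring

theorem id_trh {v w : H} (h1 : v.re = 0) (h2 : w.re = 0) (s a b : ℝ) :
    2 * (((a : H) * (-(v * w)) + (b : H) * ((s : H) * v)) * ((s : H) * w)).re =
      - (b * (s * s * T2 v w)) := by
  simp [T2, h1, h2, Quaternion.normSq_def']; ring

/-- hyperbolic pair modulo `M` -/
structure HP (p : ℕ) (C : Submodule ℤ H) (M : ℤ) where
  v : H
  w : H
  hv : v ∈ C
  hw : w ∈ C
  rv : v.re = 0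
  rw' : w.re = 0
  A : ℤ
  B : ℤ
  G : ℤ
  c : ℤ
  k : ℤ
  nv : N v = M * A
  nw : N w = M * B
  tvw : T2 v w = 1 + M * G
  hc : c * (-(p : ℤ)) = 1 + M * k

/-- congruence modulo `M O` -/
def Cg (O : Submodule ℤ H) (M : ℤ) (x y : H) : Prop := ∃ o ∈ O, x = y + (M : H) * o

section Cg
variable {O : Submodule ℤ H} {M : ℤ} {x y z x' y' : H}

theorem Cg.refl (x : H) : Cg O M x x := ⟨0, zero_mem _, by simp⟩
theorem Cg.symm (h : Cg O M x y) : Cg O M y x := by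
  obtain ⟨o, ho, rfl⟩ := h; exact ⟨-o, neg_mem ho, by noncomm_ring⟩
theorem Cg.trans (h : Cg O M x y) (h' : Cg O M y z) : Cg O M x z := by
  obtain ⟨o, ho, rfl⟩ := h
  obtain ⟨o', ho', rfl⟩ := h'
  exact ⟨o' + o, add_mem ho' ho, by noncomm_ring⟩
theorem Cg.add (h : Cg O M x y) (h' : Cg O M x' y') : Cg O M (x + x') (y + y') := by
  obtain ⟨o, ho, rfl⟩ := h
  obtain ⟨o', ho', rfl⟩ := h'
  exact ⟨o + o', add_mem ho ho', by noncomm_ring⟩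
theorem Cg.mulR (hO : O * O = O) (h : Cg O M x y) (hz : z ∈ O) : Cg O M (x * z) (y * z) := by
  obtain ⟨o, ho, rfl⟩ := h
  exact ⟨o * z, hO ▸ mul_mem_mul ho hz, by rw [add_mul, mul_assoc]⟩
theorem Cg.mulL (hO : O * O = O) (h : Cg O M x y) (hz : z ∈ O) : Cg O M (z * x) (z * y) := by
  obtain ⟨o, ho, rfl⟩ := h
  exact ⟨z * o, hO ▸ mul_mem_mul hz ho, by rw [mul_add, ← mul_assoc, ← mul_assoc, Int.cast_comm]⟩
theorem Cg.int (n : ℤ) (h : Cg O M x y) : Cg O M ((n : H) * x) ((n : H) * y) := by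
  obtain ⟨o, ho, rfl⟩ := h
  exact ⟨n * o, int_mul_mem _ ho, by rw [mul_add, ← mul_assoc, ← mul_assoc, Int.cast_comm n (M : H)]⟩
theorem Cg.mem {J : Submodule ℤ H} (hJ : ∀ o ∈ O, (M : H) * o ∈ J) (h : Cg O M x y) (hy : y ∈ J) : x ∈ J := by
  obtain ⟨o, ho, rfl⟩ := h
  exact add_mem hy (hJ o ho)
end Cg

theorem icoe (n : ℤ) : (((n : ℤ) : ℝ) : H) = (n : H) := by norm_cast

namespace HP
variable {p : ℕ} [hp : Fact p.Prime] {O C : Submodule ℤ H} {M : ℤ} (t : HP p C M)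

/-- idempotent -/
noncomputable def e : H := -(t.v * t.w)
/-- idempotent -/
noncomputable def f : H := -(t.w * t.v)
/-- nilpotent -/
noncomputable def g : H := ((√(p : ℝ) : ℝ) : H) * t.v
/-- nilpotent -/
noncomputable def h : H := ((√(p : ℝ) : ℝ) : H) * t.w

/-- row element -/
noncomputable def ro (r s : ℤ) : H := r * t.e + s * t.g

/-- the generator -/
noncomputable def be (a b d : ℤ) : H := a * t.e + b * t.g + d * t.f

variable (ho : Ord p O C)
include ho

theorem eO : t.e ∈ O := by rw [e, ← ho.CC]; exact neg_mem (mul_mem_mul t.hv t.hw)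
theorem fO : t.f ∈ O := by rw [f, ← ho.CC]; exact neg_mem (mul_mem_mul t.hw t.hv)
theorem gO : t.g ∈ O := by rw [g, ← ho.CC]; exact mul_mem_mul ho.sqC t.hv
theorem hO : t.h ∈ O := by rw [h, ← ho.CC]; exact mul_mem_mul ho.sqC t.hw
theorem roO (r s : ℤ) : t.ro r s ∈ O := add_mem (int_mul_mem _ (t.eO ho)) (int_mul_mem _ (t.gO ho))
theorem beO (a b d : ℤ) : t.be a b d ∈ O :=
  add_mem (add_mem (int_mul_mem _ (t.eO ho)) (int_mul_mem _ (t.gO ho))) (int_mul_mem _ (t.fO ho))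

omit ho in
theorem vv : t.v * t.v = -((M : H) * t.A) := by
  rw [id_sq t.rv, t.nv, Quaternion.coe_mul, icoe, icoe]
omit ho in
theorem ww : t.w * t.w = -((M : H) * t.B) := by
  rw [id_sq t.rw', t.nw, Quaternion.coe_mul, icoe, icoe]
omit ho in
theorem wv : t.w * t.v = -(1 + (M : H) * t.G) - t.v * t.w := by
  rw [id_anti t.rv t.rw', t.tvw, Quaternion.coe_add, Quaternion.coe_mul, icoe, icoe]; simp
omit ho in
theorem vwv : t.v * t.w * t.v = -(1 + (M : H) * t.G) * t.v + (M : H) * t.A * t.w := by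
  rw [id_vwv t.rv t.rw', t.tvw, t.nv, Quaternion.coe_add, Quaternion.coe_mul, Quaternion.coe_mul, icoe, icoe, icoe]; simp

theorem ef1 : Cg O M (t.e + t.f) 1 := by
  refine ⟨t.G * 1, int_mul_mem _ ho.one_mem, ?_⟩
  rw [e, f, t.wv]; noncomm_ring

theorem ee : Cg O M (t.e * t.e) t.e := by
  refine ⟨t.G * t.e - (t.A * (M * (t.B * 1)) : H), sub_mem (int_mul_mem _ (t.eO ho)) ?_, ?_⟩
  · exact int_mul_mem _ (int_mul_mem _ (int_mul_mem _ ho.one_mem))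
  · have : t.e * t.e = t.v * t.w * t.v * t.w := by rw [e]; noncomm_ring
    rw [this, t.vwv, add_mul, mul_assoc _ t.w t.w, t.ww, e]
    noncomm_ring

theorem eg : Cg O M (t.e * t.g) t.g := by
  refine ⟨t.G * t.g - t.A * t.h, sub_mem (int_mul_mem _ (t.gO ho)) (int_mul_mem _ (t.hO ho)), ?_⟩
  have : t.e * t.g = -(((√(p : ℝ) : ℝ) : H) * (t.v * t.w * t.v)) := by
    rw [e, g, ← mul_assoc, neg_mul, ← real_comm]; noncomm_ring
  rw [this, t.vwv, g, h, show -(1 + (M : H) * t.G) * t.v = -t.v - (M : H) * t.G * t.v by noncomm_ring]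
  ext <;> simp <;> ring

theorem ge : Cg O M (t.g * t.e) 0 := by
  refine ⟨t.A * t.h, int_mul_mem _ (t.hO ho), ?_⟩
  have : t.g * t.e = -(((√(p : ℝ) : ℝ) : H) * (t.v * t.v * t.w)) := by
    rw [e, g]; noncomm_ring
  rw [this, t.vv, h]
  ext <;> simp <;> ring

theorem gg : Cg O M (t.g * t.g) 0 := by
  refine ⟨((-(p * t.A) : ℤ) : H) * 1, int_mul_mem _ ho.one_mem, ?_⟩
  have : t.g * t.g = ((√(p : ℝ) * √(p : ℝ) : ℝ) : H) * (t.v * t.v) := by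
    rw [g, Quaternion.coe_mul, mul_assoc, ← mul_assoc t.v, ← real_comm _ t.v]; noncomm_ring
  rw [this, t.vv, sqrtp_sq p]
  ext <;> simp <;> ring

theorem ef : Cg O M (t.e * t.f) 0 := by
  refine ⟨t.B * (M * (t.A * 1)), int_mul_mem _ (int_mul_mem _ (int_mul_mem _ ho.one_mem)), ?_⟩
  have : t.e * t.f = t.v * (t.w * t.w) * t.v := by rw [e, f]; noncomm_ring
  rw [this, t.ww, show t.v * -((M : H) * t.B) * t.v = -((M * t.B) * (t.v * t.v)) by
    have := Int.cast_comm (M * t.B) t.v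
    push_cast at this
    rw [mul_neg, neg_mul, ← this]; noncomm_ring, t.vv]
  noncomm_ring

theorem gf : Cg O M (t.g * t.f) t.g := by
  have h1 := (t.ef1 ho).mulL ho.OO (t.gO ho)
  have h2 := (t.ge ho).symm.add (Cg.refl (t.g * t.f))
  rw [zero_add, ← mul_add] at h2
  simpa using h2.trans h1

theorem chg : Cg O M ((t.c : H) * (t.h * t.g)) t.f := by
  refine ⟨t.k * t.f, int_mul_mem _ (t.fO ho), ?_⟩
  have : t.h * t.g = -(((√(p : ℝ) * √(p : ℝ) : ℝ) : H) * t.f) := by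
    rw [h, g, f, Quaternion.coe_mul, mul_assoc, ← mul_assoc t.w, ← real_comm _ t.w]; noncomm_ring
  rw [this, sqrtp_sq p]
  have h2 := congrArg (fun z : ℤ => (z : H)) t.hc
  push_cast at h2
  have : (t.c : H) * -(((p : ℝ) : H) * t.f) = (t.c * -(p : H)) * t.f := by
    rw [show (((p : ℝ)) : H) = (p : H) by norm_cast]; noncomm_ring
  rw [this, h2]; noncomm_ring

theorem row_surj {x : H} (hx : x ∈ O) : ∃ r s : ℤ, Cg O M (t.e * x) (t.ro r s) := by
  obtain ⟨m, hm⟩ := ho.trO (x * t.e) (ho.OO ▸ mul_mem_mul hx (t.eO ho))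
  obtain ⟨m', hm'⟩ := (ho.memC t.w).1 t.hw x hx
  have hsx : star x ∈ O := by rw [← mem_cj, ho.cjO]; exact hx
  have hex : t.e * x ∈ O := ho.OO ▸ mul_mem_mul (t.eO ho) hx
  refine ⟨m, -m', ?_⟩
  have h1 : Cg O M (t.e * x) (t.e * x * t.e + t.e * x * t.f) := by
    have := ((t.ef1 ho).mulL ho.OO hex).symm
    rwa [mul_one, mul_add] at this
  have h2 : Cg O M (t.e * x * t.e) (m * t.e) := by
    refine ⟨-((M * (t.A * (t.B * star x)))), neg_mem (int_mul_mem _ (int_mul_mem _ (int_mul_mem _ hsx))), ?_⟩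
    rw [id_yxy, hm, icoe, show N t.e = ((M * t.A * (M * t.B) : ℤ) : ℝ) by
      rw [e, Quaternion.normSq_neg, map_mul, t.nv, t.nw]; push_cast; ring, icoe]
    have := Int.cast_comm t.A (M : H)
    push_cast
    rw [show (M : H) * t.A * (M * t.B) = M * (t.A * M * t.B) by noncomm_ring, this]
    noncomm_ring
  have h3 : Cg O M (t.e * x * t.f) (-(m' : H) * (t.e * t.g)) := by
    refine ⟨-(t.B * (t.v * star x * t.v)), neg_mem (int_mul_mem _ ?_), ?_⟩
    · rw [← ho.CC]
      refine mul_mem_mul ?_ t.hv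
      exact (le_of_eq ho.CO) (mul_mem_mul t.hv hsx)
    · have h4 : t.e * x * t.f = t.v * (t.w * x * t.w) * t.v := by rw [e, f]; noncomm_ring
      rw [h4, id_yxy x t.w, re_cycl x t.w, hm', t.nw, e, g]
      have c1 := real_comm (√(p : ℝ) * m') t.v
      have c2 := real_comm (M * t.B) t.v
      have c3 := real_comm (√(p : ℝ)) (t.v * t.w)
      have c4 := real_comm (√(p : ℝ)) (m' : H)
      simp only [Quaternion.coe_mul, icoe] at c1 c2 ⊢
      generalize ((√(p : ℝ) : ℝ) : H) = q at *
      calc _ = (t.v * (q * m')) * t.w * t.v - (t.v * (M * t.B)) * star x * t.v := by noncomm_ring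
        _ = (q * m') * t.v * t.w * t.v - (M * t.B) * t.v * star x * t.v := by rw [c1, c2]
        _ = _ := by
          rw [c4, show -(m' : H) * (-(t.v * t.w) * (q * t.v)) = m' * (t.v * t.w * q) * t.v by noncomm_ring, ← c3]
          noncomm_ring
  have h5 := (t.eg ho).int (-m')
  have h6 := h1.trans (h2.add (h3.trans (by simpa using h5)))
  simpa [ro] using h6

theorem row_inj {r s : ℤ} (h0 : Cg O M (t.ro r s) 0) : M ∣ r ∧ M ∣ s := by
  obtain ⟨o, hoo, h1⟩ := h0
  rw [zero_add] at h1
  have key : ∀ z ∈ O, ∃ n : ℤ, 2 * (t.ro r s * z).re = M * n := by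
    intro z hz
    obtain ⟨n, hn⟩ := ho.trO (o * z) (ho.OO ▸ mul_mem_mul hoo hz)
    refine ⟨n, ?_⟩
    rw [h1, mul_assoc, ← icoe, re_coe_mul, ← hn]; ring
  obtain ⟨n, hn⟩ := key _ (t.eO ho)
  obtain ⟨n', hn'⟩ := key _ (t.hO ho)
  rw [ro, e, g, ← icoe, ← icoe] at hn hn'
  rw [id_tre t.rv t.rw', t.tvw, t.nv, t.nw] at hn
  rw [h, id_trh t.rv t.rw', t.tvw, sqrtp_sq p] at hn'
  have e1 : r * ((1 + M * t.G) ^ 2 - 2 * (M * t.A * (M * t.B))) = M * n := by exact_mod_cast hn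
  have e2 : -(s * (p * (1 + M * t.G))) = M * n' := by exact_mod_cast hn'
  have hc := t.hc
  constructor
  · exact ⟨n - r * (2 * t.G + M * t.G ^ 2 - 2 * (t.A * (M * t.B))), by linear_combination e1⟩
  · exact ⟨n' * t.c - s * t.k - s * t.G - s * t.G * t.k * M, by
      linear_combination t.c * e2 + (-s - s * M * t.G) * hc⟩

omit ho in
theorem nbe (a b d : ℤ) : ∃ k : ℤ, N (t.be a b d) = ((a * d + M * k : ℤ) : ℝ) := by
  refine ⟨(a ^ 2 + d ^ 2) * (t.A * (M * t.B)) + b ^ 2 * p * t.A + a * d * (2 * t.G + M * t.G ^ 2 - 2 * (t.A * (M * t.B))), ?_⟩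
  rw [be, e, f, g, ← icoe, ← icoe, ← icoe, id_nbeta t.rv t.rw', t.tvw, t.nv, t.nw, sqrtp_sq p]
  push_cast; ring

end HP
end MF

namespace MF
open Module MeasureTheory Filter Topology Submodule

local notation "N" => Quaternion.normSq

theorem ncoe (n : ℕ) : (((n : ℕ) : ℝ) : H) = (n : H) := by norm_cast

theorem hnf (G : AddSubgroup (ℤ × ℤ)) (n : ℤ) (hn : 0 < n) (h1 : (n, 0) ∈ G) (h2 : (0, n) ∈ G) :
    ∃ a b d : ℤ, 0 < a ∧ 0 < d ∧ 0 ≤ b ∧ b < d ∧ a ∣ n ∧ d ∣ n ∧ (a, b) ∈ G ∧ (0, d) ∈ G ∧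
      ∀ r s : ℤ, (r, s) ∈ G → ∃ k l : ℤ, r = k * a ∧ s = k * b + l * d := by
  have pos : ∀ S : AddSubgroup ℤ, n ∈ S → ∃ a : ℤ, 0 < a ∧ a ∣ n ∧ a ∈ S ∧ ∀ x ∈ S, a ∣ x := by
    intro S hS
    obtain ⟨a, ha⟩ := Int.subgroup_cyclic S
    rw [← AddSubgroup.zmultiples_eq_closure] at ha
    subst ha
    have hd : ∀ x ∈ AddSubgroup.zmultiples a, a ∣ x := fun x hx => Int.mem_zmultiples_iff.1 hx
    have ha0 : a ≠ 0 := by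
      rintro rfl
      have := hd n hS
      rw [zero_dvd_iff] at this; omega
    refine ⟨|a|, abs_pos.2 ha0, (abs_dvd _ _).2 (hd n hS), Int.mem_zmultiples_iff.2 ((dvd_abs _ _).2 dvd_rfl), fun x hx => (abs_dvd _ _).2 (hd x hx)⟩
  obtain ⟨a, ha0, han, ha, ha'⟩ := pos (G.map (AddMonoidHom.fst ℤ ℤ)) ⟨_, h1, rfl⟩
  obtain ⟨d, hd0, hdn, hd, hd'⟩ := pos (G.comap (AddMonoidHom.inr ℤ ℤ)) h2
  obtain ⟨⟨a1, b⟩, hab, rfl⟩ := ha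
  simp only [AddMonoidHom.coe_fst] at *
  have hd1 : ((0 : ℤ), d) ∈ G := hd
  have hd2 : ∀ l : ℤ, ((0 : ℤ), l * d) ∈ G := fun l => by simpa using G.zsmul_mem hd1 l
  have hb : (a1, b % d) ∈ G := by
    have := G.sub_mem hab (hd2 (b / d))
    have e : b - b / d * d = b % d := by rw [Int.emod_def]; ring
    simpa [e] using this
  refine ⟨a1, b % d, d, ha0, hd0, Int.emod_nonneg _ hd0.ne', Int.emod_lt_of_pos _ hd0, han, hdn, hb, hd1, ?_⟩
  intro r s hrs
  obtain ⟨k, hk⟩ := ha' r ⟨_, hrs, rfl⟩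
  have h3 : ((0 : ℤ), s - k * (b % d)) ∈ G := by
    have := G.sub_mem hrs (G.zsmul_mem hb k)
    simpa [hk, mul_comm] using this
  obtain ⟨l, hl⟩ := hd' _ h3
  exact ⟨k, l, by rw [hk]; ring, by linarith [hl, mul_comm d l]⟩

theorem hnf_unique {a b d a' b' d' : ℤ} (ha : 0 < a) (hd : 0 < d) (hb : 0 ≤ b) (hb' : b < d)
    (ha2 : 0 < a') (hd2 : 0 < d') (hb2 : 0 ≤ b') (hb2' : b' < d')
    (h : ∀ r s : ℤ, (∃ k l : ℤ, r = k * a ∧ s = k * b + l * d) ↔ ∃ k l : ℤ, r = k * a' ∧ s = k * b' + l * d') :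
    b = b' ∧ d = d' := by
  obtain ⟨k1, l1, e1, e2⟩ := (h a b).1 ⟨1, 0, by ring, by ring⟩
  obtain ⟨k2, l2, e3, e4⟩ := (h a' b').2 ⟨1, 0, by ring, by ring⟩
  obtain ⟨k3, l3, e5, e6⟩ := (h 0 d).1 ⟨0, 1, by ring, by ring⟩
  obtain ⟨k4, l4, e7, e8⟩ := (h 0 d').2 ⟨0, 1, by ring, by ring⟩
  have haa : a = a' := Int.dvd_antisymm ha.le ha2.le ⟨k2, by rw [e3]; ring⟩ ⟨k1, by rw [e1]; ring⟩
  have k3z : k3 = 0 := by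
    rcases mul_eq_zero.1 e5.symm with h | h
    · exact h
    · omega
  have k4z : k4 = 0 := by
    rcases mul_eq_zero.1 e7.symm with h | h
    · exact h
    · omega
  rw [k3z] at e6; rw [k4z] at e8
  have hdd : d = d' := Int.dvd_antisymm hd.le hd2.le ⟨l4, by rw [e8]; ring⟩ ⟨l3, by rw [e6]; ring⟩
  subst haa; subst hdd
  have k1z : k1 = 1 := by
    have : (k1 - 1) * a = 0 := by linear_combination -e1
    rcases mul_eq_zero.1 this with h | h <;> omega
  rw [k1z] at e2
  refine ⟨?_, rfl⟩
  have h1 : l1 * d < d := by linarith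
  have h2 : -d < l1 * d := by linarith
  have h3 : l1 < 1 := by nlinarith
  have h4 : -1 < l1 := by nlinarith
  have : l1 = 0 := by omega
  rw [this] at e2; linarith

/-- primitive left ideals of norm `n` -/
structure JJ (O : Submodule ℤ H) (n : ℕ) (J : Submodule ℤ H) : Prop where
  le : J ≤ O
  OJ : O * J = J
  JcJ : J * cj J = sp (n : H) * O
  mem : (n : H) ∈ cj J * J

/-- the left ideal `O β + M O` -/
noncomputable def Jb (O : Submodule ℤ H) (M : ℤ) (β : H) : Submodule ℤ H := O * sp β ⊔ sp (M : H) * O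

theorem mem_Jb {O : Submodule ℤ H} {M : ℤ} {β x : H} : x ∈ Jb O M β ↔ ∃ o ∈ O, Cg O M x (o * β) := by
  rw [Jb, Submodule.mem_sup]
  constructor
  · rintro ⟨y, hy, z, hz, rfl⟩
    obtain ⟨o, ho, rfl⟩ := mem_mul_sp.1 hy
    obtain ⟨o', ho', rfl⟩ := mem_sp_mul.1 hz
    exact ⟨o, ho, o', ho', rfl⟩
  · rintro ⟨o, ho, o', ho', rfl⟩
    exact ⟨_, mem_mul_sp.2 ⟨o, ho, rfl⟩, _, mem_sp_mul.2 ⟨o', ho', rfl⟩, rfl⟩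

section
variable {p : ℕ} [hp : Fact p.Prime] {O C : Submodule ℤ H}

theorem Ord.mulO (ho : Ord p O C) {x y : H} (hx : x ∈ O) (hy : y ∈ O) : x * y ∈ O := ho.OO ▸ mul_mem_mul hx hy
theorem Ord.starO (ho : Ord p O C) {x : H} (hx : x ∈ O) : star x ∈ O := by rw [← mem_cj, ho.cjO]; exact hx

theorem Jb_JJ (ho : Ord p O C) {M k N0 : ℤ} {n : ℕ} {β : H} (hβ : β ∈ O)
    (hn : N β = ((n + M * k : ℤ) : ℝ)) (hnM : (n : ℤ) ∣ M) (h0 : (N0 : H) ∈ Jb O M β) (hM : M = N0 * N0) :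
    JJ O n (Jb O M β) := by
  have hle : Jb O M β ≤ O := by
    intro x hx
    obtain ⟨o, hoo, o', ho', rfl⟩ := mem_Jb.1 hx
    exact add_mem (ho.mulO hoo hβ) (int_mul_mem _ ho')
  have hmul : ∀ o ∈ O, ∀ x ∈ Jb O M β, o * x ∈ Jb O M β := by
    intro o hoo x hx
    obtain ⟨o1, h1, h2⟩ := mem_Jb.1 hx
    exact mem_Jb.2 ⟨o * o1, ho.mulO hoo h1, by rw [mul_assoc]; exact h2.mulL ho.OO hoo⟩
  have hmul' : ∀ o ∈ O, ∀ x ∈ cj (Jb O M β), x * o ∈ cj (Jb O M β) := by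
    intro o hoo x hx
    rw [mem_cj] at hx ⊢
    rw [star_mul]; exact hmul _ (ho.starO hoo) _ hx
  have hβJ : β ∈ Jb O M β := mem_Jb.2 ⟨1, ho.one_mem, by rw [one_mul]; exact Cg.refl _⟩
  have hbb : β * star β = (n : H) + M * k := by
    rw [Quaternion.self_mul_star, hn, icoe]; push_cast; rfl
  have hbb' : star β * β = (n : H) + M * k := by
    rw [Quaternion.star_mul_self, hn, icoe]; push_cast; rfl
  have hMk : (M : H) = N0 * N0 := by rw [hM]; push_cast; rfl
  have h0' : (N0 : H) ∈ cj (Jb O M β) := by rw [mem_cj]; simpa using h0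
  refine ⟨hle, ?_, ?_, ?_⟩
  · apply le_antisymm
    · rw [Submodule.mul_le]; exact hmul
    · exact one_mul_le ho.one_mem
  · apply le_antisymm
    · rw [Submodule.mul_le]
      intro x hx y hy
      rw [mem_cj] at hy
      obtain ⟨o1, h1, o2, h2, rfl⟩ := mem_Jb.1 hx
      obtain ⟨o3, h3, o4, h4, h5⟩ := mem_Jb.1 hy
      obtain ⟨m, hm⟩ := hnM
      have hy' : y = star β * star o3 + M * star o4 := by
        rw [← star_star y, h5]; simp [Int.cast_comm]
      have hmH : (M : H) = n * m := by rw [hm]; push_cast; rfl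
      refine mem_sp_mul.2 ⟨o1 * ((1 + m * k : ℤ) * star o3) + m * (o1 * β * star o4) + m * (o2 * y), ?_, ?_⟩
      · have hyO : y ∈ O := by
          have := ho.starO (hle hy); rwa [star_star] at this
        exact add_mem (add_mem (ho.mulO h1 (int_mul_mem _ (ho.starO h3))) (int_mul_mem _ (ho.mulO (ho.mulO h1 hβ) (ho.starO h4))))
          (int_mul_mem _ (ho.mulO h2 hyO))
      · have c1 : (n : H) * o1 = o1 * n := (Nat.cast_comm n o1)
        have c2 : (M : H) * (o1 * β) = o1 * β * M := Int.cast_comm M _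
        have e1 : o1 * β * (star β * star o3) = n * (o1 * (((1 + m * k : ℤ) : H) * star o3)) := by
          calc _ = o1 * (β * star β) * star o3 := by noncomm_ring
            _ = _ := by rw [hbb, hmH, ← mul_assoc (n : H), c1]; push_cast; noncomm_ring
        calc _ = n * (o1 * (((1 + m * k : ℤ) : H) * star o3)) + (n * m) * (o1 * β) * star o4 + n * m * o2 * y := by noncomm_ring
          _ = o1 * β * (star β * star o3) + o1 * β * M * star o4 + M * o2 * y := by rw [e1, ← hmH, c2]
          _ = (o1 * β) * (star β * star o3 + M * star o4) + M * o2 * y := by noncomm_ring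
          _ = _ := by rw [← hy']; noncomm_ring
    · intro x hx
      obtain ⟨o, hoo, rfl⟩ := mem_sp_mul.1 hx
      have : (n : H) * o = β * (star β * o) - N0 * (N0 * (k * o)) := by
        rw [← mul_assoc, hbb, hMk]; noncomm_ring
      rw [this]
      exact sub_mem (mul_mem_mul hβJ (hmul' _ hoo _ (star_mem_cj hβJ)))
        (mul_mem_mul h0 (hmul' _ (int_mul_mem _ hoo) _ h0'))
  · have : (n : H) = star β * β - N0 * (k * N0) := by
      rw [hbb', hMk, Int.cast_comm k]; noncomm_ring
    rw [this]
    exact sub_mem (mul_mem_mul (star_mem_cj hβJ) hβJ) (mul_mem_mul h0' (int_mul_mem _ h0))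

namespace HP
variable {M : ℤ} (t : HP p C M)

theorem ro_add (r s r' s' : ℤ) : t.ro (r + r') (s + s') = t.ro r s + t.ro r' s' := by
  rw [ro, ro, ro]; push_cast; noncomm_ring
theorem ro_sub (r s r' s' : ℤ) : t.ro (r - r') (s - s') = t.ro r s - t.ro r' s' := by
  rw [ro, ro, ro]; push_cast; noncomm_ring
theorem ro_smul (k r s : ℤ) : t.ro (k * r) (k * s) = k * t.ro r s := by
  rw [ro, ro]; push_cast; noncomm_ring

theorem e_be (ho : Ord p O C) (a b d : ℤ) : Cg O M (t.e * t.be a b d) (t.ro a b) := by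
  have h := (((t.ee ho).int a).add ((t.eg ho).int b)).add ((t.ef ho).int d)
  have e1 : t.e * t.be a b d = (a : H) * (t.e * t.e) + (b : H) * (t.e * t.g) + (d : H) * (t.e * t.f) := by
    rw [be, mul_add, mul_add, ← mul_assoc, ← mul_assoc, ← mul_assoc, ← Int.cast_comm, ← Int.cast_comm, ← Int.cast_comm]
    noncomm_ring
  rw [e1]; simpa [ro] using h

theorem g_be (ho : Ord p O C) (a b d : ℤ) : Cg O M (t.g * t.be a b d) (t.ro 0 d) := by
  have h := (((t.ge ho).int a).add ((t.gg ho).int b)).add ((t.gf ho).int d)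
  have e1 : t.g * t.be a b d = (a : H) * (t.g * t.e) + (b : H) * (t.g * t.g) + (d : H) * (t.g * t.f) := by
    rw [be, mul_add, mul_add, ← mul_assoc, ← mul_assoc, ← mul_assoc, ← Int.cast_comm, ← Int.cast_comm, ← Int.cast_comm]
    noncomm_ring
  rw [e1]; simpa [ro] using h

theorem ro_be (ho : Ord p O C) (r s a b d : ℤ) : Cg O M (t.ro r s * t.be a b d) (t.ro (r * a) (r * b + s * d)) := by
  have h := ((t.e_be ho a b d).int r).add ((t.g_be ho a b d).int s)
  rw [← ro_smul, ← ro_smul, ← ro_add] at h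
  rw [ro, add_mul, mul_assoc, mul_assoc]
  simpa using h

theorem e_ro (ho : Ord p O C) (r s : ℤ) : Cg O M (t.e * t.ro r s) (t.ro r s) := by
  have h := ((t.ee ho).int r).add ((t.eg ho).int s)
  have e1 : t.e * t.ro r s = (r : H) * (t.e * t.e) + (s : H) * (t.e * t.g) := by
    rw [ro, mul_add, ← mul_assoc, ← mul_assoc, ← Int.cast_comm, ← Int.cast_comm]
    noncomm_ring
  rw [e1]; simpa [ro] using h

theorem ro_mem (ho : Ord p O C) {n a b d : ℤ} (hn : n = a * d) (hM : M = n * n) (r s : ℤ) :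
    t.ro r s ∈ Jb O M (t.be a b d) ↔ ∃ k l : ℤ, r = k * a ∧ s = k * b + l * d := by
  rw [mem_Jb]
  constructor
  · rintro ⟨x, hx, h⟩
    obtain ⟨r1, s1, h1⟩ := t.row_surj ho hx
    have h2 := (h.mulL ho.OO (t.eO ho))
    rw [← mul_assoc] at h2
    have h3 := ((t.e_ro ho r s).symm.trans h2).trans ((h1.mulR ho.OO (t.beO ho a b d)).trans (t.ro_be ho r1 s1 a b d))
    have h4 : Cg O M (t.ro (r - r1 * a) (s - (r1 * b + s1 * d))) 0 := by
      rw [ro_sub]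
      have := h3.add (Cg.refl (-t.ro (r1 * a) (r1 * b + s1 * d)))
      simpa [sub_eq_add_neg] using this
    obtain ⟨⟨k, hk⟩, l, hl⟩ := t.row_inj ho h4
    subst hM; subst hn
    exact ⟨r1 + k * (a * d) * d, s1 + l * a * a * d - k * a * d * b, by linear_combination hk, by linear_combination hl⟩
  · rintro ⟨k, l, rfl, rfl⟩
    exact ⟨_, t.roO ho k l, (t.ro_be ho k l a b d).symm⟩

/-- the ideal lemma -/
theorem ideal (ho : Ord p O C) {J : Submodule ℤ H} (hle : J ≤ O) (hOJ : O * J = J) {N0 : ℤ} (hN : 0 < N0)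
    (hM : M = N0 * N0) (hJ : (N0 : H) ∈ J) :
    ∃ a b d : ℤ, 0 < a ∧ 0 < d ∧ 0 ≤ b ∧ b < d ∧ a ∣ N0 ∧ d ∣ N0 ∧ J = Jb O M (t.be a b d) := by
  have hm : ∀ o ∈ O, ∀ x ∈ J, o * x ∈ J := fun o h x hx => hOJ ▸ mul_mem_mul h hx
  have hMO : ∀ o ∈ O, (M : H) * o ∈ J := by
    intro o hoo
    have : (M : H) * o = (N0 * o) * N0 := by
      rw [hM, ← Int.cast_comm N0 ((N0 : H) * o)]; push_cast; noncomm_ring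
    rw [this]; exact hm _ (int_mul_mem _ hoo) _ hJ
  let G : AddSubgroup (ℤ × ℤ) :=
    { carrier := {x | t.ro x.1 x.2 ∈ J}
      zero_mem' := by
        show t.ro 0 0 ∈ J
        simp [ro]
      add_mem' := by
        intro x y hx hy
        show t.ro (x.1 + y.1) (x.2 + y.2) ∈ J
        rw [ro_add]; exact add_mem hx hy
      neg_mem' := by
        intro x hx
        show t.ro (-x.1) (-x.2) ∈ J
        have := t.ro_smul (-1) x.1 x.2
        rw [neg_one_mul, neg_one_mul] at this
        rw [this]; exact int_mul_mem _ hx }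
  have hG : ∀ r s, (r, s) ∈ G ↔ t.ro r s ∈ J := fun r s => Iff.rfl
  obtain ⟨a, b, d, ha, hd, hb, hbd, han, hdn, h1, h2, h3⟩ := hnf G N0 hN
    (by rw [hG, ro]
        have := hm _ (t.eO ho) _ hJ
        rw [← Int.cast_comm] at this; simpa using this)
    (by rw [hG, ro]
        have := hm _ (t.gO ho) _ hJ
        rw [← Int.cast_comm] at this; simpa using this)
  rw [hG] at h1 h2
  refine ⟨a, b, d, ha, hd, hb, hbd, han, hdn, ?_⟩
  apply le_antisymm
  · intro x hx
    -- every `y = e y'` in J is in Jb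
    have key : ∀ y ∈ J, t.e * y ∈ Jb O M (t.be a b d) := by
      intro y hy
      obtain ⟨r, s, hrs⟩ := t.row_surj ho (hle hy)
      have : t.ro r s ∈ J := hrs.symm.mem hMO (hm _ (t.eO ho) _ hy)
      obtain ⟨k, l, rfl, rfl⟩ := h3 r s this
      exact mem_Jb.2 ⟨_, t.roO ho k l, hrs.trans (t.ro_be ho k l a b d).symm⟩
    have hmJ : ∀ o ∈ O, ∀ x ∈ Jb O M (t.be a b d), o * x ∈ Jb O M (t.be a b d) := by
      intro o hoo x hx
      obtain ⟨o1, h1, h2⟩ := mem_Jb.1 hx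
      exact mem_Jb.2 ⟨o * o1, ho.mulO hoo h1, by rw [mul_assoc]; exact h2.mulL ho.OO hoo⟩
    have hMJ : ∀ o ∈ O, (M : H) * o ∈ Jb O M (t.be a b d) := fun o hoo =>
      mem_Jb.2 ⟨0, zero_mem _, o, hoo, by simp⟩
    have hg : t.g * x ∈ Jb O M (t.be a b d) := by
      have := (t.eg ho).mulR ho.OO (hle hx)
      rw [mul_assoc] at this
      exact this.symm.mem hMJ (key _ (hm _ (t.gO ho) _ hx))
    have hf : t.f * x ∈ Jb O M (t.be a b d) := by
      have := (t.chg ho).mulR ho.OO (hle hx)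
      rw [mul_assoc, mul_assoc] at this
      exact this.symm.mem hMJ (int_mul_mem _ (hmJ _ (t.hO ho) _ hg))
    have h1 := (t.ef1 ho).mulR ho.OO (hle hx)
    rw [one_mul, add_mul] at h1
    exact h1.symm.mem hMJ (add_mem (key x hx) hf)
  · have hbe : t.be a b d ∈ J := by
      have e1 : t.be a b d = t.ro a b + d * t.f := rfl
      rw [e1]
      refine add_mem h1 ?_
      have h4 := (t.chg ho).int d
      refine h4.symm.mem hMO ?_
      have : (d : H) * (t.c * (t.h * t.g)) = t.c * (t.h * t.ro 0 d) := by
        rw [ro, show ((0 : ℤ) : H) * t.e + d * t.g = d * t.g by simp, ← mul_assoc t.h, ← Int.cast_comm d t.h, ← mul_assoc, Int.cast_comm d (t.c : H)]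
        noncomm_ring
      rw [this]
      exact int_mul_mem _ (hm _ (t.hO ho) _ h2)
    intro x hx
    obtain ⟨o, hoo, h⟩ := mem_Jb.1 hx
    exact h.mem hMO (hm _ hoo _ hbe)

theorem card_JJ (t : HP p C M) (ho : Ord p O C) {n : ℕ} (hn : 0 < n) (hM : M = n * n) :
    Nat.card {J // JJ O n J} = ∑ d ∈ n.divisors, d := by
  have hJ : ∀ d : n.divisors, ∀ b : Fin d.1, JJ O n (Jb O M (t.be ((n / d.1 : ℕ) : ℤ) (b : ℕ) (d.1 : ℕ))) := by
    intro d b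
    obtain ⟨k, hk⟩ := t.nbe ((n / d.1 : ℕ) : ℤ) (b : ℕ) (d.1 : ℕ)
    have hd := Nat.dvd_of_mem_divisors d.2
    have e1 : (((n / d.1 : ℕ) : ℤ) * (d.1 : ℕ)) = n := by exact_mod_cast Nat.div_mul_cancel hd
    rw [e1] at hk
    refine Jb_JJ ho (N0 := n) (t.beO ho _ _ _) hk ⟨n, hM⟩ ?_ hM
    refine mem_Jb.2 ⟨_, ho.starO (t.beO ho ((n / d.1 : ℕ) : ℤ) (b : ℕ) (d.1 : ℕ)), ((-k : ℤ) : H) * 1, int_mul_mem _ ho.one_mem, ?_⟩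
    rw [Quaternion.star_mul_self, hk, icoe]
    push_cast; noncomm_ring
  let F : (Σ d : n.divisors, Fin d.1) → {J // JJ O n J} := fun x => ⟨_, hJ x.1 x.2⟩
  have hF : Function.Bijective F := by
    constructor
    · rintro ⟨⟨d, hd⟩, b, hb⟩ ⟨⟨d', hd'⟩, b', hb'⟩ h
      have h1 : Jb O M (t.be ((n / d : ℕ) : ℤ) b d) = Jb O M (t.be ((n / d' : ℕ) : ℤ) b' d') := congrArg Subtype.val h
      have e1 : (n : ℤ) = (((n / d : ℕ) : ℤ) * (d : ℕ)) := by exact_mod_cast (Nat.div_mul_cancel (Nat.dvd_of_mem_divisors hd)).symm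
      have e2 : (n : ℤ) = (((n / d' : ℕ) : ℤ) * (d' : ℕ)) := by exact_mod_cast (Nat.div_mul_cancel (Nat.dvd_of_mem_divisors hd')).symm
      have p1 : 0 < n / d := Nat.div_pos (Nat.divisor_le hd) (Nat.pos_of_mem_divisors hd)
      have p2 : 0 < n / d' := Nat.div_pos (Nat.divisor_le hd') (Nat.pos_of_mem_divisors hd')
      have := Nat.pos_of_mem_divisors hd
      have := Nat.pos_of_mem_divisors hd'
      obtain ⟨h2, h3⟩ := hnf_unique (a := ((n / d : ℕ) : ℤ)) (b := b) (d := d) (a' := ((n / d' : ℕ) : ℤ)) (b' := b') (d' := d')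
        (by omega) (by omega) (by omega) (by simpa using hb) (by omega) (by omega) (by omega) (by simpa using hb')
        (fun r s => by rw [← t.ro_mem ho e1 hM, ← t.ro_mem ho e2 hM, h1])
      have h2' : b = b' := by omega
      have h3' : d = d' := by omega
      subst h2' h3'; rfl
    · rintro ⟨J, h⟩
      have hnJ : ((n : ℤ) : H) ∈ J := by
        have : cj J * J ≤ J := by
          calc cj J * J ≤ O * J := mul_le_mul_left (by rw [← ho.cjO]; exact cj_mono h.le) _
            _ = J := h.OJ
        simpa using this h.mem
      obtain ⟨a, b, d, ha, hd, hb, hbd, han, hdn, hJb⟩ := t.ideal ho h.le h.OJ (N0 := n) (by omega) hM hnJ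
      lift a to ℕ using ha.le
      lift d to ℕ using hd.le
      lift b to ℕ using hb
      obtain ⟨k, hk⟩ := t.nbe a b d
      have hadM : ((a * d : ℕ) : ℤ) ∣ M := by rw [hM]; push_cast; exact mul_dvd_mul han hdn
      have h2 : JJ O (a * d) J := by
        rw [hJb]
        refine Jb_JJ ho (N0 := n) (t.beO ho _ _ _) (by exact_mod_cast hk) hadM ?_ hM
        rw [← hJb]; exact hnJ
      have dv : ∀ m m' : ℕ, 0 < m' → sp (m : H) * O = sp (m' : H) * O → m' ∣ m := by
        intro m m' hm' hmm
        have : (m : H) ∈ sp (m' : H) * O := by rw [← hmm]; exact mem_sp_mul.2 ⟨1, ho.one_mem, mul_one _⟩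
        obtain ⟨z, hz, hz'⟩ := mem_sp_mul.1 this
        have hz2 : z = (((m : ℝ) / m' : ℝ) : H) := by
          have hne : (m' : H) ≠ 0 := by
            have := coeH_ne (r := (m' : ℝ)) (by exact_mod_cast hm'.ne')
            rwa [ncoe] at this
          apply mul_left_cancel₀ hne
          rw [hz']
          have : (m : ℝ) = m' * ((m : ℝ) / m') := by field_simp
          have h3 := congrArg (fun r : ℝ => (r : H)) this
          rw [Quaternion.coe_mul] at h3
          exact_mod_cast h3
        rw [hz2] at hz
        obtain ⟨q, hq⟩ := ho.int _ hz
        have : (m : ℤ) = m' * q := by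
          have hne : (m' : ℝ) ≠ 0 := by exact_mod_cast hm'.ne'
          field_simp at hq
          exact_mod_cast hq
        exact Int.natCast_dvd_natCast.1 ⟨q, this⟩
      have hadn : a * d = n := by
        have hadpos : 0 < a * d := by
          apply Nat.mul_pos <;> omega
        exact Nat.dvd_antisymm (dv _ _ hadpos (h.JcJ.symm.trans h2.JcJ)) (dv _ _ hn (h2.JcJ.symm.trans h.JcJ))
      refine ⟨⟨⟨d, Nat.mem_divisors.2 ⟨⟨a, by rw [← hadn, mul_comm]⟩, by omega⟩⟩, ⟨b, by show b < d; omega⟩⟩, ?_⟩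
      apply Subtype.ext
      show Jb O M (t.be ((n / d : ℕ) : ℤ) b d) = J
      rw [hJb, ← hadn, Nat.mul_div_cancel _ (by omega)]
  rw [← Nat.card_congr (Equiv.ofBijective F hF), Nat.card_sigma]
  simp only [Nat.card_eq_fintype_card, Fintype.card_fin]
  exact Finset.sum_coe_sort n.divisors (fun d => d)

end HP
end
end MF

namespace MF
open Module MeasureTheory Filter Topology Submodule

local notation "N" => Quaternion.normSq

/-- ternary form -/
def q3 (a b c u v w : ℤ) (x : Fin 3 → ℤ) : ℤ :=
  a * x 0 ^ 2 + b * x 1 ^ 2 + c * x 2 ^ 2 + u * (x 1 * x 2) + v * (x 0 * x 2) + w * (x 0 * x 1)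

/-- polar form -/
def T3 (a b c u v w : ℤ) (x y : Fin 3 → ℤ) : ℤ :=
  2 * a * x 0 * y 0 + 2 * b * x 1 * y 1 + 2 * c * x 2 * y 2 + u * (x 1 * y 2 + x 2 * y 1)
    + v * (x 0 * y 2 + x 2 * y 0) + w * (x 0 * y 1 + x 1 * y 0)

/-- hyperbolic pair mod M -/
def HI (a b c u v w M : ℤ) : Prop := ∃ x y : Fin 3 → ℤ, M ∣ q3 a b c u v w x ∧ M ∣ q3 a b c u v w y ∧
  M ∣ T3 a b c u v w x y - 1

section
variable {a b c u v w : ℤ}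

theorem q3_add (x y : Fin 3 → ℤ) (m n : ℤ) : q3 a b c u v w (m • x + n • y) =
    m ^ 2 * q3 a b c u v w x + n ^ 2 * q3 a b c u v w y + m * n * T3 a b c u v w x y := by
  simp [q3, T3]; ring

theorem T3_add (x y z : Fin 3 → ℤ) (m n : ℤ) : T3 a b c u v w (m • x + n • y) z =
    m * T3 a b c u v w x z + n * T3 a b c u v w y z := by
  simp [T3]; ring

theorem T3_add' (x y z : Fin 3 → ℤ) (m n : ℤ) : T3 a b c u v w z (m • x + n • y) =
    m * T3 a b c u v w z x + n * T3 a b c u v w z y := by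
  simp [T3]; ring

theorem T3_self (x : Fin 3 → ℤ) : T3 a b c u v w x x = 2 * q3 a b c u v w x := by
  simp [T3, q3]; ring

theorem HI.of_dvd {M M' : ℤ} (h : HI a b c u v w M) (hd : M' ∣ M) : HI a b c u v w M' := by
  obtain ⟨x, y, h1, h2, h3⟩ := h
  exact ⟨x, y, hd.trans h1, hd.trans h2, hd.trans h3⟩

theorem HI.sq {M : ℤ} (h : HI a b c u v w M) : HI a b c u v w (M ^ 2) := by
  obtain ⟨x, y, ⟨A, h1⟩, ⟨B, h2⟩, ⟨G, h3⟩⟩ := h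
  have h3' : T3 a b c u v w x y = 1 + M * G := by linarith
  set x' : Fin 3 → ℤ := (1 : ℤ) • x + (-(M * A)) • y with hx'
  set s := G - 2 * M * A * B with hs
  set m := (1 - M * s) ^ 2 * (M * B) with hm
  set y' : Fin 3 → ℤ := (1 - M * s) • y + (-m) • x' with hy'
  have e1 : q3 a b c u v w x' = M ^ 2 * (A ^ 2 * (M * B) - A * G) := by
    rw [hx', q3_add, h1, h2, h3']; ring
  have e2 : T3 a b c u v w x' y = 1 + M * s := by
    rw [hx', T3_add, T3_self, h3', h2, hs]; ring
  have e2' : T3 a b c u v w y x' = 1 + M * s := by rw [← e2]; simp [T3]; ring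
  refine ⟨x', y', ⟨_, e1⟩, ?_, ?_⟩
  · rw [hy', q3_add, e2', h2, e1]
    exact ⟨m ^ 2 * (A ^ 2 * (M * B) - A * G) + m * s ^ 2, by rw [hm]; ring⟩
  · rw [hy', T3_add', e2, T3_self, e1]
    exact ⟨-s ^ 2 - 2 * m * (A ^ 2 * (M * B) - A * G), by ring⟩

theorem HI.mul {M M' : ℤ} (h : HI a b c u v w M) (h' : HI a b c u v w M') (hc : IsCoprime M M') :
    HI a b c u v w (M * M') := by
  obtain ⟨x, y, ⟨A, h1⟩, ⟨B, h2⟩, ⟨G, h3⟩⟩ := h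
  obtain ⟨x', y', ⟨A', h1'⟩, ⟨B', h2'⟩, ⟨G', h3'⟩⟩ := h'
  obtain ⟨r, s, hrs⟩ := hc
  have g1 : T3 a b c u v w x y = 1 + M * G := by linarith
  have g2 : T3 a b c u v w x' y' = 1 + M' * G' := by linarith
  refine ⟨(s * M') • x + (r * M) • x', (s * M') • y + (r * M) • y', ?_, ?_, ?_⟩
  · rw [q3_add, h1, h1']
    exact ⟨s ^ 2 * M' * A + r ^ 2 * M * A' + s * r * T3 a b c u v w x x', by ring⟩
  · rw [q3_add, h2, h2']
    exact ⟨s ^ 2 * M' * B + r ^ 2 * M * B' + s * r * T3 a b c u v w y y', by ring⟩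
  · rw [T3_add, T3_add', T3_add', g1, g2]
    exact ⟨s ^ 2 * M' * G + r ^ 2 * M * G' + s * r * (T3 a b c u v w x y' + T3 a b c u v w x' y) - 2 * s * r,
      by linear_combination (r * M + s * M' + 1) * hrs⟩

theorem HI.prime {l : ℕ} (hl : l.Prime) (hD : ¬ (l : ℤ) ∣ 4 * a * b * c + u * v * w - a * u ^ 2 - b * v ^ 2 - c * w ^ 2) :
    HI a b c u v w l := by
  haveI : Fact l.Prime := ⟨hl⟩
  classical
  -- a nonzero isotropic vector
  obtain ⟨x, hx0, hx⟩ : ∃ x : Fin 3 → ℤ, (¬ ∀ i, (l : ℤ) ∣ x i) ∧ (l : ℤ) ∣ q3 a b c u v w x := by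
    let K := ZMod l
    let f : MvPolynomial (Fin 3) K := ∑ k : Fin 6, MvPolynomial.C (![(a : K), b, c, u, v, w] k) *
      (MvPolynomial.X (![0, 1, 2, 1, 0, 0] k) * MvPolynomial.X (![0, 1, 2, 2, 2, 1] k))
    have hf : f.totalDegree < Fintype.card (Fin 3) := by
      refine lt_of_le_of_lt (MvPolynomial.totalDegree_finsetSum_le (d := 2) ?_) (by simp)
      intro k _
      refine (MvPolynomial.totalDegree_mul _ _).trans ?_
      rw [MvPolynomial.totalDegree_C, zero_add]
      refine (MvPolynomial.totalDegree_mul _ _).trans ?_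
      rw [MvPolynomial.totalDegree_X, MvPolynomial.totalDegree_X]
    have h1 := char_dvd_card_solutions l hf
    have hev : ∀ x : Fin 3 → K, MvPolynomial.eval x f = a * x 0 ^ 2 + b * x 1 ^ 2 + c * x 2 ^ 2 + u * (x 1 * x 2) + v * (x 0 * x 2) + w * (x 0 * x 1) := by
      intro x
      simp [f, Fin.sum_univ_succ]; ring
    have h0 : MvPolynomial.eval (0 : Fin 3 → K) f = 0 := by rw [hev]; simp
    have hcard : 1 < Fintype.card { x : Fin 3 → K // MvPolynomial.eval x f = 0 } := by
      have : 0 < Fintype.card { x : Fin 3 → K // MvPolynomial.eval x f = 0 } := Fintype.card_pos_iff.2 ⟨⟨0, h0⟩⟩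
      exact lt_of_lt_of_le hl.one_lt (Nat.le_of_dvd this h1)
    obtain ⟨⟨y, hy⟩, hy0⟩ := Fintype.exists_ne_of_one_lt_card hcard ⟨0, h0⟩
    rw [hev] at hy
    refine ⟨fun i => (y i).val, ?_, ?_⟩
    · intro h
      apply hy0
      apply Subtype.ext
      funext i
      have := (ZMod.intCast_zmod_eq_zero_iff_dvd ((y i).val : ℤ) l).2 (h i)
      simpa using this
    · rw [← ZMod.intCast_zmod_eq_zero_iff_dvd]
      simp only [q3]
      push_cast
      simpa using hy
  have hli : Prime (l : ℤ) := Nat.prime_iff_prime_int.1 hl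
  -- some partial is nonzero
  obtain ⟨e, he⟩ : ∃ e : Fin 3 → ℤ, ¬ (l : ℤ) ∣ T3 a b c u v w x e := by
    by_contra hcon
    push Not at hcon
    have t1 := hcon ![1, 0, 0]
    have t2 := hcon ![0, 1, 0]
    have t3 := hcon ![0, 0, 1]
    simp only [T3] at t1 t2 t3
    simp at t1 t2 t3
    obtain ⟨k0, hk0⟩ := hx
    obtain ⟨k1, hk1⟩ := t1
    obtain ⟨k2, hk2⟩ := t2
    obtain ⟨k3, hk3⟩ := t3
    rw [q3] at hk0
    have fin : ∀ z : ℤ, (l : ℤ) ∣ (4 * a * b * c + u * v * w - a * u ^ 2 - b * v ^ 2 - c * w ^ 2) * z ^ 2 → (l : ℤ) ∣ z := by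
      intro z hz
      rcases hli.dvd_or_dvd hz with h | h
      · exact absurd h hD
      · exact hli.dvd_of_dvd_pow h
    apply hx0
    intro i
    apply fin
    fin_cases i
    · refine ⟨(4 * b * c - u ^ 2) * k0 - (c * k2 * (l * k2) - u * k2 * (l * k3) + b * k3 * (l * k3)), ?_⟩
      show _ * (x 0) ^ 2 = _
      linear_combination (4 * b * c - u ^ 2) * hk0 - c * (2 * b * x 1 + u * x 2 + w * x 0 + l * k2) * hk2 + u * (l * k3) * hk2 + u * (2 * b * x 1 + u * x 2 + w * x 0) * hk3 - b * (2 * c * x 2 + u * x 1 + v * x 0 + l * k3) * hk3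
    · refine ⟨(4 * a * c - v ^ 2) * k0 - (c * k1 * (l * k1) - v * k1 * (l * k3) + a * k3 * (l * k3)), ?_⟩
      show _ * (x 1) ^ 2 = _
      linear_combination (4 * a * c - v ^ 2) * hk0 - c * (2 * a * x 0 + v * x 2 + w * x 1 + l * k1) * hk1 + v * (l * k3) * hk1 + v * (2 * a * x 0 + v * x 2 + w * x 1) * hk3 - a * (2 * c * x 2 + u * x 1 + v * x 0 + l * k3) * hk3
    · refine ⟨(4 * a * b - w ^ 2) * k0 - (b * k1 * (l * k1) - w * k1 * (l * k2) + a * k2 * (l * k2)), ?_⟩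
      show _ * (x 2) ^ 2 = _
      linear_combination (4 * a * b - w ^ 2) * hk0 - b * (2 * a * x 0 + v * x 2 + w * x 1 + l * k1) * hk1 + w * (l * k2) * hk1 + w * (2 * a * x 0 + v * x 2 + w * x 1) * hk2 - a * (2 * b * x 1 + u * x 2 + w * x 0 + l * k2) * hk2
  have hco : IsCoprime (l : ℤ) (T3 a b c u v w x e) := (Prime.coprime_iff_not_dvd hli).2 he
  obtain ⟨r, s, hrs⟩ := hco
  obtain ⟨A, hA⟩ := hx
  set y : Fin 3 → ℤ := s • e + (-(s ^ 2 * q3 a b c u v w e)) • x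
  have hT : T3 a b c u v w e x = T3 a b c u v w x e := by simp [T3]; ring
  refine ⟨x, y, ⟨A, hA⟩, ?_, ?_⟩
  · rw [q3_add, hA, hT]
    exact ⟨s ^ 2 * q3 a b c u v w e * (r + s ^ 2 * q3 a b c u v w e * A), by
      linear_combination (-s ^ 2 * q3 a b c u v w e) * hrs⟩
  · rw [T3_add', T3_self, hA]
    exact ⟨-r - 2 * s ^ 2 * q3 a b c u v w e * A, by linear_combination hrs⟩

theorem HI.all (M : ℕ) : 0 < M → IsCoprime (M : ℤ) (4 * a * b * c + u * v * w - a * u ^ 2 - b * v ^ 2 - c * w ^ 2) →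
    HI a b c u v w M := by
  induction M using Nat.recOnPosPrimePosCoprime with
  | zero => intro h; omega
  | one => intro _ _; exact ⟨0, 0, by simp, by simp, by simp⟩
  | prime_pow l k hl hk =>
    intro _ hc
    have h1 : HI a b c u v w l := by
      apply HI.prime hl
      rw [← (Prime.coprime_iff_not_dvd (Nat.prime_iff_prime_int.1 hl))]
      exact hc.of_isCoprime_of_dvd_left (by push_cast; exact dvd_pow_self _ hk.ne')
    have h2 : ∀ k : ℕ, HI a b c u v w ((l : ℤ) ^ (2 ^ k)) := by
      intro k
      induction k with
      | zero => simpa using h1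
      | succ k ih => rw [pow_succ, pow_mul]; exact ih.sq
    push_cast
    exact (h2 k).of_dvd (pow_dvd_pow _ (Nat.lt_two_pow_self).le)
  | coprime m n hm hn hmn ihm ihn =>
    intro _ hc
    push_cast at hc ⊢
    exact (ihm (by omega) hc.of_mul_left_left).mul (ihn (by omega) hc.of_mul_left_right) (Nat.isCoprime_iff_coprime.2 hmn)
end

namespace TL
variable {p : ℕ} [hp : Fact p.Prime] (t : TL p)

/-- lattice vector -/
noncomputable def vec (x : Fin 3 → ℤ) : H := x 0 * t.e1 + x 1 * t.e2 + x 2 * t.e3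

theorem vec_C (x) : t.vec x ∈ t.C :=
  add_mem (add_mem (int_mul_mem _ t.e1_C) (int_mul_mem _ t.e2_C)) (int_mul_mem _ t.e3_C)

theorem vec_re (x) : (t.vec x).re = 0 := by
  rw [vec, ← icoe, ← icoe, ← icoe]
  simp only [Quaternion.re_add, re_coe_mul, t.h1, t.h2, t.h3]; simp

theorem id_N3 {e1 e2 e3 : H} (h1 : e1.re = 0) (h2 : e2.re = 0) (h3 : e3.re = 0) (x y z : ℝ) :
    N ((x : H) * e1 + (y : H) * e2 + (z : H) * e3) = N e1 * x ^ 2 + N e2 * y ^ 2 + N e3 * z ^ 2 + T2 e2 e3 * (y * z)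
      + T2 e1 e3 * (x * z) + T2 e1 e2 * (x * y) := by
  simp [T2, h1, h2, h3, Quaternion.normSq_def']; ring

theorem id_T3 {e1 e2 e3 : H} (h1 : e1.re = 0) (h2 : e2.re = 0) (h3 : e3.re = 0) (x y z x' y' z' : ℝ) :
    T2 ((x : H) * e1 + (y : H) * e2 + (z : H) * e3) ((x' : H) * e1 + (y' : H) * e2 + (z' : H) * e3) =
     2 * N e1 * x * x' + 2 * N e2 * y * y' + 2 * N e3 * z * z' + T2 e2 e3 * (y * z' + z * y')
      + T2 e1 e3 * (x * z' + z * x') + T2 e1 e2 * (x * y' + y * x') := by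
  simp [T2, h1, h2, h3, Quaternion.normSq_def']; ring

theorem N_vec (x) : N (t.vec x) = (q3 t.a t.b t.c t.u t.v t.w x : ℤ) := by
  rw [vec, ← MF.icoe, ← MF.icoe, ← MF.icoe, id_N3 t.h1 t.h2 t.h3, t.ha, t.hb, t.hc, t.hu, t.hv, t.hw, q3]; push_cast; ring

theorem T_vec (x y) : T2 (t.vec x) (t.vec y) = (T3 t.a t.b t.c t.u t.v t.w x y : ℤ) := by
  rw [vec, vec]
  simp only [← MF.icoe]
  rw [id_T3 t.h1 t.h2 t.h3, t.ha, t.hb, t.hc, t.hu, t.hv, t.hw, T3]; push_cast; ring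

theorem exists_HP (M : ℕ) (hM : 0 < M) (hc : Nat.Coprime M p) : Nonempty (HP p t.C M) := by
  have hcp : IsCoprime (M : ℤ) (p : ℤ) := Nat.isCoprime_iff_coprime.2 hc
  obtain ⟨x, y, ⟨A, h1⟩, ⟨B, h2⟩, ⟨G, h3⟩⟩ := HI.all (a := t.a) (b := t.b) (c := t.c) (u := t.u) (v := t.v) (w := t.w) M hM
    (by rw [t.nat_disc]; exact hcp)
  obtain ⟨r, s, hrs⟩ := hcp
  exact ⟨{ v := t.vec x, w := t.vec y, hv := t.vec_C x, hw := t.vec_C y, rv := t.vec_re x, rw' := t.vec_re y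
           A := A, B := B, G := G, c := -s, k := -r
           nv := by rw [N_vec, h1]; push_cast; ring
           nw := by rw [N_vec, h2]; push_cast; ring
           tvw := by rw [T_vec, show T3 t.a t.b t.c t.u t.v t.w x y = 1 + M * G by linarith]; push_cast; ring
           hc := by linear_combination hrs }⟩

theorem card_JJ {n : ℕ} (hn : 0 < n) (hc : Nat.Coprime n p) : Nat.card {J // JJ t.O n J} = ∑ d ∈ n.divisors, d := by
  obtain ⟨h⟩ := t.exists_HP (n * n) (by positivity) (Nat.Coprime.mul_left hc hc)
  exact HP.card_JJ h t.ord hn (by push_cast; ring)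

end TL
end MF

namespace MF
open Module MeasureTheory Filter Topology Submodule

local notation "N" => Quaternion.normSq

/-- orthogonal map `x ↦ ε u x ū` -/
noncomputable def rot (ε : ℝ) (u x : H) : H := (ε : H) * (u * x * star u)

theorem unit_l {u : H} (h : N u = 1) : star u * u = 1 := by rw [Quaternion.star_mul_self, h]; rfl
theorem unit_r {u : H} (h : N u = 1) : u * star u = 1 := by rw [Quaternion.self_mul_star, h]; rfl

theorem rot_rot (ε ε' : ℝ) (u u' x : H) : rot ε' u' (rot ε u x) = rot (ε' * ε) (u' * u) x := by
  simp only [rot, star_mul, Quaternion.coe_mul]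
  have := real_comm ε u'
  calc _ = (ε' : H) * ((u' * ε) * (u * x * star u) * star u') := by noncomm_ring
    _ = _ := by rw [← this]; noncomm_ring

theorem rot_one (x : H) : rot 1 1 x = x := by simp [rot]

theorem rot_re (ε : ℝ) {u x : H} (hx : x.re = 0) : (rot ε u x).re = 0 := by
  rw [rot, re_coe_mul, re_cycl, ← mul_assoc, Quaternion.star_mul_self, re_coe_mul, hx]; ring

theorem rot_N {ε : ℝ} (he : ε * ε = 1) {u : H} (hu : N u = 1) (x : H) : N (rot ε u x) = N x := by
  rw [rot, map_mul, map_mul, map_mul, Quaternion.normSq_star, hu, normSq_coe', he]; ring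

theorem rot_T {ε : ℝ} (he : ε * ε = 1) {u : H} (hu : N u = 1) (x y : H) : T2 (rot ε u x) (rot ε u y) = T2 x y := by
  have h : rot ε u x * rot ε u y = u * (x * y) * star u := by
    simp only [rot]
    have h0 : ((ε : ℝ) : H) * ε = 1 := by rw [← Quaternion.coe_mul, he]; rfl
    calc _ = (ε : H) * ((u * x * star u) * ε) * (u * y * star u) := by noncomm_ring
      _ = ((ε : H) * ε) * (u * x * star u) * (u * y * star u) := by rw [← real_comm ε]; noncomm_ring
      _ = u * x * (star u * u) * (y * star u) := by rw [h0]; noncomm_ring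
      _ = _ := by rw [unit_l hu]; noncomm_ring
  rw [T2, T2, h, re_cycl, ← mul_assoc, unit_l hu, one_mul]

theorem rot_add (ε : ℝ) (u x y : H) : rot ε u (x + y) = rot ε u x + rot ε u y := by
  simp only [rot]; noncomm_ring

theorem rot_int (ε : ℝ) (u x : H) (n : ℤ) : rot ε u (n * x) = n * rot ε u x := by
  simp only [rot]
  rw [← mul_assoc u, ← Int.cast_comm, ← mul_assoc (n : H), Int.cast_comm n (ε : H)]; noncomm_ring

theorem refl_ex {x y : H} (hx : x.re = 0) (hy : y.re = 0) (h : N x = N y) :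
    ∃ (ε : ℝ) (u : H), ε * ε = 1 ∧ N u = 1 ∧ rot ε u x = y ∧
      ∀ z : H, z.re = 0 → T2 z x = T2 z y → rot ε u z = z := by
  by_cases hxy : x = y
  · subst hxy
    exact ⟨1, 1, by ring, by simp, rot_one x, fun z _ _ => rot_one z⟩
  set v := x - y with hv
  have hv0 : v ≠ 0 := sub_ne_zero.2 hxy
  have hvr : v.re = 0 := by simp [hv, hx, hy]
  have hNv := normSq_pos hv0
  set r : ℝ := √(N v) with hr
  have hrp : 0 < r := Real.sqrt_pos.2 hNv
  have hr2 : r * r = N v := Real.mul_self_sqrt hNv.le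
  have key : ∀ z : H, z.re = 0 → rot (-1) ((r⁻¹ : ℝ) * v) z = z - ((T2 v z / N v : ℝ) : H) * v := by
    intro z hz
    have h1 := id_vwv hvr hz
    have hsv : star v = -v := by ext <;> simp [hvr]
    have h2 : rot (-1) ((r⁻¹ : ℝ) * v) z = (((N v)⁻¹ : ℝ) : H) * (v * z * v) := by
      rw [rot, star_mul, hsv, Quaternion.star_coe, ← hr2, mul_inv, Quaternion.coe_mul]
      have := real_comm r⁻¹ (v * z * v)
      rw [Quaternion.coe_neg, Quaternion.coe_one]
      calc _ = ((r⁻¹ : ℝ) : H) * ((v * z * v) * ((r⁻¹ : ℝ) : H)) := by noncomm_ring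
        _ = _ := by rw [← this]; noncomm_ring
    rw [h2, h1, mul_add, ← mul_assoc, ← mul_assoc, ← Quaternion.coe_mul, inv_mul_cancel₀ hNv.ne', mul_neg, ← Quaternion.coe_mul,
      show (N v)⁻¹ * T2 v z = T2 v z / N v by ring]
    rw [Quaternion.coe_one]; noncomm_ring
  refine ⟨-1, (r⁻¹ : ℝ) * v, by ring, ?_, ?_, ?_⟩
  · rw [map_mul, normSq_coe', ← hr2]; field_simp
  · rw [key x hx]
    have : T2 v x = N v := by
      have h3 : N v = 2 * N x - T2 x y := by
        have e : N v = N x + N y - T2 x y := by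
          simp [hv, T2, hx, hy, Quaternion.normSq_def']; ring
        rw [e, ← h]; ring
      rw [h3]; simp [hv, T2, hx, hy, Quaternion.normSq_def']; ring
    rw [this, div_self hNv.ne', hv]; simp
  · intro z hz hzz
    rw [key z hz]
    have : T2 v z = 0 := by
      have : T2 v z = T2 z x - T2 z y := by simp [hv, T2]; ring
      rw [this, hzz, sub_self]
    rw [this]; simp

theorem sq1 {a b : ℝ} (h : a * a = 1) (h' : b * b = 1) : (a * b) * (a * b) = 1 := by
  linear_combination h' + (b * b) * h

theorem ROT2 {e1 e2 f1 f2 : H} (h1 : e1.re = 0) (h2 : e2.re = 0) (g1 : f1.re = 0)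
    (g2 : f2.re = 0) (n1 : N e1 = N f1) (n2 : N e2 = N f2)
    (t12 : T2 e1 e2 = T2 f1 f2) :
    ∃ (ε : ℝ) (u : H), ε * ε = 1 ∧ N u = 1 ∧ rot ε u e1 = f1 ∧ rot ε u e2 = f2 := by
  obtain ⟨ε, u, he, hu, k1, -⟩ := refl_ex h1 g1 n1
  obtain ⟨ε', u', he', hu', k2, k3⟩ := refl_ex (x := rot ε u e2) (y := f2) (rot_re ε h2) g2 (by rw [rot_N he hu, n2])
  refine ⟨ε' * ε, u' * u, sq1 he' he, by rw [map_mul, hu', hu, one_mul], ?_, ?_⟩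
  · rw [← rot_rot, k1, k3 f1 g1 (by rw [← k1, rot_T he hu, t12, k1])]
  · rw [← rot_rot, k2]

theorem ROT {e1 e2 e3 f1 f2 f3 : H} (h1 : e1.re = 0) (h2 : e2.re = 0) (h3 : e3.re = 0) (g1 : f1.re = 0)
    (g2 : f2.re = 0) (g3 : f3.re = 0) (n1 : N e1 = N f1) (n2 : N e2 = N f2) (n3 : N e3 = N f3)
    (t12 : T2 e1 e2 = T2 f1 f2) (t13 : T2 e1 e3 = T2 f1 f3) (t23 : T2 e2 e3 = T2 f2 f3) :
    ∃ (ε : ℝ) (u : H), ε * ε = 1 ∧ N u = 1 ∧ rot ε u e1 = f1 ∧ rot ε u e2 = f2 ∧ rot ε u e3 = f3 := by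
  obtain ⟨ε, u, he, hu, k1, k2⟩ := ROT2 h1 h2 g1 g2 n1 n2 t12
  obtain ⟨ε', u', he', hu', k3, k4⟩ := refl_ex (x := rot ε u e3) (y := f3) (rot_re ε h3) g3 (by rw [rot_N he hu, n3])
  refine ⟨ε' * ε, u' * u, sq1 he' he, by rw [map_mul, hu', hu, one_mul], ?_, ?_, ?_⟩
  · rw [← rot_rot, k1, k4 f1 g1 (by rw [← k1, rot_T he hu, t13, k1])]
  · rw [← rot_rot, k2, k4 f2 g2 (by rw [← k2, rot_T he hu, t23, k2])]
  · rw [← rot_rot, k3]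

/-- sign normalisation -/
def psg (u : H) : Prop := 0 < u.re ∨ (u.re = 0 ∧ (0 < u.imI ∨ (u.imI = 0 ∧ (0 < u.imJ ∨ (u.imJ = 0 ∧ 0 < u.imK)))))

open Classical in
/-- sign -/
noncomputable def sgnH (u : H) : ℝ := if psg u then 1 else -1

theorem sgnH_sq (u : H) : sgnH u * sgnH u = 1 := by
  unfold sgnH; split_ifs <;> norm_num

theorem psg_neg {u : H} (hu : u ≠ 0) : psg (-u) ↔ ¬ psg u := by
  unfold psg
  simp only [Quaternion.re_neg, Quaternion.imI_neg, Quaternion.imJ_neg, Quaternion.imK_neg, Left.neg_pos_iff, neg_eq_zero]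
  have hne : ¬ (u.re = 0 ∧ u.imI = 0 ∧ u.imJ = 0 ∧ u.imK = 0) := by
    rintro ⟨a, b, c, d⟩; exact hu (Quaternion.ext _ _ a b c d)
  rcases lt_trichotomy u.re 0 with h | h | h
  · simp [h, h.ne, h.not_gt]
  · rcases lt_trichotomy u.imI 0 with h' | h' | h'
    · simp [h, h', h'.ne, h'.not_gt]
    · rcases lt_trichotomy u.imJ 0 with h2 | h2 | h2
      · simp [h, h', h2, h2.ne, h2.not_gt]
      · rcases lt_trichotomy u.imK 0 with h3 | h3 | h3
        · simp [h, h', h2, h3, h3.ne, h3.not_gt]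
        · exact absurd ⟨h, h', h2, h3⟩ hne
        · simp [h, h', h2, h3, h3.ne', h3.not_gt]
      · simp [h, h', h2, h2.ne', h2.not_gt]
    · simp [h, h', h'.ne', h'.not_gt]
  · simp [h, h.ne', h.not_gt]

theorem sgnH_neg {u : H} (hu : u ≠ 0) : sgnH (-u) = - sgnH u := by
  unfold sgnH
  rw [psg_neg hu]
  by_cases h : psg u <;> simp [h]

/-- conjugated lattice -/
noncomputable def cn (u : H) (K : Submodule ℤ H) : Submodule ℤ H := sp u * K * sp (star u)

theorem mem_cn {u : H} (hu : N u = 1) {K : Submodule ℤ H} {x : H} : x ∈ cn u K ↔ star u * x * u ∈ K := by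
  rw [cn, mem_mul_sp]
  constructor
  · rintro ⟨z, hz, rfl⟩
    obtain ⟨y, hy, rfl⟩ := mem_sp_mul.1 hz
    rw [show star u * (u * y * star u) * u = (star u * u) * y * (star u * u) by noncomm_ring, unit_l hu]
    simpa using hy
  · intro h
    refine ⟨u * (star u * x * u), mem_sp_mul.2 ⟨_, h, rfl⟩, ?_⟩
    rw [show u * (star u * x * u) * star u = (u * star u) * x * (u * star u) by noncomm_ring, unit_r hu]
    simp

theorem cn_mono {u : H} {K K' : Submodule ℤ H} (h : K ≤ K') : cn u K ≤ cn u K' :=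
  mul_le_mul_left (mul_le_mul_right h _) _

theorem unit_ne {u : H} (hu : N u = 1) : u ≠ 0 := by
  rintro rfl; simp at hu

theorem cn_lat {u : H} (hu : N u = 1) {K : Submodule ℤ H} (h : IsLat K) : IsLat (cn u K) ∧ cov (cn u K) = cov K := by
  have hu0 := unit_ne hu
  have hs : star u ≠ 0 := by simpa using hu0
  have h1 := h.spL hu0
  have h2 := h1.1.spR hs
  refine ⟨h2.1, ?_⟩
  rw [cn, h2.2, h1.2, Quaternion.normSq_star, hu]; ring

/-- unit quaternions commuting with a lattice -/
theorem central {K : Submodule ℤ H} (hK : IsLat K) {w : H} (h : ∀ x ∈ K, w * x = x * w) : w = ((w.re : ℝ) : H) := by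
  have h2 : ∀ x : H, w * x = x * w := by
    intro x
    have hx : x ∈ span ℝ (K : Set H) := by rw [hK.top]; trivial
    induction hx using Submodule.span_induction with
    | mem x hx => exact h x hx
    | zero => simp
    | add x y _ _ hx hy => rw [mul_add, add_mul, hx, hy]
    | smul r x _ hx => rw [mul_smul_comm, smul_mul_assoc, hx]
  obtain ⟨qi, i0, i1, i2, i3⟩ : ∃ q : H, q.re = 0 ∧ q.imI = 1 ∧ q.imJ = 0 ∧ q.imK = 0 := ⟨⟨0, 1, 0, 0⟩, rfl, rfl, rfl, rfl⟩
  obtain ⟨qj, j0, j1, j2, j3⟩ : ∃ q : H, q.re = 0 ∧ q.imI = 0 ∧ q.imJ = 1 ∧ q.imK = 0 := ⟨⟨0, 0, 1, 0⟩, rfl, rfl, rfl, rfl⟩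
  have hi := h2 qi
  have hj := h2 qj
  have a1 : (w * qi).imK = (qi * w).imK := by rw [hi]
  have a2 : (w * qi).imJ = (qi * w).imJ := by rw [hi]
  have a3 : (w * qj).imK = (qj * w).imK := by rw [hj]
  simp [i0, i1, i2, i3, j0, j1, j2, j3] at a1 a2 a3
  apply Quaternion.ext
  · simp
  · simp; linarith
  · simp; linarith
  · simp; linarith

end MF

namespace MF
open Module MeasureTheory Filter Topology Submodule

local notation "N" => Quaternion.normSq

theorem T2_polar {x y : H} (hx : x.re = 0) (hy : y.re = 0) : T2 x y = N (x + y) - N x - N y := by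
  simp [T2, hx, hy, Quaternion.normSq_def']; ring

namespace TL
variable {p : ℕ} (t : TL p)

theorem vec_add (x y) : t.vec (x + y) = t.vec x + t.vec y := by
  simp [vec]; noncomm_ring

theorem vec_smul (n : ℤ) (x) : t.vec (n • x) = n * t.vec x := by
  simp [vec, mul_add, mul_assoc]

theorem mem_L' {x : H} : x ∈ t.L ↔ ∃ y, t.vec y = x := by
  rw [mem_L]
  constructor
  · rintro ⟨a, b, c, rfl⟩; exact ⟨![a, b, c], by simp [vec]⟩
  · rintro ⟨y, rfl⟩; exact ⟨y 0, y 1, y 2, rfl⟩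

theorem vec_zero [Fact p.Prime] {x} (h : t.vec x = 0) : x = 0 := by
  have hd := t.nat_disc
  have hT : ∀ y, T3 t.a t.b t.c t.u t.v t.w x y = 0 := by
    intro y
    have := t.T_vec x y
    rw [h] at this
    simp [T2] at this
    exact_mod_cast this.symm
  have t1 := hT ![1, 0, 0]
  have t2 := hT ![0, 1, 0]
  have t3 := hT ![0, 0, 1]
  simp [T3] at t1 t2 t3
  have hp : (p : ℤ) ≠ 0 := by exact_mod_cast (Fact.out : p.Prime).ne_zero
  have k0 : (2 * p : ℤ) * x 0 = 0 := by
    rw [← hd]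
    linear_combination (4 * t.b * t.c - t.u ^ 2) * t1 + (t.u * t.v - 2 * t.c * t.w) * t2 + (t.u * t.w - 2 * t.b * t.v) * t3
  have k1 : (2 * p : ℤ) * x 1 = 0 := by
    rw [← hd]
    linear_combination (4 * t.a * t.c - t.v ^ 2) * t2 + (t.u * t.v - 2 * t.c * t.w) * t1 + (t.v * t.w - 2 * t.a * t.u) * t3
  have k2 : (2 * p : ℤ) * x 2 = 0 := by
    rw [← hd]
    linear_combination (4 * t.a * t.b - t.w ^ 2) * t3 + (t.v * t.w - 2 * t.a * t.u) * t2 + (t.u * t.w - 2 * t.b * t.v) * t1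
  have h2 : (2 * p : ℤ) ≠ 0 := by positivity
  ext i
  fin_cases i
  · simpa [h2, hp] using k0
  · simpa [h2, hp] using k1
  · simpa [h2, hp] using k2

theorem vec_inj [Fact p.Prime] {x y} (h : t.vec x = t.vec y) : x = y := by
  have : t.vec (x + (-1 : ℤ) • y) = 0 := by rw [vec_add, vec_smul, h]; simp
  have := t.vec_zero this
  simpa [add_neg_eq_zero] using this

theorem L_of_C [Fact p.Prime] {x : H} (h : x ∈ t.C) (hx : x.re = 0) : x ∈ t.L := by
  obtain ⟨n0, n1, n2, n3, rfl⟩ := t.mem_C.1 h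
  have ho := t.hor
  have hs := sqrtp_pos p
  have e : ∀ (n : ℤ) (y : H), ((n : H) * y).re = n * y.re := by
    intro n y; rw [← icoe, re_coe_mul]
  rw [Quaternion.re_add, Quaternion.re_add, Quaternion.re_add, e, e, e, e, t.h1, t.h2, t.h3] at hx
  have : (n3 : ℝ) * √(p : ℝ) = 0 := by rw [← ho]; linarith
  have h3 : (n3 : ℝ) = 0 := by
    rcases mul_eq_zero.1 this with h | h
    · exact h
    · exact absurd h hs.ne'
  have h3 : n3 = 0 := by exact_mod_cast h3
  exact t.mem_L.2 ⟨n0, n1, n2, by simp [h3]⟩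

theorem L_le_C [Fact p.Prime] : t.L ≤ t.C := by
  intro x hx
  obtain ⟨y, rfl⟩ := t.mem_L'.1 hx
  exact t.vec_C y

theorem L_re [Fact p.Prime] {x : H} (hx : x ∈ t.L) : x.re = 0 := by
  obtain ⟨y, rfl⟩ := t.mem_L'.1 hx
  exact t.vec_re y

theorem e1_L : t.e1 ∈ t.L := t.mem_L.2 ⟨1, 0, 0, by simp⟩
theorem e2_L : t.e2 ∈ t.L := t.mem_L.2 ⟨0, 1, 0, by simp⟩
theorem e3_L : t.e3 ∈ t.L := t.mem_L.2 ⟨0, 0, 1, by simp⟩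

variable (t' : TL p)

theorem conj_C [Fact p.Prime] {u : H} (hu : N u = 1) (h : cn u t'.O = t.O) {x : H} (hx : x ∈ t'.C) :
    u * x * star u ∈ t.C := by
  rw [t.ord.memC]
  intro o ho
  rw [← h, mem_cn hu] at ho
  obtain ⟨m, hm⟩ := (t'.ord.memC x).1 hx _ ho
  refine ⟨m, ?_⟩
  rw [← hm, show u * x * star u * o = u * (x * star u * o) by noncomm_ring, re_cycl]
  congr 2; noncomm_ring

theorem rot_L [Fact p.Prime] {ε : ℝ} {u : H} (he : ε * ε = 1) (hu : N u = 1) (h : cn u t'.O = t.O) {x : H} (hx : x ∈ t'.L) :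
    rot ε u x ∈ t.L := by
  have h1 : u * x * star u ∈ t.L := by
    apply t.L_of_C (t.conj_C t' hu h (t'.L_le_C hx))
    have := rot_re 1 (u := u) (t'.L_re hx)
    simpa [rot] using this
  rcases mul_self_eq_one_iff.1 he with h2 | h2
  · simpa [rot, h2] using h1
  · simpa [rot, h2] using h1

theorem rot_mul {ε : ℝ} (he : ε * ε = 1) {u : H} (hu : N u = 1) (x y : H) :
    rot ε u x * rot ε u y = u * (x * y) * star u := by
  simp only [rot]
  have h0 : ((ε : ℝ) : H) * ε = 1 := by rw [← Quaternion.coe_mul, he]; rfl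
  calc _ = (ε : H) * ((u * x * star u) * ε) * (u * y * star u) := by noncomm_ring
    _ = ((ε : H) * ε) * (u * x * star u) * (u * y * star u) := by rw [← real_comm ε]; noncomm_ring
    _ = u * x * (star u * u) * (y * star u) := by rw [h0]; noncomm_ring
    _ = _ := by rw [unit_l hu]; noncomm_ring

theorem cn_of_rot [Fact p.Prime] {ε : ℝ} {u : H} (he : ε * ε = 1) (hu : N u = 1)
    (k1 : rot ε u t'.e1 ∈ t.L) (k2 : rot ε u t'.e2 ∈ t.L) (k3 : rot ε u t'.e3 ∈ t.L) : cn u t'.O = t.O := by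
  have hL : ∀ {x y : H}, x ∈ t.L → y ∈ t.L → x * y ∈ t.O := by
    intro x y hx hy
    rw [← t.ord.CC]; exact mul_mem_mul (t.L_le_C hx) (t.L_le_C hy)
  have hle : cn u t'.O ≤ t.O := by
    intro x hx
    rw [mem_cn hu] at hx
    have hx2 : x = u * (star u * x * u) * star u := by
      rw [show u * (star u * x * u) * star u = (u * star u) * x * (u * star u) by noncomm_ring, unit_r hu]; simp
    obtain ⟨n0, n1, n2, n3, hn⟩ := t'.mem_O.1 hx
    have : x = n0 * 1 + n1 * (rot ε u t'.e2 * rot ε u t'.e3) + n2 * (rot ε u t'.e3 * rot ε u t'.e1)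
        + n3 * (rot ε u t'.e1 * rot ε u t'.e2) := by
      rw [hx2, hn, rot_mul he hu, rot_mul he hu, rot_mul he hu]
      have e : ∀ (n : ℤ) (y : H), u * (n * y) * star u = n * (u * y * star u) := by
        intro n y
        rw [← mul_assoc u, ← Int.cast_comm]; noncomm_ring
      have e1 : u * 1 * star u = 1 := by rw [mul_one, unit_r hu]
      rw [mul_add, mul_add, mul_add, add_mul, add_mul, add_mul, e, e, e, e, e1]
    rw [this]
    exact add_mem (add_mem (add_mem (int_mul_mem _ t.one_O) (int_mul_mem _ (hL k2 k3)))
      (int_mul_mem _ (hL k3 k1))) (int_mul_mem _ (hL k1 k2))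
  have hl := cn_lat hu t'.ord.lat
  exact IsLat.eq_of_cov hl.1 t.ord.lat hle (by rw [hl.2, t.ord.covO, t'.ord.covO])

theorem vec_mulVec (m : Matrix (Fin 3) (Fin 3) ℤ) (x) : t.vec (m.mulVec x) =
    x 0 * t.vec (fun i => m i 0) + x 1 * t.vec (fun i => m i 1) + x 2 * t.vec (fun i => m i 2) := by
  have : m.mulVec x = x 0 • (fun i => m i 0) + x 1 • (fun i => m i 1) + x 2 • (fun i => m i 2) := by
    ext i
    simp [Matrix.mulVec, dotProduct, Fin.sum_univ_three]; ring
  rw [this, vec_add, vec_add, vec_smul, vec_smul, vec_smul]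

/-- isometries -/
def Iso : Type := {m : Matrix (Fin 3) (Fin 3) ℤ // ∀ x, N (t.vec (m.mulVec x)) = N (t'.vec x)}

/-- conjugators -/
def Un (A B : Submodule ℤ H) : Type := {u : H // N u = 1 ∧ cn u A = B}

/-- relation -/
def RR (ε : ℝ) (u : H) (m : Matrix (Fin 3) (Fin 3) ℤ) : Prop := ∀ x, t.vec (m.mulVec x) = rot ε u (t'.vec x)

theorem RR_of {ε : ℝ} {u : H} {m : Matrix (Fin 3) (Fin 3) ℤ}
    (h1 : t.vec (fun i => m i 0) = rot ε u t'.e1) (h2 : t.vec (fun i => m i 1) = rot ε u t'.e2)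
    (h3 : t.vec (fun i => m i 2) = rot ε u t'.e3) : RR t t' ε u m := by
  intro x
  rw [vec_mulVec, h1, h2, h3, vec, rot_add, rot_add, rot_int, rot_int, rot_int]

theorem RR_m [Fact p.Prime] {ε : ℝ} {u : H} (he : ε * ε = 1) (hu : N u = 1) (h : cn u t'.O = t.O) :
    ∃ m, RR t t' ε u m := by
  obtain ⟨y1, h1⟩ := t.mem_L'.1 (t.rot_L t' he hu h t'.e1_L)
  obtain ⟨y2, h2⟩ := t.mem_L'.1 (t.rot_L t' he hu h t'.e2_L)
  obtain ⟨y3, h3⟩ := t.mem_L'.1 (t.rot_L t' he hu h t'.e3_L)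
  exact ⟨Matrix.of fun i j => ![y1, y2, y3] j i, RR_of t t' h1 h2 h3⟩

theorem RR_uniq [Fact p.Prime] {ε : ℝ} {u : H} {m m'} (h : RR t t' ε u m) (h' : RR t t' ε u m') : m = m' := by
  have : m.mulVec = m'.mulVec := by
    funext x; exact t.vec_inj (by rw [h x, h' x])
  exact Matrix.mulVec_injective this

theorem RR_iso {ε : ℝ} {u : H} (he : ε * ε = 1) (hu : N u = 1) {m} (h : RR t t' ε u m) (x) :
    N (t.vec (m.mulVec x)) = N (t'.vec x) := by rw [h, rot_N he hu]

theorem rot_negu (ε : ℝ) (u x : H) : rot ε (-u) x = rot ε u x := by simp [rot]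

theorem RR_cn [Fact p.Prime] {ε : ℝ} {u : H} (he : ε * ε = 1) (hu : N u = 1) {m} (h : RR t t' ε u m) : cn u t'.O = t.O := by
  have e1 : t'.vec ![1, 0, 0] = t'.e1 := by simp [vec]
  have e2 : t'.vec ![0, 1, 0] = t'.e2 := by simp [vec]
  have e3 : t'.vec ![0, 0, 1] = t'.e3 := by simp [vec]
  apply t.cn_of_rot t' he hu
  · rw [← e1, ← h]; exact t.mem_L'.2 ⟨_, rfl⟩
  · rw [← e2, ← h]; exact t.mem_L'.2 ⟨_, rfl⟩
  · rw [← e3, ← h]; exact t.mem_L'.2 ⟨_, rfl⟩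

theorem RR_u [Fact p.Prime] {m : Matrix (Fin 3) (Fin 3) ℤ} (h : ∀ x, N (t.vec (m.mulVec x)) = N (t'.vec x)) :
    ∃ u, N u = 1 ∧ cn u t'.O = t.O ∧ RR t t' (sgnH u) u m := by
  have hT : ∀ x y, T2 (t.vec (m.mulVec x)) (t.vec (m.mulVec y)) = T2 (t'.vec x) (t'.vec y) := by
    intro x y
    rw [T2_polar (t.vec_re _) (t.vec_re _), T2_polar (t'.vec_re _) (t'.vec_re _), ← vec_add, ← vec_add,
      ← Matrix.mulVec_add, h, h, h]
  have e1 : t'.vec ![1, 0, 0] = t'.e1 := by simp [vec]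
  have e2 : t'.vec ![0, 1, 0] = t'.e2 := by simp [vec]
  have e3 : t'.vec ![0, 0, 1] = t'.e3 := by simp [vec]
  have c1 : m.mulVec ![1, 0, 0] = fun i => m i 0 := by ext i; simp [Matrix.mulVec, dotProduct, Fin.sum_univ_three]
  have c2 : m.mulVec ![0, 1, 0] = fun i => m i 1 := by ext i; simp [Matrix.mulVec, dotProduct, Fin.sum_univ_three]
  have c3 : m.mulVec ![0, 0, 1] = fun i => m i 2 := by ext i; simp [Matrix.mulVec, dotProduct, Fin.sum_univ_three]
  obtain ⟨ε, u, he, hu, k1, k2, k3⟩ := ROT t'.h1 t'.h2 t'.h3 (t.vec_re (m.mulVec ![1, 0, 0])) (t.vec_re (m.mulVec ![0, 1, 0]))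
    (t.vec_re (m.mulVec ![0, 0, 1])) (by rw [h, e1]) (by rw [h, e2]) (by rw [h, e3]) (by rw [hT, e1, e2])
    (by rw [hT, e1, e3]) (by rw [hT, e2, e3])
  rw [c1] at k1; rw [c2] at k2; rw [c3] at k3
  have hR : RR t t' ε u m := RR_of t t' k1.symm k2.symm k3.symm
  by_cases hs : sgnH u = ε
  · refine ⟨u, hu, RR_cn t t' he hu hR, by rw [hs]; exact hR⟩
  · have hs' : sgnH (-u) = ε := by
      rw [sgnH_neg (unit_ne hu)]
      rcases mul_self_eq_one_iff.1 he with h1 | h1 <;> rcases mul_self_eq_one_iff.1 (sgnH_sq u) with h2 | h2 <;>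
        simp [h1, h2] at hs ⊢
    have hR' : RR t t' ε (-u) m := by intro x; rw [rot_negu, hR]
    have hu' : N (-u) = 1 := by rw [Quaternion.normSq_neg, hu]
    exact ⟨-u, hu', RR_cn t t' he hu' hR', by rw [hs']; exact hR'⟩

theorem RR_u_uniq [Fact p.Prime] {m : Matrix (Fin 3) (Fin 3) ℤ} {u u' : H} (hu : N u = 1) (hu' : N u' = 1)
    (h : RR t t' (sgnH u) u m) (h' : RR t t' (sgnH u') u' m) : u = u' := by
  have e1 : t'.vec ![1, 0, 0] = t'.e1 := by simp [vec]
  have e2 : t'.vec ![0, 1, 0] = t'.e2 := by simp [vec]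
  have e3 : t'.vec ![0, 0, 1] = t'.e3 := by simp [vec]
  have hs := sqrtp_pos p
  have k1 : rot (sgnH u) u t'.e1 = rot (sgnH u') u' t'.e1 := by rw [← e1, ← h, ← h']
  have k2 : rot (sgnH u) u t'.e2 = rot (sgnH u') u' t'.e2 := by rw [← e2, ← h, ← h']
  have k3 : rot (sgnH u) u t'.e3 = rot (sgnH u') u' t'.e3 := by rw [← e3, ← h, ← h']
  have tri : ∀ v : H, N v = 1 → (rot (sgnH v) v t'.e1 * rot (sgnH v) v t'.e2 * rot (sgnH v) v t'.e3).re
      = sgnH v * (√(p : ℝ) / 2) := by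
    intro v hv
    rw [rot_mul (sgnH_sq v) hv, rot, ← mul_assoc, ← real_comm, mul_assoc, re_coe_mul]
    rw [show v * (t'.e1 * t'.e2) * star v * (v * t'.e3 * star v) = v * (t'.e1 * t'.e2 * (star v * v) * t'.e3 * star v) by noncomm_ring,
      re_cycl, unit_l hv, mul_one, mul_assoc, unit_l hv, mul_one]
    have := t'.hor
    rw [← this]; ring
  have hsg : sgnH u = sgnH u' := by
    have := tri u hu
    rw [k1, k2, k3, tri u' hu'] at this
    have h2 : √(p : ℝ) / 2 ≠ 0 := by positivity
    exact (mul_right_cancel₀ h2 this).symm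
  have hcomm : ∀ x ∈ t'.O, (star u' * u) * x = x * (star u' * u) := by
    have hprod : ∀ x : H, u * x * star u = u' * x * star u' → (star u' * u) * x = x * (star u' * u) := by
      intro x hx
      calc (star u' * u) * x = star u' * (u * x * star u) * u := by
            rw [show star u' * (u * x * star u) * u = star u' * (u * x) * (star u * u) by noncomm_ring, unit_l hu]; noncomm_ring
        _ = _ := by
            rw [hx, show star u' * (u' * x * star u') * u = (star u' * u') * x * (star u' * u) by noncomm_ring, unit_l hu']; noncomm_ring
    have g1 := hprod (t'.e2 * t'.e3) (by rw [← rot_mul (sgnH_sq u) hu, ← rot_mul (sgnH_sq u') hu', k2, k3])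
    have g2 := hprod (t'.e3 * t'.e1) (by rw [← rot_mul (sgnH_sq u) hu, ← rot_mul (sgnH_sq u') hu', k3, k1])
    have g3 := hprod (t'.e1 * t'.e2) (by rw [← rot_mul (sgnH_sq u) hu, ← rot_mul (sgnH_sq u') hu', k1, k2])
    generalize star u' * u = q at g1 g2 g3
    intro x hx
    obtain ⟨n0, n1, n2, n3, rfl⟩ := t'.mem_O.1 hx
    have e : ∀ (n : ℤ) (y : H), q * y = y * q → q * (n * y) = (n * y) * q := by
      intro n y hy
      rw [← mul_assoc, ← Int.cast_comm, mul_assoc, hy, mul_assoc]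
    rw [mul_add, mul_add, mul_add, add_mul, add_mul, add_mul, e n0 1 (by simp), e n1 _ g1, e n2 _ g2, e n3 _ g3]
  have hc := central t'.ord.lat hcomm
  have hN : N (star u' * u) = 1 := by rw [map_mul, Quaternion.normSq_star, hu, hu']; ring
  rw [hc, normSq_coe'] at hN
  have hq : u = u' * (((star u' * u).re : ℝ) : H) := by
    rw [← hc, ← mul_assoc, unit_r hu', one_mul]
  rcases mul_self_eq_one_iff.1 hN with h1 | h1
  · rw [h1] at hq; simpa using hq
  · rw [h1] at hq
    have hq : u = -u' := by simpa using hq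
    rw [hq, sgnH_neg (unit_ne hu')] at hsg
    have := sgnH_sq u'
    have h0 : sgnH u' = 0 := by linarith
    rw [h0] at this; norm_num at this

theorem equiv_Un [Fact p.Prime] : Nonempty (Un t'.O t.O ≃ Iso t t') := by
  choose f hf using fun u : Un t'.O t.O => t.RR_m t' (sgnH_sq u.1) u.2.1 u.2.2
  refine Nonempty.intro (Equiv.ofBijective (fun u => (⟨f u, RR_iso t t' (sgnH_sq u.1) u.2.1 (hf u)⟩ : Iso t t')) ⟨?_, ?_⟩)
  · intro u u' h
    have : f u = f u' := congrArg Subtype.val h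
    exact Subtype.ext (RR_u_uniq t t' u.2.1 u'.2.1 (hf u) (by rw [this]; exact hf u'))
  · intro m
    obtain ⟨u, hu, hc, hR⟩ := t.RR_u t' m.2
    exact ⟨⟨u, hu, hc⟩, Subtype.ext (RR_uniq t t' (hf ⟨u, hu, hc⟩) hR)⟩

instance [Fact p.Prime] : Finite (Iso t t') := by
  have hl := t.ord.latC
  have hfin : ∀ X : ℝ, Finite {x : H // x ∈ t.C ∧ N x ≤ X} := fun X => hl.finite X
  let F : Iso t t' → {x : H // x ∈ t.C ∧ N x ≤ N (t'.vec ![1, 0, 0])} × {x : H // x ∈ t.C ∧ N x ≤ N (t'.vec ![0, 1, 0])}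
      × {x : H // x ∈ t.C ∧ N x ≤ N (t'.vec ![0, 0, 1])} := fun m =>
    (⟨t.vec (m.1.mulVec ![1, 0, 0]), t.vec_C _, (m.2 _).le⟩, ⟨t.vec (m.1.mulVec ![0, 1, 0]), t.vec_C _, (m.2 _).le⟩,
      ⟨t.vec (m.1.mulVec ![0, 0, 1]), t.vec_C _, (m.2 _).le⟩)
  have := hfin (N (t'.vec ![1, 0, 0]))
  have := hfin (N (t'.vec ![0, 1, 0]))
  have := hfin (N (t'.vec ![0, 0, 1]))
  refine Finite.of_injective F ?_
  intro m m' h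
  simp only [F, Prod.mk.injEq, Subtype.mk.injEq] at h
  obtain ⟨h1, h2, h3⟩ := h
  have h1 := t.vec_inj h1
  have h2 := t.vec_inj h2
  have h3 := t.vec_inj h3
  apply Subtype.ext
  ext i j
  have g1 := congrFun h1 i
  have g2 := congrFun h2 i
  have g3 := congrFun h3 i
  simp [Matrix.mulVec, dotProduct, Fin.sum_univ_three] at g1 g2 g3
  fin_cases j
  · exact g1
  · exact g2
  · exact g3

theorem cn_symm {u : H} (hu : N u = 1) {A B : Submodule ℤ H} (h : cn u A = B) : cn (star u) B = A := by
  have hu' : N (star u) = 1 := by rw [Quaternion.normSq_star, hu]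
  ext x
  rw [mem_cn hu', ← h, mem_cn hu, star_star,
    show star u * (u * x * star u) * u = (star u * u) * x * (star u * u) by noncomm_ring, unit_l hu]
  simp

theorem Iso_inv [Fact p.Prime] (m : Iso t t') : ∃ m' : Iso t' t, m.1 * m'.1 = 1 ∧ m'.1 * m.1 = 1 := by
  obtain ⟨u, hu, hc, hR⟩ := t.RR_u t' m.2
  have hu' : N (star u) = 1 := by rw [Quaternion.normSq_star, hu]
  have hc' := cn_symm hu hc
  obtain ⟨m', hR'⟩ := t'.RR_m t (sgnH_sq u) hu' hc'
  have : m.1 * m' = 1 := by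
    apply Matrix.mulVec_injective
    funext x
    apply t.vec_inj
    rw [← Matrix.mulVec_mulVec, hR, hR', rot_rot, sgnH_sq, unit_r hu, rot_one, Matrix.one_mulVec]
  exact ⟨⟨m', RR_iso t' t (sgnH_sq u) hu' hR'⟩, this, mul_eq_one_comm.1 this⟩

/-- representation of a form by a lattice -/
def Rep (a : Matrix (Fin 3) (Fin 3) ℤ) : Prop := ∀ x, (Qform a x : ℝ) = N (t.vec x)

theorem card_Aut [Fact p.Prime] {a} (h : t.Rep a) : Nat.card (AutGrp a) = Nat.card (Iso t t) := by
  refine Nat.card_congr (Equiv.ofBijective (fun g => (⟨((g.1⁻¹ : GL (Fin 3) ℤ) : Matrix (Fin 3) (Fin 3) ℤ), fun x => ?_⟩ : Iso t t)) ⟨?_, ?_⟩)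
  · have := g.2 x
    rw [← h, ← h, this]
  · intro g g' hg
    have : ((g.1⁻¹ : GL (Fin 3) ℤ) : Matrix (Fin 3) (Fin 3) ℤ) = (g'.1⁻¹ : GL (Fin 3) ℤ) := congrArg Subtype.val hg
    have h2 : g.1⁻¹ = g'.1⁻¹ := Units.ext this
    exact Subtype.ext (inv_injective h2)
  · intro m
    obtain ⟨m', h1, h2⟩ := t.Iso_inv t m
    let g : GL (Fin 3) ℤ := ⟨m'.1, m.1, h2, h1⟩
    refine ⟨⟨g, fun x => ?_⟩, Subtype.ext rfl⟩
    have : (((g⁻¹ : GL (Fin 3) ℤ)) : Matrix (Fin 3) (Fin 3) ℤ) = m.1 := rfl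
    rw [this]
    have h3 := m.2 x
    rw [← h, ← h] at h3
    exact_mod_cast h3

theorem FE_iff [Fact p.Prime] {a b} (h : t.Rep a) (h' : t'.Rep b) : FormEquiv (Qform a) (Qform b) ↔ Nonempty (Iso t t') := by
  constructor
  · rintro ⟨g, hg⟩
    refine ⟨((g⁻¹ : GL (Fin 3) ℤ) : Matrix (Fin 3) (Fin 3) ℤ), fun x => ?_⟩
    rw [← h, ← h', hg]
  · rintro ⟨m⟩
    obtain ⟨m', h1, h2⟩ := t.Iso_inv t' m
    let g : GL (Fin 3) ℤ := ⟨m'.1, m.1, h2, h1⟩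
    refine ⟨g, fun x => ?_⟩
    have : (((g⁻¹ : GL (Fin 3) ℤ)) : Matrix (Fin 3) (Fin 3) ℤ) = m.1 := rfl
    rw [this]
    have h3 := m.2 x
    rw [← h, ← h'] at h3
    exact_mod_cast h3.symm

theorem card_Iso [Fact p.Prime] (hne : Nonempty (Iso t t')) : Nat.card (Iso t t') = Nat.card (Iso t t) := by
  obtain ⟨m⟩ := hne
  obtain ⟨m', h1, h2⟩ := t.Iso_inv t' m
  refine Nat.card_congr (Equiv.ofBijective (fun k => (⟨k.1 * m'.1, fun x => ?_⟩ : Iso t t)) ⟨?_, ?_⟩)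
  · rw [← Matrix.mulVec_mulVec, k.2, m'.2]
  · intro k k' hk
    have : k.1 * m'.1 = k'.1 * m'.1 := congrArg Subtype.val hk
    apply Subtype.ext
    have := congrArg (· * m.1) this
    simpa [Matrix.mul_assoc, h2] using this
  · intro k
    refine ⟨⟨k.1 * m.1, fun x => ?_⟩, Subtype.ext ?_⟩
    · rw [← Matrix.mulVec_mulVec, k.2, m.2]
    · simp [Matrix.mul_assoc, h1]

end TL
end MF

namespace MF
open Module MeasureTheory Filter Topology Submodule

local notation "N" => Quaternion.normSq

theorem Qform_q3 (a : Matrix (Fin 3) (Fin 3) ℤ) (x) :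
    Qform a x = q3 (a 0 0) (a 1 1) (a 2 2) (a 1 2) (a 0 2) (a 0 1) x := by
  simp [Qform, q3, Fin.sum_univ_three]; ring

theorem Tbil_T3 (a : Matrix (Fin 3) (Fin 3) ℤ) (x y) :
    Tbil a x y = T3 (a 0 0) (a 1 1) (a 2 2) (a 1 2) (a 0 2) (a 0 1) x y := by
  rw [Tbil, Qform_q3, Qform_q3, Qform_q3]; simp [q3, T3]; ring

theorem HasDisc_iff (a : Matrix (Fin 3) (Fin 3) ℤ) (d : ℤ) : HasDisc a d ↔
    4 * a 0 0 * a 1 1 * a 2 2 + a 1 2 * a 0 2 * a 0 1 - a 0 0 * a 1 2 ^ 2 - a 1 1 * a 0 2 ^ 2 - a 2 2 * a 0 1 ^ 2 = d := by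
  have he : eps 3 = 1 := by decide
  rw [HasDisc, Matrix.det_fin_three, he]
  simp only [gram, Matrix.of_apply, Tbil_T3]
  simp [T3, Pi.single_apply]
  constructor <;> intro h <;> linarith

theorem exists_q {p : ℕ} (hp : 0 < p) {A B C U V W : ℤ} (hA : 0 < A) (hΔ : 0 < 4 * A * B - W ^ 2)
    (hd : 4 * A * B * C + U * V * W - A * U ^ 2 - B * V ^ 2 - C * W ^ 2 = p) :
    ∃ t : TL p, t.a = A ∧ t.b = B ∧ t.c = C ∧ t.u = U ∧ t.v = V ∧ t.w = W := by
  obtain ⟨α, hα, hα2⟩ : ∃ α : ℝ, 0 < α ∧ α ^ 2 = A := ⟨√(A : ℝ), Real.sqrt_pos.2 (by exact_mod_cast hA), Real.sq_sqrt (by exact_mod_cast hA.le)⟩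
  obtain ⟨δ, hδ, hδ2⟩ : ∃ δ : ℝ, 0 < δ ∧ δ ^ 2 = 4 * A * B - W ^ 2 := by
    have : (0 : ℝ) < 4 * A * B - W ^ 2 := by exact_mod_cast hΔ
    exact ⟨√(4 * A * B - W ^ 2 : ℝ), Real.sqrt_pos.2 this, Real.sq_sqrt this.le⟩
  obtain ⟨π, hπ, hπ2, hπ3⟩ : ∃ π : ℝ, 0 < π ∧ π ^ 2 = p ∧ √(p : ℝ) = π := by
    have : (0 : ℝ) < p := by exact_mod_cast hp
    exact ⟨√(p : ℝ), Real.sqrt_pos.2 this, Real.sq_sqrt this.le, rfl⟩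
  have hd : (4 * A * B * C + U * V * W - A * U ^ 2 - B * V ^ 2 - C * W ^ 2 : ℝ) = p := by exact_mod_cast hd
  obtain ⟨e1, x0, x1, x2, x3⟩ : ∃ q : H, q.re = 0 ∧ q.imI = α ∧ q.imJ = 0 ∧ q.imK = 0 := ⟨⟨0, α, 0, 0⟩, rfl, rfl, rfl, rfl⟩
  obtain ⟨e2, y0, y1, y2, y3⟩ : ∃ q : H, q.re = 0 ∧ q.imI = W / (2 * α) ∧ q.imJ = δ / (2 * α) ∧ q.imK = 0 :=
    ⟨⟨0, W / (2 * α), δ / (2 * α), 0⟩, rfl, rfl, rfl, rfl⟩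
  obtain ⟨e3, z0, z1, z2, z3⟩ : ∃ q : H, q.re = 0 ∧ q.imI = V / (2 * α) ∧ q.imJ = (2 * A * U - W * V) / (2 * α * δ) ∧ q.imK = - π / δ :=
    ⟨⟨0, V / (2 * α), (2 * A * U - W * V) / (2 * α * δ), - π / δ⟩, rfl, rfl, rfl, rfl⟩
  have hα' := hα.ne'
  have hδ' := hδ.ne'
  refine ⟨⟨e1, e2, e3, x0, y0, z0, A, B, C, U, V, W, ?_, ?_, ?_, ?_, ?_, ?_, ?_⟩, rfl, rfl, rfl, rfl, rfl, rfl⟩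
  · simp [Quaternion.normSq_def', x0, x1, x2, x3]; linarith
  · simp [Quaternion.normSq_def', y0, y1, y2, y3]; field_simp
    linear_combination hδ2 - 4 * B * hα2
  · simp [Quaternion.normSq_def', z0, z1, z2, z3]; field_simp
    rw [hα2, hδ2, hπ2, ← hd]; ring
  · simp [T2, y0, y1, y2, y3, z0, z1, z2, z3]; field_simp
    linear_combination - 2 * U * hα2
  · simp [T2, x0, x1, x2, x3, z0, z1, z2, z3]; field_simp
  · simp [T2, x0, x1, x2, x3, y0, y1, y2, y3]; field_simp
  · simp [x0, x1, x2, x3, y0, y1, y2, y3, z0, z1, z2, z3]; rw [hπ3]; field_simp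

theorem exists_Rep {p : ℕ} [hp0 : Fact p.Prime] (hp : 0 < p) {a : Matrix (Fin 3) (Fin 3) ℤ} (h : PosDef a) (hd : HasDisc a p) :
    ∃ t : TL p, t.Rep a := by
  rw [HasDisc_iff] at hd
  have hA : 0 < a 0 0 := by
    have := h ![1, 0, 0] (by intro h; simpa using congrFun h 0)
    rw [Qform_q3] at this; simpa [q3] using this
  have hΔ : 0 < 4 * a 0 0 * a 1 1 - a 0 1 ^ 2 := by
    have := h ![-a 0 1, 2 * a 0 0, 0] (by intro h; have := congrFun h 1; simp at this; omega)
    rw [Qform_q3] at this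
    simp [q3] at this
    have h2 : 0 < a 0 0 * (4 * a 0 0 * a 1 1 - a 0 1 ^ 2) := by nlinarith
    exact pos_of_mul_pos_right h2 hA.le
  obtain ⟨t, h1, h2, h3, h4, h5, h6⟩ := exists_q hp hA hΔ hd
  refine ⟨t, fun x => ?_⟩
  rw [t.N_vec, Qform_q3, h1, h2, h3, h4, h5, h6]

theorem TL.exists_mat {p : ℕ} [Fact p.Prime] (t : TL p) : ∃ a, PosDef a ∧ HasDisc a p ∧ t.Rep a := by
  have hR : t.Rep !![t.a, t.w, t.v; 0, t.b, t.u; 0, 0, t.c] := by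
    intro x; rw [t.N_vec, Qform_q3]; rfl
  refine ⟨_, ?_, ?_, hR⟩
  · intro x hx
    have h1 := normSq_pos (fun h => hx (t.vec_zero h))
    rw [← hR] at h1
    exact_mod_cast h1
  · rw [HasDisc_iff]; exact t.nat_disc
end MF

namespace MF
open Module MeasureTheory Filter Topology Submodule

local notation "N" => Quaternion.normSq

theorem sp_unit {u : H} (hu : N u = 1) : sp (star u) * sp u = 1 := by
  rw [sp_mul_sp, unit_l hu, sp_one]

theorem Conn.cn {O A K : Submodule ℤ H} (g : Conn O A K) {u : H} (hu : N u = 1) :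
    Conn O (MF.cn u A) (K * sp (star u)) := by
  have h1 := sp_unit hu
  refine ⟨g.oneL, ?_, ?_, ?_, ?_, ?_⟩
  · rw [mem_cn hu, mul_one, unit_l hu]; exact g.oneR
  · rw [cj_mul, cj_sp, star_star, mul_assoc, ← mul_assoc (sp (star u)), h1, one_mul, g.L]
  · rw [cj_mul, cj_sp, star_star, MF.cn, ← g.R]; simp only [mul_assoc]
  · rw [← mul_assoc, g.OK]
  · rw [MF.cn, mul_assoc, ← mul_assoc (sp (star u)), ← mul_assoc (sp (star u)), h1, one_mul, ← mul_assoc, g.KO]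

/-- the right order of an ideal of norm `n` -/
noncomputable def RO (n : ℕ) (J : Submodule ℤ H) : Submodule ℤ H := sp (((n : ℝ)⁻¹ : ℝ) : H) * (cj J * J)

theorem ncoeH (n : ℕ) : (((n : ℕ) : ℝ) : H) = (n : H) := by norm_cast

theorem JJ.conn {O J : Submodule ℤ H} {n : ℕ} (hn : 0 < n) (h1 : (1 : H) ∈ O) (h : JJ O n J) {s : ℝ} (hs : s ≠ 0) (hs2 : s * s = n) :
    Conn O (RO n J) (sp ((s⁻¹ : ℝ) : H) * J) := by
  have hn0 : (n : ℝ) ≠ 0 := by positivity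
  have hss : sp ((s⁻¹ : ℝ) : H) * sp ((s⁻¹ : ℝ) : H) = sp (((n : ℝ)⁻¹ : ℝ) : H) := by
    rw [sp_mul_sp, ← Quaternion.coe_mul, ← mul_inv, hs2]
  have hnn : sp (((n : ℝ)⁻¹ : ℝ) : H) * sp (n : H) = 1 := by
    rw [sp_mul_sp, ← ncoeH, ← Quaternion.coe_mul, inv_mul_cancel₀ hn0, Quaternion.coe_one, sp_one]
  have hL : sp ((s⁻¹ : ℝ) : H) * J * cj (sp ((s⁻¹ : ℝ) : H) * J) = O := by
    rw [cj_mul, cj_sp_real, mul_assoc, ← mul_assoc J, h.JcJ, ← sp_comm, ← mul_assoc, hss, ← mul_assoc, hnn, one_mul]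
  have hOK : O * (sp ((s⁻¹ : ℝ) : H) * J) = sp ((s⁻¹ : ℝ) : H) * J := by
    rw [← mul_assoc, ← sp_comm, mul_assoc, h.OJ]
  have hR : cj (sp ((s⁻¹ : ℝ) : H) * J) * (sp ((s⁻¹ : ℝ) : H) * J) = RO n J := by
    rw [cj_mul, cj_sp_real, RO, mul_assoc, ← mul_assoc (sp _), hss, ← mul_assoc, ← sp_comm, mul_assoc]
  refine ⟨h1, ?_, hL, hR, hOK, ?_⟩
  · rw [RO, mem_sp_mul]
    exact ⟨_, h.mem, by rw [← ncoeH, ← Quaternion.coe_mul, inv_mul_cancel₀ hn0, Quaternion.coe_one]⟩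
  · rw [← hR, ← mul_assoc, hL, hOK]

theorem JJ.n_mem {O J : Submodule ℤ H} {n : ℕ} (hcj : cj O = O) (h : JJ O n J) : (n : H) ∈ J := by
  rw [← h.OJ]
  refine mul_le_mul_left (?_ : cj J ≤ O) J h.mem
  rw [← hcj]; exact cj_mono h.le

/-- pairs of an ideal and a conjugator -/
def PA (O A : Submodule ℤ H) (n : ℕ) (q : Submodule ℤ H × H) : Prop :=
  JJ O n q.1 ∧ N q.2 = 1 ∧ cn q.2 (RO n q.1) = A
/-- pairs of a connecting lattice and a vector -/
def PB (O A : Submodule ℤ H) (n : ℕ) (q : Submodule ℤ H × H) : Prop :=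
  Conn O A q.1 ∧ q.2 ∈ cj q.1 ∧ N q.2 = n

theorem PA_PB {O A : Submodule ℤ H} {n : ℕ} (hn : 0 < n) (h1 : (1 : H) ∈ O) (hcj : cj O = O) {s : ℝ} (hs : s ≠ 0)
    (hs2 : s * s = n) {J : Submodule ℤ H} {u : H} (h : PA O A n (J, u)) :
    PB O A n (sp ((s⁻¹ : ℝ) : H) * J * sp (star u), s * u) := by
  obtain ⟨hJ, hu, hA⟩ := h
  simp only at hJ hu hA
  have g := (hJ.conn hn h1 hs hs2).cn hu
  rw [hA] at g
  refine ⟨g, ?_, ?_⟩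
  · simp only
    rw [cj_mul, cj_sp, star_star, mem_sp_mul]
    refine ⟨(s : H), ?_, real_comm _ _ |>.symm⟩
    rw [mem_cj, Quaternion.star_coe, mem_sp_mul]
    refine ⟨n, hJ.n_mem hcj, ?_⟩
    rw [← ncoeH, ← Quaternion.coe_mul, ← hs2, inv_mul_cancel_left₀ hs]
  · simp only
    rw [map_mul, hu, normSq_coe', hs2, mul_one]

theorem sp_smul_inv {s : ℝ} (hs : s ≠ 0) : sp ((s⁻¹ : ℝ) : H) * sp (s : H) = 1 := by
  rw [sp_mul_sp, ← Quaternion.coe_mul, inv_mul_cancel₀ hs, Quaternion.coe_one, sp_one]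

theorem PB_PA {O A : Submodule ℤ H} {n : ℕ} (hn : 0 < n) {s : ℝ} (hs : s ≠ 0)
    (hs2 : s * s = n) {K : Submodule ℤ H} {x : H} (h : PB O A n (K, x)) :
    PA O A n (K * sp x, ((s⁻¹ : ℝ) : H) * x) := by
  obtain ⟨g, hx, hN⟩ := h
  simp only at g hx hN
  have hn0 : (n : ℝ) ≠ 0 := by positivity
  have hxx : x * star x = (n : H) := by rw [Quaternion.self_mul_star, hN, ncoeH]
  have hxx' : star x * x = (n : H) := by rw [Quaternion.star_mul_self, hN, ncoeH]
  have hcJ : cj (K * sp x) * (K * sp x) = sp (star x) * A * sp x := by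
    rw [cj_mul, cj_sp, ← g.R]; simp only [mul_assoc]
  have hu : N (((s⁻¹ : ℝ) : H) * x) = 1 := by
    rw [map_mul, normSq_coe', hN, ← hs2]; field_simp
  refine ⟨⟨?_, ?_, ?_, ?_⟩, hu, ?_⟩
  · rw [← g.L]; exact mul_le_mul_right (sp_le.2 hx) K
  · rw [← mul_assoc, g.OK]
  · rw [cj_mul, cj_sp, mul_assoc, ← mul_assoc (sp x), sp_mul_sp, hxx, ← ncoeH, ← mul_assoc, ← sp_comm, mul_assoc, g.L]
  · simp only
    rw [hcJ, mem_mul_sp]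
    exact ⟨star x, mem_sp_mul.2 ⟨1, g.oneR, mul_one _⟩, hxx'⟩
  · simp only
    rw [RO, hcJ, cn, star_mul, Quaternion.star_coe]
    have e1 : sp (((s⁻¹ : ℝ) : H) * x) * sp (((n : ℝ)⁻¹ : ℝ) : H) * sp (star x) = sp ((s⁻¹ : ℝ) : H) := by
      have : x * (((n : ℝ)⁻¹ : ℝ) : H) * star x = 1 := by
        rw [← real_comm, mul_assoc, hxx, ← ncoeH, ← Quaternion.coe_mul, inv_mul_cancel₀ hn0, Quaternion.coe_one]
      rw [sp_mul_sp, sp_mul_sp, mul_assoc _ x, mul_assoc, this, mul_one]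
    have e2 : sp x * sp (star x * ((s⁻¹ : ℝ) : H)) = sp (s : H) := by
      rw [sp_mul_sp, ← mul_assoc, hxx, ← ncoeH, ← hs2, ← Quaternion.coe_mul, mul_assoc, mul_inv_cancel₀ hs, mul_one]
    calc _ = (sp (((s⁻¹ : ℝ) : H) * x) * sp (((n : ℝ)⁻¹ : ℝ) : H) * sp (star x)) * A * (sp x * sp (star x * ((s⁻¹ : ℝ) : H))) := by
          simp only [mul_assoc]
      _ = A := by rw [e1, e2, sp_comm, mul_assoc, sp_smul_inv hs, mul_one]

theorem card_PA {O A : Submodule ℤ H} {n : ℕ} (hn : 0 < n) (h1 : (1 : H) ∈ O) (hcj : cj O = O) :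
    Nat.card {q // PA O A n q} = Nat.card {q // PB O A n q} := by
  have hn0 : (0 : ℝ) < n := by exact_mod_cast hn
  obtain ⟨s, hs, hs2⟩ : ∃ s : ℝ, s ≠ 0 ∧ s * s = n := ⟨√n, (Real.sqrt_pos.2 hn0).ne', Real.mul_self_sqrt hn0.le⟩
  refine Nat.card_congr
    { toFun := fun q => ⟨(sp ((s⁻¹ : ℝ) : H) * q.1.1 * sp (star q.1.2), s * q.1.2), PA_PB hn h1 hcj hs hs2 q.2⟩
      invFun := fun q => ⟨(q.1.1 * sp q.1.2, ((s⁻¹ : ℝ) : H) * q.1.2), PB_PA hn hs hs2 q.2⟩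
      left_inv := ?_
      right_inv := ?_ }
  · rintro ⟨⟨J, u⟩, hq⟩
    apply Subtype.ext
    have hu : N u = 1 := hq.2.1
    simp only [Prod.mk.injEq]
    constructor
    · rw [← sp_mul_sp, mul_assoc, ← mul_assoc (sp (star u)), ← sp_comm, mul_assoc (sp (s : H)), sp_unit hu, mul_one, mul_assoc,
        ← sp_comm, ← mul_assoc, sp_smul_inv hs, one_mul]
    · rw [← mul_assoc, ← Quaternion.coe_mul, inv_mul_cancel₀ hs, Quaternion.coe_one, one_mul]
  · rintro ⟨⟨K, x⟩, hq⟩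
    apply Subtype.ext
    have hN : N x = n := hq.2.2
    simp only [Prod.mk.injEq]
    constructor
    · rw [star_mul, Quaternion.star_coe, mul_assoc, mul_assoc, sp_mul_sp, ← mul_assoc x, Quaternion.self_mul_star, hN,
        ← Quaternion.coe_mul, ← sp_comm, ← mul_assoc, sp_mul_sp, ← Quaternion.coe_mul,
        show s⁻¹ * ((n : ℝ) * s⁻¹) = 1 by rw [← hs2]; field_simp, Quaternion.coe_one, sp_one, one_mul]
    · rw [← mul_assoc, ← Quaternion.coe_mul, mul_inv_cancel₀ hs, Quaternion.coe_one, one_mul]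

theorem card_PA_sum {O A : Submodule ℤ H} {n : ℕ} [Fintype {J // JJ O n J}] [∀ J : {J // JJ O n J}, Finite (TL.Un (RO n J.1) A)] :
    Nat.card {q // PA O A n q} = ∑ J : {J // JJ O n J}, Nat.card (TL.Un (RO n J.1) A) := by
  rw [← Nat.card_sigma]
  refine Nat.card_congr
    { toFun := fun q => ⟨⟨q.1.1, q.2.1⟩, ⟨q.1.2, q.2.2⟩⟩
      invFun := fun q => ⟨(q.1.1, q.2.1), q.1.2, q.2.2⟩
      left_inv := fun q => rfl
      right_inv := fun q => rfl }
end MF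

namespace MF
open Module MeasureTheory Filter Topology Submodule

local notation "N" => Quaternion.normSq

/-- hypotheses of the mass formula, with chosen lattices -/
structure SD (p : ℕ) (S : Finset (Matrix (Fin 3) (Fin 3) ℤ)) (T : Matrix (Fin 3) (Fin 3) ℤ → TL p) : Prop where
  rep : ∀ a ∈ S, (T a).Rep a
  comp : ∀ b : Matrix (Fin 3) (Fin 3) ℤ, PosDef b → HasDisc b (p : ℤ) → ∃ a ∈ S, FormEquiv (Qform b) (Qform a)
  irr : ∀ a ∈ S, ∀ b ∈ S, FormEquiv (Qform a) (Qform b) → a = b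

variable {p : ℕ} [hp : Fact p.Prime] {S : Finset (Matrix (Fin 3) (Fin 3) ℤ)} {T : Matrix (Fin 3) (Fin 3) ℤ → TL p}

theorem finite_Un (t t' : TL p) : Finite (TL.Un t'.O t.O) := by
  obtain ⟨e⟩ := t.equiv_Un t'
  exact Finite.of_equiv _ e.symm

theorem card_Aut_pos {t : TL p} {a} (h : t.Rep a) : Nat.card (AutGrp a) ≠ 0 := by
  rw [t.card_Aut h]
  have : Nonempty (TL.Iso t t) := ⟨⟨1, fun x => by rw [Matrix.one_mulVec]⟩⟩
  exact Nat.card_pos.ne'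

theorem SD.sum_one (h : SD p S T) (t' : TL p) :
    ∑ a ∈ S, (Nat.card (TL.Un t'.O (T a).O) : ℝ) / Nat.card (AutGrp a) = 1 := by
  obtain ⟨b, hb1, hb2, hb3⟩ := t'.exists_mat
  obtain ⟨a0, ha0, hfe⟩ := h.comp b hb1 hb2
  obtain ⟨m⟩ := (t'.FE_iff (T a0) hb3 (h.rep a0 ha0)).1 hfe
  obtain ⟨m', -, -⟩ := t'.Iso_inv (T a0) m
  rw [Finset.sum_eq_single_of_mem a0 ha0]
  · rw [Nat.card_congr ((T a0).equiv_Un t').some, (T a0).card_Aut (h.rep a0 ha0), (T a0).card_Iso t' ⟨m'⟩]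
    apply div_self
    have := card_Aut_pos (h.rep a0 ha0)
    rw [(T a0).card_Aut (h.rep a0 ha0)] at this
    exact_mod_cast this
  · intro a ha hne
    rw [Nat.card_congr ((T a).equiv_Un t').some]
    have : IsEmpty (TL.Iso (T a) t') := by
      refine ⟨fun k => hne (h.irr a ha a0 ha0 (((T a).FE_iff (T a0) (h.rep a ha) (h.rep a0 ha0)).2 ⟨⟨k.1 * m.1, fun x => ?_⟩⟩))⟩
      rw [← Matrix.mulVec_mulVec, k.2, m.2]
    simp

theorem SD.sum_n (h : SD p S T) (t : TL p) {n : ℕ} (hn : 0 < n) (hc : Nat.Coprime n p) :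
    ∑ a ∈ S, (Nat.card {q // PB t.O (T a).O n q} : ℝ) / Nat.card (AutGrp a) = ∑ d ∈ n.divisors, (d : ℝ) := by
  have hcard := t.card_JJ hn hc
  have hpos : 0 < ∑ d ∈ n.divisors, d := Finset.sum_pos (fun d hd => Nat.pos_of_mem_divisors hd) ⟨1, by simp [hn.ne']⟩
  have hfin : Finite {J // JJ t.O n J} := Nat.finite_of_card_ne_zero (by omega)
  have : Fintype {J // JJ t.O n J} := Fintype.ofFinite _
  have hn0 : (0 : ℝ) < n := by exact_mod_cast hn
  have hT : ∀ J : {J // JJ t.O n J}, ∃ t' : TL p, t'.O = RO n J.1 := by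
    intro J
    have g := J.2.conn hn t.one_O (Real.sqrt_pos.2 hn0).ne' (Real.mul_self_sqrt hn0.le)
    obtain ⟨t', h1, h2⟩ := (t.ord.conn g).exists_TL
    exact ⟨t', h1⟩
  have hf : ∀ a, ∀ J : {J // JJ t.O n J}, Finite (TL.Un (RO n J.1) (T a).O) := by
    intro a J
    obtain ⟨t', ht⟩ := hT J
    rw [← ht]; exact finite_Un _ _
  calc _ = ∑ a ∈ S, ∑ J : {J // JJ t.O n J}, (Nat.card (TL.Un (RO n J.1) (T a).O) : ℝ) / Nat.card (AutGrp a) := by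
        refine Finset.sum_congr rfl fun a ha => ?_
        have := hf a
        rw [← card_PA hn t.one_O t.ord.cjO, card_PA_sum]
        push_cast
        rw [Finset.sum_div]
    _ = ∑ J : {J // JJ t.O n J}, (1 : ℝ) := by
        rw [Finset.sum_comm]
        refine Finset.sum_congr rfl fun J _ => ?_
        obtain ⟨t', ht⟩ := hT J
        rw [← ht]; exact h.sum_one t'
    _ = _ := by
        rw [Finset.sum_const, nsmul_one, Finset.card_univ, ← Nat.card_eq_fintype_card, hcard]; push_cast; rfl

theorem fin_sub {P Q : H → Prop} (hP : Finite {x // P x}) (h : ∀ x, Q x → P x) : Finite {x // Q x} :=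
  Finite.of_injective (Subtype.map id h) (Subtype.map_injective h Function.injective_id)

/-- the numbers up to X prime to p -/
def IX (p X : ℕ) : Finset ℕ := (Finset.Icc 1 X).filter (fun n => Nat.Coprime n p)

theorem mem_IX {X n : ℕ} : n ∈ IX p X ↔ (1 ≤ n ∧ n ≤ X) ∧ Nat.Coprime n p := by simp [IX]

/-- vectors with norm prime to p -/
theorem card_prime_part {O C A K : Submodule ℤ H} (ho : Ord p O C) (g : Conn O A K) (X : ℕ) :
    ((∑ n ∈ IX p X, Nat.card {x // x ∈ cj K ∧ N x = n} : ℕ) : ℝ) = cnt (cj K) X - cnt (cj (C * K)) (X / p) := by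
  have hp0 : (0 : ℝ) < p := by exact_mod_cast hp.out.pos
  have hs := sqrtp_pos p
  have hs2 := sqrtp_sq p
  have hlat : IsLat (cj K) := (g.lat ho.lat).cjL.1
  have hfin : Finite {x // x ∈ cj K ∧ N x ≤ X} := hlat.finite (X : ℝ)
  have hfn : ∀ n : ℕ, (n : ℝ) ≤ X → Finite {x // x ∈ cj K ∧ N x = n} := fun n hn =>
    fin_sub hfin (fun x hx => ⟨hx.1, hx.2.le.trans hn⟩)
  have hnat : ∀ x ∈ cj K, ∃ n : ℕ, N x = n := by
    intro x hx
    obtain ⟨n, hn⟩ := ho.nrm g (mem_cj.1 hx)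
    exact ⟨n, by rw [← hn, Quaternion.normSq_star]⟩
  have hcop : ∀ n : ℕ, Nat.Coprime n p ↔ ¬ p ∣ n := fun n => by
    rw [Nat.coprime_comm, hp.out.coprime_iff_not_dvd]
  -- the divisible part
  have hdiv : cnt (cj (C * K)) (X / p) = Nat.card {x // (x ∈ cj K ∧ N x ≤ X) ∧ ∃ n : ℕ, N x = p * n} := by
    rw [cnt]
    have hsne : ((√(p : ℝ) : ℝ) : H) ≠ 0 := coeH_ne hs.ne'
    refine Nat.card_congr (Equiv.ofBijective (fun x => ⟨((√(p : ℝ) : ℝ) : H) * x.1, ⟨?_, ?_⟩, ?_⟩) ⟨?_, ?_⟩)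
    · rw [mem_cj]
      apply ho.P_le g
      rw [mem_sp_mul]
      exact ⟨star x.1, mem_cj.1 x.2.1, by rw [star_mul, Quaternion.star_coe, real_comm]⟩
    · rw [map_mul, normSq_coe', hs2]
      have := x.2.2
      rw [le_div_iff₀ hp0] at this; linarith
    · obtain ⟨n, hn⟩ := ho.nrm (ho.conn_CK g) (mem_cj.1 x.2.1)
      exact ⟨n, by rw [map_mul, normSq_coe', hs2, ← hn, Quaternion.normSq_star]⟩
    · intro x y h
      have : ((√(p : ℝ) : ℝ) : H) * x.1 = ((√(p : ℝ) : ℝ) : H) * y.1 := congrArg Subtype.val h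
      exact Subtype.ext (mul_left_cancel₀ hsne this)
    · rintro ⟨x, ⟨hx, hX⟩, n, hn⟩
      have h1 := ho.anisoK g (mem_cj.1 hx) (n := n) (by rw [Quaternion.normSq_star, hn])
      rw [mem_sp_mul] at h1
      obtain ⟨z, hz, hzx⟩ := h1
      have hx2 : x = ((√(p : ℝ) : ℝ) : H) * star z := by
        rw [← star_star x, ← hzx, star_mul, Quaternion.star_coe, real_comm]
      refine ⟨⟨star z, star_mem_cj hz, ?_⟩, Subtype.ext hx2.symm⟩
      rw [le_div_iff₀ hp0]
      rw [hx2, map_mul, normSq_coe', hs2] at hX; linarith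
  have hsplit : cnt (cj K) X = Nat.card {x // (x ∈ cj K ∧ N x ≤ X) ∧ ∃ n : ℕ, N x = p * n}
      + Nat.card {x // (x ∈ cj K ∧ N x ≤ X) ∧ ¬ ∃ n : ℕ, N x = p * n} := by
    classical
    rw [cnt]
    have : Finite {x // (x ∈ cj K ∧ N x ≤ X) ∧ ∃ n : ℕ, N x = p * n} :=
      fin_sub hfin (fun x hx => hx.1)
    have : Finite {x // (x ∈ cj K ∧ N x ≤ X) ∧ ¬ ∃ n : ℕ, N x = p * n} :=
      fin_sub hfin (fun x hx => hx.1)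
    rw [← Nat.card_sum]
    refine Nat.card_congr
      ((Equiv.sumCompl (fun x : {x // x ∈ cj K ∧ N x ≤ X} => ∃ n : ℕ, N x.1 = p * n)).symm.trans
        (Equiv.sumCongr (Equiv.subtypeSubtypeEquivSubtypeInter (fun x => x ∈ cj K ∧ N x ≤ X) (fun x => ∃ n : ℕ, N x = p * n))
          (Equiv.subtypeSubtypeEquivSubtypeInter (fun x => x ∈ cj K ∧ N x ≤ X) (fun x => ¬ ∃ n : ℕ, N x = p * n))))
  have hmain : ∑ n ∈ IX p X, Nat.card {x // x ∈ cj K ∧ N x = n} =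
      Nat.card {x // (x ∈ cj K ∧ N x ≤ X) ∧ ¬ ∃ n : ℕ, N x = p * n} := by
    have hf2 : ∀ n : IX p X, Finite {x // x ∈ cj K ∧ N x = (n.1 : ℝ)} := fun n => hfn n.1 (by
      exact_mod_cast (mem_IX.1 n.2).1.2)
    rw [← Finset.sum_coe_sort, ← Nat.card_sigma]
    refine Nat.card_congr (Equiv.ofBijective (fun q => ⟨q.2.1, ⟨q.2.2.1, ?_⟩, ?_⟩) ⟨?_, ?_⟩)
    · rw [q.2.2.2]; exact_mod_cast (mem_IX.1 q.1.2).1.2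
    · rintro ⟨n, hn⟩
      rw [q.2.2.2] at hn
      have hn : q.1.1 = p * n := by exact_mod_cast hn
      exact (hcop _).1 (mem_IX.1 q.1.2).2 ⟨n, hn⟩
    · rintro ⟨⟨n, hn⟩, x, hx, hx2⟩ ⟨⟨m, hm⟩, y, hy, hy2⟩ h
      have h : x = y := congrArg Subtype.val h
      subst h
      have : n = m := by
        have : (n : ℝ) = m := by rw [← hx2, hy2]
        exact_mod_cast this
      subst this
      rfl
    · rintro ⟨x, ⟨hx, hX⟩, hd⟩
      obtain ⟨n, hn⟩ := hnat x hx
      have h1 : n ∈ IX p X := by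
        rw [mem_IX]
        refine ⟨⟨?_, ?_⟩, ?_⟩
        · rcases Nat.eq_zero_or_pos n with h0 | h0
          · exact absurd ⟨0, by rw [hn, h0]; simp⟩ hd
          · exact h0
        · rw [hn] at hX; exact_mod_cast hX
        · rw [hcop]; rintro ⟨k, hk⟩
          exact hd ⟨k, by rw [hn, hk]; push_cast; ring⟩
      exact ⟨⟨⟨n, h1⟩, x, hx, hn⟩, rfl⟩
  rw [hmain, hdiv, hsplit]; push_cast; ring

theorem card_PB {O C A K : Submodule ℤ H} (ho : Ord p O C) (g : Conn O A K) (n : ℕ) :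
    Nat.card {q // PB O A n q} = Nat.card {x // x ∈ cj K ∧ N x = n} + Nat.card {x // x ∈ cj (C * K) ∧ N x = n} := by
  have hf : ∀ {M}, Conn O A M → Finite {x // x ∈ cj M ∧ N x = n} := by
    intro M gM
    have hfin : Finite {x // x ∈ cj M ∧ N x ≤ n} := (gM.lat ho.lat).cjL.1.finite (n : ℝ)
    exact fin_sub hfin (fun x hx => ⟨hx.1, hx.2.le⟩)
  have := hf g
  have := hf (ho.conn_CK g)
  rw [← Nat.card_sum]
  refine Nat.card_congr (Equiv.symm (Equiv.ofBijective (Sum.elim (fun x => ⟨(K, x.1), g, x.2.1, x.2.2⟩)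
    (fun x => ⟨(C * K, x.1), ho.conn_CK g, x.2.1, x.2.2⟩)) ⟨?_, ?_⟩))
  · rintro (x | x) (y | y) h
    · have := congrArg (fun q => q.1.2) h
      exact congrArg _ (Subtype.ext this)
    · have := congrArg (fun q => q.1.1) h
      exact absurd this (ho.K_ne_CK g)
    · have := congrArg (fun q => q.1.1) h
      exact absurd this.symm (ho.K_ne_CK g)
    · have := congrArg (fun q => q.1.2) h
      exact congrArg _ (Subtype.ext this)
  · rintro ⟨⟨M, x⟩, hq1, hq2, hq3⟩
    simp only at hq1 hq2 hq3
    rcases ho.conn_two g hq1 with h | h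
    · subst h; exact ⟨Sum.inl ⟨x, hq2, hq3⟩, rfl⟩
    · subst h; exact ⟨Sum.inr ⟨x, hq2, hq3⟩, rfl⟩

theorem sum_PB {O C A K : Submodule ℤ H} (ho : Ord p O C) (g : Conn O A K) (X : ℕ) :
    ∑ n ∈ IX p X, (Nat.card {q // PB O A n q} : ℝ) =
      (cnt (cj K) X - cnt (cj K) (X / p)) + (cnt (cj (C * K)) X - cnt (cj (C * K)) (X / p)) := by
  have h1 := card_prime_part ho g X
  have h2 := card_prime_part ho (ho.conn_CK g) X
  rw [← mul_assoc, ho.CC, g.OK] at h2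
  simp only [card_PB ho g]
  push_cast at h1 h2 ⊢
  rw [Finset.sum_add_distrib, h1, h2]; ring

theorem sum_PB_lim {O C A K : Submodule ℤ H} (ho : Ord p O C) (g : Conn O A K) :
    Tendsto (fun X : ℕ => (∑ n ∈ IX p X, (Nat.card {q // PB O A n q} : ℝ)) / (X : ℝ) ^ 2) atTop
      (𝓝 (4 * Real.pi ^ 2 / p * (1 - 1 / p ^ 2))) := by
  have hp0 : (0 : ℝ) < p := by exact_mod_cast hp.out.pos
  have key : ∀ M, Conn O A M → Tendsto (fun X : ℕ => ((cnt (cj M) X : ℝ) - cnt (cj M) (X / p)) / (X : ℝ) ^ 2) atTop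
      (𝓝 (2 * Real.pi ^ 2 / p * (1 - 1 / p ^ 2))) := by
    intro M gM
    have hl := (gM.lat ho.lat).cjL
    have hc : cov (cj M) = p / 4 := by rw [hl.2, gM.cov_eq ho.lat ho.int ho.tr1, ho.covO]
    have h1 := hl.1.asym
    rw [hc] at h1
    have h2 := h1.comp tendsto_natCast_atTop_atTop
    have h3 := h1.comp ((tendsto_natCast_atTop_atTop (R := ℝ)).atTop_div_const hp0)
    have h4 := h2.sub (h3.mul_const (1 / (p : ℝ) ^ 2))
    refine (h4.congr ?_).trans (le_of_eq ?_)
    · intro X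
      simp only [Function.comp]
      rcases Nat.eq_zero_or_pos X with h0 | h0
      · simp [h0]
      · field_simp
    · congr 1; field_simp; ring
  have h := (key K g).add (key (C * K) (ho.conn_CK g))
  refine (h.congr ?_).trans (le_of_eq ?_)
  · intro X
    rw [sum_PB ho g X, add_div]
  · congr 1; ring

end MF

namespace MF
open Module MeasureTheory Filter Topology Submodule

section
variable {p : ℕ} [hp : Fact p.Prime]

theorem sum_IX (Y : ℕ) : 2 * ∑ d ∈ IX p Y, d + p * ((Y / p) * (Y / p + 1)) = Y * (Y + 1) := by
  induction Y with
  | zero => simp [IX]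
  | succ Y ih =>
    have hI : IX p (Y + 1) = if p ∣ Y + 1 then IX p Y else insert (Y + 1) (IX p Y) := by
      ext n
      split_ifs with h
      · rw [mem_IX, mem_IX]
        constructor
        · rintro ⟨⟨h1, h2⟩, h3⟩
          refine ⟨⟨h1, ?_⟩, h3⟩
          rcases Nat.lt_or_ge n (Y + 1) with h4 | h4
          · omega
          · have : n = Y + 1 := by omega
            rw [this, Nat.coprime_comm, hp.out.coprime_iff_not_dvd] at h3
            exact absurd h h3
        · rintro ⟨⟨h1, h2⟩, h3⟩; exact ⟨⟨h1, by omega⟩, h3⟩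
      · rw [Finset.mem_insert, mem_IX, mem_IX]
        constructor
        · rintro ⟨⟨h1, h2⟩, h3⟩
          by_cases h4 : n = Y + 1
          · left; exact h4
          · right; exact ⟨⟨h1, by omega⟩, h3⟩
        · rintro (rfl | ⟨⟨h1, h2⟩, h3⟩)
          · exact ⟨⟨by omega, le_refl _⟩, by rw [Nat.coprime_comm, hp.out.coprime_iff_not_dvd]; exact h⟩
          · exact ⟨⟨h1, by omega⟩, h3⟩
    rw [hI, Nat.succ_div]
    split_ifs with h
    · have h2 := Nat.div_mul_cancel h
      rw [Nat.succ_div_of_dvd h] at h2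
      nlinarith
    · rw [Finset.sum_insert (by rw [mem_IX]; omega)]
      simp only [add_zero]
      nlinarith

theorem sum_div (X : ℕ) : ∑ n ∈ IX p X, ∑ d ∈ n.divisors, (d : ℝ) = ∑ e ∈ IX p X, ∑ d ∈ IX p (X / e), (d : ℝ) := by
  rw [Finset.sum_sigma', Finset.sum_sigma']
  refine Finset.sum_bij' (fun q _ => ⟨q.1 / q.2, q.2⟩) (fun q _ => ⟨q.1 * q.2, q.2⟩) ?_ ?_ ?_ ?_ ?_
  · rintro ⟨n, d⟩ h
    simp only [Finset.mem_sigma, mem_IX, Nat.mem_divisors] at h ⊢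
    obtain ⟨⟨⟨h1, h2⟩, h3⟩, ⟨e, rfl⟩, h5⟩ := h
    have hd : 0 < d := Nat.pos_of_ne_zero (by rintro rfl; simp at h5)
    have he : 0 < e := Nat.pos_of_ne_zero (by rintro rfl; simp at h5)
    rw [Nat.mul_div_cancel_left e hd]
    refine ⟨⟨⟨he, by nlinarith⟩, Nat.Coprime.coprime_mul_left h3⟩, ⟨hd, ?_⟩, Nat.Coprime.coprime_mul_right h3⟩
    rw [Nat.le_div_iff_mul_le he]; exact h2
  · rintro ⟨e, d⟩ h
    simp only [Finset.mem_sigma, mem_IX, Nat.mem_divisors] at h ⊢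
    obtain ⟨⟨⟨h1, h2⟩, h3⟩, ⟨h4, h5⟩, h6⟩ := h
    rw [Nat.le_div_iff_mul_le h1] at h5
    exact ⟨⟨⟨by nlinarith, by linarith⟩, Nat.Coprime.mul_left h3 h6⟩, ⟨e, by ring⟩, by positivity⟩
  · rintro ⟨n, d⟩ h
    simp only [Finset.mem_sigma, mem_IX, Nat.mem_divisors] at h ⊢
    rw [Nat.div_mul_cancel h.2.1]
  · rintro ⟨e, d⟩ h
    simp only [Finset.mem_sigma, mem_IX, Nat.mem_divisors] at h ⊢
    rw [Nat.mul_div_cancel _ (by omega)]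
  · rintro ⟨n, d⟩ h; rfl

theorem tendsto_ndiv (k : ℕ) : Tendsto (fun X : ℕ => ((X / k : ℕ) : ℝ) / X) atTop (𝓝 (1 / (k : ℝ))) := by
  have h := (tendsto_nat_floor_mul_div_atTop (R := ℝ) (a := 1 / (k : ℝ)) (by positivity)).comp tendsto_natCast_atTop_atTop
  refine h.congr fun X => ?_
  simp only [Function.comp]
  rw [← Nat.floor_div_eq_div (K := ℝ), show (1 / (k : ℝ)) * X = (X : ℝ) / k by ring]

theorem IX_lim {e : ℕ} (he : 0 < e) : Tendsto (fun X : ℕ => (∑ d ∈ IX p (X / e), (d : ℝ)) / (X : ℝ) ^ 2) atTop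
    (𝓝 ((1 - 1 / p) / 2 * (1 / (e : ℝ) ^ 2))) := by
  have hp0 : (0 : ℝ) < p := by exact_mod_cast hp.out.pos
  have he0 : (0 : ℝ) < e := by exact_mod_cast he
  have h1 := tendsto_ndiv e
  have h2 := tendsto_ndiv (e * p)
  have h3 := tendsto_one_div_atTop_nhds_zero_nat (𝕜 := ℝ)
  have h4 := ((h1.mul (h1.add h3)).sub ((h2.mul (h2.add h3)).const_mul (p : ℝ))).div_const 2
  refine (h4.congr' ?_).trans (le_of_eq ?_)
  · filter_upwards [eventually_gt_atTop 0] with X hX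
    have hX0 : (0 : ℝ) < X := by exact_mod_cast hX
    have h5 := sum_IX (p := p) (X / e)
    rw [Nat.div_div_eq_div_mul] at h5
    have h6 : 2 * ∑ d ∈ IX p (X / e), (d : ℝ) + p * (((X / (e * p) : ℕ) : ℝ) * (((X / (e * p) : ℕ) : ℝ) + 1)) =
      ((X / e : ℕ) : ℝ) * (((X / e : ℕ) : ℝ) + 1) := by
      rw [← Nat.cast_sum]; exact_mod_cast h5
    have h7 : ∑ d ∈ IX p (X / e), (d : ℝ) = (((X / e : ℕ) : ℝ) * (((X / e : ℕ) : ℝ) + 1) -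
       p * (((X / (e * p) : ℕ) : ℝ) * (((X / (e * p) : ℕ) : ℝ) + 1))) / 2 := by linarith
    rw [h7]; field_simp
  · congr 1; push_cast; field_simp; ring

theorem IX_le {X e : ℕ} (he : 0 < e) : (∑ d ∈ IX p (X / e), (d : ℝ)) / (X : ℝ) ^ 2 ≤ 1 / (e : ℝ) ^ 2 := by
  have he0 : (0 : ℝ) < e := by exact_mod_cast he
  rcases Nat.eq_zero_or_pos X with h0 | h0
  · simp [h0]
  have hX0 : (0 : ℝ) < X := by exact_mod_cast h0
  have h1 : ((X / e : ℕ) : ℝ) ≤ X / e := Nat.cast_div_le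
  have h2 : ∑ d ∈ IX p (X / e), (d : ℝ) ≤ ((X / e : ℕ) : ℝ) ^ 2 := by
    have h5 := sum_IX (p := p) (X / e)
    have : ∑ d ∈ IX p (X / e), d ≤ (X / e) ^ 2 := by
      rcases Nat.eq_zero_or_pos (X / e) with h | h
      · simp [h, IX]
      · nlinarith [Nat.zero_le (p * ((X / e / p) * (X / e / p + 1)))]
    rw [← Nat.cast_sum]; exact_mod_cast this
  rw [div_le_div_iff₀ (by positivity) (by positivity)]
  have h3 : ((X / e : ℕ) : ℝ) * e ≤ X := by rw [le_div_iff₀ he0] at h1; exact h1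
  have h4 : (((X / e : ℕ) : ℝ) * e) ^ 2 ≤ X ^ 2 := by gcongr
  calc _ ≤ ((X / e : ℕ) : ℝ) ^ 2 * (e : ℝ) ^ 2 := by gcongr
    _ = (((X / e : ℕ) : ℝ) * e) ^ 2 := by ring
    _ ≤ _ := by rw [one_mul]; exact h4

theorem zeta_cop : HasSum (fun e : ℕ => if Nat.Coprime e p then 1 / (e : ℝ) ^ 2 else 0) (Real.pi ^ 2 / 6 * (1 - 1 / p ^ 2)) := by
  have hp0 : (0 : ℝ) < p := by exact_mod_cast hp.out.pos
  have h1 := hasSum_zeta_two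
  have h2 : HasSum (fun e : ℕ => if Nat.Coprime e p then 0 else 1 / (e : ℝ) ^ 2) (Real.pi ^ 2 / 6 * (1 / p ^ 2)) := by
    have hinj : Function.Injective (fun k : ℕ => p * k) := fun a b h => Nat.eq_of_mul_eq_mul_left hp.out.pos h
    rw [← hinj.hasSum_iff]
    · have := h1.mul_right (1 / (p : ℝ) ^ 2)
      have hf : ((fun e : ℕ => if Nat.Coprime e p then 0 else 1 / (e : ℝ) ^ 2) ∘ fun k : ℕ => p * k) =
          fun n : ℕ => 1 / (n : ℝ) ^ 2 * (1 / (p : ℝ) ^ 2) := by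
        funext k
        have hk : ¬ Nat.Coprime (p * k) p := by
          rw [Nat.coprime_comm, hp.out.coprime_iff_not_dvd]
          exact fun h => h ⟨k, rfl⟩
        simp only [Function.comp]
        rw [if_neg hk]; push_cast; rw [mul_pow]; ring
      rw [hf]; exact this
    · intro x hx
      rw [if_pos]
      rw [Nat.coprime_comm, hp.out.coprime_iff_not_dvd]
      rintro ⟨k, rfl⟩; exact hx ⟨k, rfl⟩
  have h3 := h1.sub h2
  have hf : (fun e : ℕ => if Nat.Coprime e p then 1 / (e : ℝ) ^ 2 else 0) =
      fun e : ℕ => 1 / (e : ℝ) ^ 2 - if Nat.Coprime e p then 0 else 1 / (e : ℝ) ^ 2 := by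
    funext e; split_ifs <;> simp
  rw [hf, show Real.pi ^ 2 / 6 * (1 - 1 / (p : ℝ) ^ 2) = Real.pi ^ 2 / 6 - Real.pi ^ 2 / 6 * (1 / (p : ℝ) ^ 2) by ring]
  exact h3

theorem sigma_lim : Tendsto (fun X : ℕ => (∑ n ∈ IX p X, ∑ d ∈ n.divisors, (d : ℝ)) / (X : ℝ) ^ 2) atTop
    (𝓝 ((1 - 1 / p) / 2 * (Real.pi ^ 2 / 6 * (1 - 1 / p ^ 2)))) := by
  have hz := (zeta_cop (p := p)).mul_left ((1 - 1 / (p : ℝ)) / 2)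
  rw [← hz.tsum_eq]
  have hcop : ∀ e : ℕ, Nat.Coprime e p → 0 < e := by
    intro e he
    rcases Nat.eq_zero_or_pos e with h | h
    · rw [h, Nat.coprime_zero_left] at he; exact absurd he hp.out.ne_one
    · exact h
  have h := tendsto_tsum_of_dominated_convergence (𝓕 := atTop)
    (f := fun (X : ℕ) (e : ℕ) => if Nat.Coprime e p then (∑ d ∈ IX p (X / e), (d : ℝ)) / (X : ℝ) ^ 2 else 0)
    (g := fun e => (1 - 1 / (p : ℝ)) / 2 * if Nat.Coprime e p then 1 / (e : ℝ) ^ 2 else 0)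
    (bound := fun e : ℕ => 1 / (e : ℝ) ^ 2) hasSum_zeta_two.summable ?_ ?_
  · refine h.congr fun X => ?_
    rw [sum_div, Finset.sum_div, tsum_eq_sum (s := IX p X)]
    · refine Finset.sum_congr rfl fun e he => ?_
      rw [if_pos (mem_IX.1 he).2]
    · intro e he
      split_ifs with h1
      · have : X < e := by
          by_contra h2; exact he (mem_IX.2 ⟨⟨hcop e h1, by omega⟩, h1⟩)
        rw [Nat.div_eq_of_lt this]; simp [IX]
      · rfl
  · intro e
    by_cases h1 : Nat.Coprime e p
    · simp only [if_pos h1]; exact IX_lim (hcop e h1)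
    · simp [h1]
  · refine Eventually.of_forall fun X e => ?_
    by_cases h1 : Nat.Coprime e p
    · simp only [if_pos h1]
      rw [Real.norm_of_nonneg (by positivity)]
      exact IX_le (hcop e h1)
    · simp only [if_neg h1, norm_zero]; positivity

end
end MF

namespace MF
open Module MeasureTheory Filter Topology Submodule

local notation "N" => Quaternion.normSq

namespace TL
variable {p : ℕ} [hp : Fact p.Prime] (t : TL p)

theorem anL {x : H} (hx : x ∈ t.L) {n : ℤ} (hn : N x = p * n) : x ∈ sp ((√(p : ℝ) : ℝ) : H) * t.O := by
  have hp0 : (0 : ℝ) < p := by exact_mod_cast hp.out.pos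
  have hn0 : 0 ≤ n := by
    have : 0 ≤ (p : ℝ) * n := by rw [← hn]; exact Quaternion.normSq_nonneg
    have : (0 : ℝ) ≤ n := nonneg_of_mul_nonneg_right this hp0
    exact_mod_cast this
  have h := t.ord.anisoK t.ord.conn_C (t.L_le_C hx) (n := n.toNat) (by
    rw [hn]; congr 1
    have : ((n.toNat : ℤ) : ℝ) = n := by rw [Int.toNat_of_nonneg hn0]
    exact_mod_cast this.symm)
  rwa [t.ord.CC] at h

theorem anT {x y : H} (hx : x ∈ t.L) (hy : y ∈ t.L) {n : ℤ} (hn : N x = p * n) : ∃ m : ℤ, T2 x y = p * m := by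
  have h := t.anL hx hn
  rw [mem_sp_mul] at h
  obtain ⟨z, hz, rfl⟩ := h
  have h1 : z * y ∈ t.C := by rw [← t.ord.OC]; exact mul_mem_mul hz (t.L_le_C hy)
  obtain ⟨m, hm⟩ := t.ord.trC h1
  refine ⟨-m, ?_⟩
  rw [T2, mul_assoc, re_coe_mul]
  have := sqrtp_sq p
  push_cast
  linear_combination (-√(p : ℝ)) * hm - m * this

theorem anP {x : H} (hx : x ∈ t.L) {n : ℤ} (hn : N x = p * (p * n)) : ∃ y ∈ t.L, x = (p : H) * y := by
  have hp0 : (0 : ℝ) < p := by exact_mod_cast hp.out.pos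
  have hn0 : 0 ≤ n := by
    have : 0 ≤ (p : ℝ) * (p * n) := by rw [← hn]; exact Quaternion.normSq_nonneg
    have : 0 ≤ (p : ℝ) * n := nonneg_of_mul_nonneg_right this hp0
    have : (0 : ℝ) ≤ n := nonneg_of_mul_nonneg_right this hp0
    exact_mod_cast this
  have hnn : (n : ℝ) = (n.toNat : ℕ) := by
    have : ((n.toNat : ℤ) : ℝ) = n := by rw [Int.toNat_of_nonneg hn0]
    exact_mod_cast this.symm
  have h := t.anL hx (n := p * n) (by rw [hn]; push_cast; ring)
  rw [mem_sp_mul] at h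
  obtain ⟨z, hz, rfl⟩ := h
  have hs := sqrtp_sq p
  have hN : N z = p * (n.toNat : ℕ) := by
    rw [map_mul, normSq_coe', hs, hnn] at hn
    exact mul_left_cancel₀ hp0.ne' hn
  have h2 := t.ord.aniso hz hN
  rw [mem_sp_mul] at h2
  obtain ⟨y, hy, rfl⟩ := h2
  have e : ((√(p : ℝ) : ℝ) : H) * (((√(p : ℝ) : ℝ) : H) * y) = (p : H) * y := by
    rw [← mul_assoc, ← Quaternion.coe_mul, hs]; rfl
  refine ⟨y, t.L_of_C hy ?_, e⟩
  have := t.L_re hx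
  rw [re_coe_mul, re_coe_mul, ← mul_assoc, hs] at this
  exact (mul_eq_zero.1 this).resolve_left hp0.ne'

theorem cross_L {x y : H} (hx : x ∈ t.L) (hy : y ∈ t.L) : ((√(p : ℝ) : ℝ) : H) * (x * y - y * x) ∈ t.L := by
  have h : x * y - y * x ∈ t.O := by
    rw [← t.ord.CC]; exact sub_mem (mul_mem_mul (t.L_le_C hx) (t.L_le_C hy)) (mul_mem_mul (t.L_le_C hy) (t.L_le_C hx))
  apply t.L_of_C
  · rw [← t.ord.CO]; exact mul_mem_mul t.ord.sqC h
  · rw [re_coe_mul, Quaternion.re_sub, re_cycl x y]; ring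

theorem anq {x y : Fin 3 → ℤ} (h : (p : ℤ) ∣ q3 t.a t.b t.c t.u t.v t.w x) : (p : ℤ) ∣ T3 t.a t.b t.c t.u t.v t.w x y := by
  obtain ⟨n, hn⟩ := h
  obtain ⟨m, hm⟩ := t.anT (t.mem_L'.2 ⟨x, rfl⟩) (t.mem_L'.2 ⟨y, rfl⟩) (n := n) (by rw [t.N_vec, hn]; push_cast; ring)
  rw [t.T_vec] at hm
  exact ⟨m, by exact_mod_cast hm⟩

end TL

/-! ### the form mod p -/

/-- the standard anisotropic plane -/
def fpl (p : ℕ) (δ : ZMod p) (z : ZMod p × ZMod p) : ZMod p :=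
  if p = 2 then z.1 ^ 2 + z.1 * z.2 + z.2 ^ 2 else z.1 ^ 2 - δ * z.2 ^ 2

theorem zmod2_one : ∀ x : ZMod 2, x ≠ 0 → x = 1 := by decide
theorem zmod2_four : (4 : ZMod 2) * 1 * 1 - 0 ^ 2 = 0 := by decide
theorem zmod2_neg : (-1 : ZMod 2) = 1 := by decide

section
variable {p : ℕ} [hp : Fact p.Prime]

theorem core_odd (h2 : p ≠ 2) {δ : ZMod p} (hδ : ¬ IsSquare δ) {b c u : ZMod p}
    (hΔ : 4 * b * c - u ^ 2 ≠ 0) (hc : c ≠ 0) (hk : ¬ IsSquare (u ^ 2 - 4 * b * c)) :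
    ∃ α β γ ε : ZMod p, ∀ X Y : ZMod p, (c * X ^ 2 - u * X * Y + b * Y ^ 2) = (4 * b * c - u ^ 2) *
      ((α * X + β * Y) ^ 2 - δ * (γ * X + ε * Y) ^ 2) := by
  have hk2 : (2 : ZMod p) ≠ 0 := by
    intro h
    have h' : ((2 : ℕ) : ZMod p) = 0 := by exact_mod_cast h
    rw [ZMod.natCast_eq_zero_iff] at h'
    exact h2 ((Nat.prime_dvd_prime_iff_eq hp.out Nat.prime_two).1 h')
  set Δ := 4 * b * c - u ^ 2 with hΔd
  obtain ⟨r, hr⟩ : ∃ r, u ^ 2 - 4 * b * c = δ * r ^ 2 := by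
    have hδ0 : δ ≠ 0 := by rintro rfl; exact hδ (IsSquare.zero)
    have : IsSquare ((u ^ 2 - 4 * b * c) / δ) := by
      by_contra hn
      have hc1 : ringChar (ZMod p) ≠ 2 := by rw [ZMod.ringChar_zmod_n]; exact h2
      have e1 := (quadraticChar_neg_one_iff_not_isSquare).2 hk
      have e2 := (quadraticChar_neg_one_iff_not_isSquare).2 hδ
      have e3 := (quadraticChar_neg_one_iff_not_isSquare).2 hn
      have e4 : quadraticChar (ZMod p) ((u ^ 2 - 4 * b * c) / δ * δ) = _ := map_mul _ _ _
      rw [div_mul_cancel₀ _ hδ0, e1, e2, e3] at e4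
      norm_num at e4
    obtain ⟨r, hr⟩ := this
    refine ⟨r, ?_⟩
    rw [div_eq_iff hδ0] at hr
    rw [hr]; ring
  obtain ⟨s, q, hsq⟩ : ∃ s q, c / Δ = s ^ 2 - δ * q ^ 2 := by
    have hδ0 : δ ≠ 0 := by rintro rfl; exact hδ (IsSquare.zero)
    obtain ⟨s, q, h⟩ := FiniteField.exists_root_sum_quadratic (R := ZMod p) (f := Polynomial.X ^ 2 - Polynomial.C (c / Δ)) (g := Polynomial.C (-δ) * Polynomial.X ^ 2)
      (Polynomial.degree_X_pow_sub_C (by norm_num) _) (Polynomial.degree_C_mul_X_pow 2 (neg_ne_zero.2 hδ0))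
      (by rw [ZMod.card]; exact Nat.odd_iff.1 (hp.out.odd_of_ne_two h2))
    refine ⟨s, q, ?_⟩
    simp at h
    linear_combination -h
  -- c X² - u X Y + b Y² = c ((X - u Y/(2*c))² - δ (r Y/(2*c))²)
  refine ⟨s, -s * u / (2 * c) + δ * q * (r / (2 * c)), q, -q * u / (2 * c) + s * (r / (2 * c)), fun X Y => ?_⟩
  have e1 : c = Δ * (s ^ 2 - δ * q ^ 2) := by rw [← hsq]; field_simp
  have e2 : b = c * ((u / (2 * c)) ^ 2 - δ * (r / (2 * c)) ^ 2) := by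
    have : 4 * b * c = u ^ 2 - δ * r ^ 2 := by linear_combination -hr
    have h4 : (4 : ZMod p) ≠ 0 := by
      rw [show (4 : ZMod p) = 2 * 2 by norm_num]; exact mul_ne_zero hk2 hk2
    field_simp
    linear_combination this
  have e3 : u = c * (2 * (u / (2 * c))) := by field_simp
  set U := u / (2 * c)
  set R := r / (2 * c)
  have e4 : -s * u / (2 * c) = -s * U := by simp only [U]; ring
  have e5 : -q * u / (2 * c) = -q * U := by simp only [U]; ring
  rw [e4, e5]
  linear_combination ((X - U * Y) ^ 2 - δ * (R * Y) ^ 2) * e1 + Y ^ 2 * e2 - X * Y * e3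

theorem core1 {δ : ZMod p} (hδ : p ≠ 2 → ¬ IsSquare δ) {a b c u v w : ZMod p}
    (hD : 4 * a * b * c + u * v * w - a * u ^ 2 - b * v ^ 2 - c * w ^ 2 = 0)
    (han : ∀ x y z : ZMod p, a * x ^ 2 + b * y ^ 2 + c * z ^ 2 + u * (y * z) + v * (x * z) + w * (x * y) = 0 →
      w * x + 2 * b * y + u * z = 0 ∧ v * x + u * y + 2 * c * z = 0)
    (hΔ : 4 * b * c - u ^ 2 ≠ 0) :
    ∃ α1 α2 α3 β1 β2 β3 : ZMod p, ∀ x y z : ZMod p,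
      a * x ^ 2 + b * y ^ 2 + c * z ^ 2 + u * (y * z) + v * (x * z) + w * (x * y) =
      fpl p δ (α1 * x + α2 * y + α3 * z, β1 * x + β2 * y + β3 * z) := by
  have key : ∀ x y z : ZMod p, (4 * b * c - u ^ 2) * (a * x ^ 2 + b * y ^ 2 + c * z ^ 2 + u * (y * z) + v * (x * z) + w * (x * y)) =
      c * (w * x + 2 * b * y + u * z) ^ 2 - u * (w * x + 2 * b * y + u * z) * (v * x + u * y + 2 * c * z)
        + b * (v * x + u * y + 2 * c * z) ^ 2 := by
    intro x y z; linear_combination x ^ 2 * hD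
  have hc : c ≠ 0 := by
    intro hc
    have := (han 0 0 1 (by rw [hc]; ring)).1
    apply hΔ; simp at this; rw [this, hc]; ring
  by_cases h2 : p = 2
  · subst h2
    have hb : b ≠ 0 := by
      intro hb
      have := (han 0 1 0 (by rw [hb]; ring)).2
      apply hΔ; simp at this; rw [this, hb]; ring
    have h01 := zmod2_one
    have hc1 := h01 c hc
    have hb1 := h01 b hb
    have hu1 : u = 1 := by
      apply h01; intro h; apply hΔ; rw [h, hb1, hc1]; exact zmod2_four
    refine ⟨w, 2 * b, u, v, u, 2 * c, fun x y z => ?_⟩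
    have := key x y z
    have h4 : 4 * b * c - u ^ 2 = 1 := h01 _ hΔ
    rw [h4, one_mul] at this
    rw [this, fpl, if_pos rfl]
    simp only
    have h5 := zmod2_neg
    have h6 : u = -1 := by rw [hu1, h5]
    generalize w * x + 2 * b * y + u * z = X
    generalize v * x + u * y + 2 * c * z = Y
    rw [hb1, hc1, h6]; ring
  · have hk2 : (2 : ZMod p) ≠ 0 := by
      intro h
      have h' : ((2 : ℕ) : ZMod p) = 0 := by exact_mod_cast h
      rw [ZMod.natCast_eq_zero_iff] at h'
      exact h2 ((Nat.prime_dvd_prime_iff_eq hp.out Nat.prime_two).1 h')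
    have hk : ¬ IsSquare (u ^ 2 - 4 * b * c) := by
      rintro ⟨k, hk⟩
      have h3 := (han 0 (2 * c) (k - u) (by linear_combination (-c) * hk)).2
      have h4 : 2 * c * k = 0 := by linear_combination h3
      have h5 : k = 0 := by
        rcases mul_eq_zero.1 h4 with h | h
        · rcases mul_eq_zero.1 h with h | h
          · exact absurd h hk2
          · exact absurd h hc
        · exact h
      apply hΔ; rw [h5] at hk; linear_combination -hk
    obtain ⟨α, β, γ, ε, h⟩ := core_odd h2 (hδ h2) hΔ hc hk
    refine ⟨α * w + β * v, α * (2 * b) + β * u, α * u + β * (2 * c), γ * w + ε * v, γ * (2 * b) + ε * u, γ * u + ε * (2 * c), fun x y z => ?_⟩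
    apply mul_left_cancel₀ hΔ
    rw [key, h, fpl, if_neg h2]
    simp only
    ring

theorem minors {a b c u v w : ℤ} (hD : 4 * a * b * c + u * v * w - a * u ^ 2 - b * v ^ 2 - c * w ^ 2 = p)
    (h1 : (p : ℤ) ∣ 4 * b * c - u ^ 2) (h2 : (p : ℤ) ∣ 4 * a * c - v ^ 2) (h3 : (p : ℤ) ∣ 4 * a * b - w ^ 2) : False := by
  have hpp : Prime (p : ℤ) := Nat.prime_iff_prime_int.1 hp.out
  have m12 : (p : ℤ) ∣ u * v - 2 * c * w := by
    apply hpp.dvd_of_dvd_pow (n := 2)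
    rw [show (u * v - 2 * c * w) ^ 2 = (4 * b * c - u ^ 2) * (4 * a * c - v ^ 2) - 4 * c * p by rw [← hD]; ring]
    exact dvd_sub (h1.mul_right _) (dvd_mul_left _ _)
  have m13 : (p : ℤ) ∣ u * w - 2 * b * v := by
    apply hpp.dvd_of_dvd_pow (n := 2)
    rw [show (u * w - 2 * b * v) ^ 2 = (4 * b * c - u ^ 2) * (4 * a * b - w ^ 2) - 4 * b * p by rw [← hD]; ring]
    exact dvd_sub (h1.mul_right _) (dvd_mul_left _ _)
  have m23 : (p : ℤ) ∣ v * w - 2 * a * u := by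
    apply hpp.dvd_of_dvd_pow (n := 2)
    rw [show (v * w - 2 * a * u) ^ 2 = (4 * a * c - v ^ 2) * (4 * a * b - w ^ 2) - 4 * a * p by rw [← hD]; ring]
    exact dvd_sub (h2.mul_right _) (dvd_mul_left _ _)
  have hp0 : (p : ℤ) ≠ 0 := hpp.ne_zero
  have hdet : (4 * b * c - u ^ 2) * (4 * a * c - v ^ 2) * (4 * a * b - w ^ 2) + 2 * ((u * v - 2 * c * w) * (u * w - 2 * b * v) * (v * w - 2 * a * u))
      - (4 * b * c - u ^ 2) * (v * w - 2 * a * u) ^ 2 - (4 * a * c - v ^ 2) * (u * w - 2 * b * v) ^ 2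
      - (4 * a * b - w ^ 2) * (u * v - 2 * c * w) ^ 2 = 4 * p ^ 2 := by rw [← hD]; ring
  have hp2 : p = 2 := by
    obtain ⟨x1, h1⟩ := h1
    obtain ⟨x2, h2⟩ := h2
    obtain ⟨x3, h3⟩ := h3
    obtain ⟨y1, m12⟩ := m12
    obtain ⟨y2, m13⟩ := m13
    obtain ⟨y3, m23⟩ := m23
    rw [h1, h2, h3, m12, m13, m23] at hdet
    have h4 : (4 : ℤ) = p * (x1 * x2 * x3 + 2 * (y1 * y2 * y3) - x1 * y3 ^ 2 - x2 * y2 ^ 2 - x3 * y1 ^ 2) := by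
      apply mul_left_cancel₀ (pow_ne_zero 2 hp0)
      linear_combination -hdet
    have h5 : p ∣ 2 ^ 2 := by
      have : (p : ℤ) ∣ ((2 ^ 2 : ℕ) : ℤ) := ⟨_, by rw [← h4]; norm_num⟩
      exact_mod_cast this
    exact (Nat.prime_dvd_prime_iff_eq hp.out Nat.prime_two).1 (hp.out.dvd_of_dvd_pow h5)
  subst hp2
  have ev : ∀ {r s : ℤ}, ((2 : ℕ) : ℤ) ∣ 4 * r - s ^ 2 → ∃ k, s = 2 * k := by
    intro r s h
    have : (2 : ℤ) ∣ s ^ 2 := by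
      have h' := dvd_sub (Dvd.intro (2 * r) (by push_cast; ring) : ((2 : ℕ) : ℤ) ∣ 4 * r) h
      rw [show 4 * r - (4 * r - s ^ 2) = s ^ 2 by ring] at h'
      exact_mod_cast h'
    exact Int.prime_two.dvd_of_dvd_pow this
  obtain ⟨u', rfl⟩ := ev (r := b * c) (by rw [← mul_assoc]; exact h1)
  obtain ⟨v', rfl⟩ := ev (r := a * c) (by rw [← mul_assoc]; exact h2)
  obtain ⟨w', rfl⟩ := ev (r := a * b) (by rw [← mul_assoc]; exact h3)
  have : (4 : ℤ) * (a * b * c + 2 * u' * v' * w' - a * u' ^ 2 - b * v' ^ 2 - c * w' ^ 2) = 2 := by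
    push_cast at hD; linarith
  generalize a * b * c + 2 * u' * v' * w' - a * u' ^ 2 - b * v' ^ 2 - c * w' ^ 2 = K at this
  omega

/-- the standard plane mod p -/
theorem exists_plane : ∃ δ : ZMod p, ∀ t : TL p, ∃ α β : Fin 3 → ZMod p, ∀ x : Fin 3 → ℤ,
    (q3 t.a t.b t.c t.u t.v t.w x : ZMod p) = fpl p δ (∑ i, α i * x i, ∑ i, β i * x i) := by
  obtain ⟨δ, hδ⟩ : ∃ δ : ZMod p, p ≠ 2 → ¬ IsSquare δ := by
    by_cases h2 : p = 2
    · exact ⟨0, fun h => absurd h2 h⟩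
    · obtain ⟨δ, hδ⟩ := FiniteField.exists_nonsquare (F := ZMod p) (by rw [ZMod.ringChar_zmod_n]; exact h2)
      exact ⟨δ, fun _ => hδ⟩
  refine ⟨δ, fun t => ?_⟩
  have hd := t.nat_disc
  have hdp : ((4 * t.a * t.b * t.c + t.u * t.v * t.w - t.a * t.u ^ 2 - t.b * t.v ^ 2 - t.c * t.w ^ 2 : ℤ) : ZMod p) = 0 := by
    rw [hd]; simp
  push_cast at hdp
  have han : ∀ x y z : ZMod p, (t.a : ZMod p) * x ^ 2 + t.b * y ^ 2 + t.c * z ^ 2 + t.u * (y * z) + t.v * (x * z) + t.w * (x * y) = 0 →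
      2 * t.a * x + t.w * y + t.v * z = 0 ∧ t.w * x + 2 * t.b * y + t.u * z = 0 ∧ t.v * x + t.u * y + 2 * t.c * z = 0 := by
    intro x y z h
    obtain ⟨x, rfl⟩ := ZMod.intCast_surjective x
    obtain ⟨y, rfl⟩ := ZMod.intCast_surjective y
    obtain ⟨z, rfl⟩ := ZMod.intCast_surjective z
    have h1 : (p : ℤ) ∣ q3 t.a t.b t.c t.u t.v t.w ![x, y, z] := by
      rw [← ZMod.intCast_zmod_eq_zero_iff_dvd]
      simp [q3]; exact h
    have h2 := t.anq (y := ![1, 0, 0]) h1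
    have h3 := t.anq (y := ![0, 1, 0]) h1
    have h4 := t.anq (y := ![0, 0, 1]) h1
    rw [← ZMod.intCast_zmod_eq_zero_iff_dvd] at h2 h3 h4
    simp [T3] at h2 h3 h4
    exact ⟨by linear_combination h2, by linear_combination h3, by linear_combination h4⟩
  have hm := minors (p := p) hd
  simp only [← ZMod.intCast_zmod_eq_zero_iff_dvd] at hm
  push_cast at hm
  by_cases c1 : (4 * t.b * t.c - t.u ^ 2 : ZMod p) = 0
  · by_cases c2 : (4 * t.a * t.c - t.v ^ 2 : ZMod p) = 0
    · by_cases c3 : (4 * t.a * t.b - t.w ^ 2 : ZMod p) = 0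
      · exact (hm c1 c2 c3).elim
      · obtain ⟨α1, α2, α3, β1, β2, β3, h⟩ := core1 hδ (a := t.c) (b := t.a) (c := t.b) (u := t.w) (v := t.u) (w := t.v)
          (by linear_combination hdp)
          (fun x y z h => by
            have := han y z x (by linear_combination h)
            exact ⟨by linear_combination this.1, by linear_combination this.2.1⟩) c3
        refine ⟨![α2, α3, α1], ![β2, β3, β1], fun x => ?_⟩
        simp only [q3, Fin.sum_univ_three]
        push_cast
        rw [show (α2 * (x 0 : ZMod p) + α3 * x 1 + α1 * x 2) = α1 * x 2 + α2 * x 0 + α3 * x 1 by ring,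
          show (β2 * (x 0 : ZMod p) + β3 * x 1 + β1 * x 2) = β1 * x 2 + β2 * x 0 + β3 * x 1 by ring, ← h]
        ring
    · obtain ⟨α1, α2, α3, β1, β2, β3, h⟩ := core1 hδ (a := t.b) (b := t.a) (c := t.c) (u := t.v) (v := t.u) (w := t.w)
          (by linear_combination hdp)
          (fun x y z h => by
            have := han y x z (by linear_combination h)
            exact ⟨by linear_combination this.1, by linear_combination this.2.2⟩) c2
      refine ⟨![α2, α1, α3], ![β2, β1, β3], fun x => ?_⟩
      simp only [q3, Fin.sum_univ_three]
      push_cast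
      rw [show (α2 * (x 0 : ZMod p) + α1 * x 1 + α3 * x 2) = α1 * x 1 + α2 * x 0 + α3 * x 2 by ring,
          show (β2 * (x 0 : ZMod p) + β1 * x 1 + β3 * x 2) = β1 * x 1 + β2 * x 0 + β3 * x 2 by ring, ← h]
      ring
  · obtain ⟨α1, α2, α3, β1, β2, β3, h⟩ := core1 hδ (a := t.a) (b := t.b) (c := t.c) (u := t.u) (v := t.v) (w := t.w)
          (by linear_combination hdp) (fun x y z h => (han x y z h).2) c1
    refine ⟨![α1, α2, α3], ![β1, β2, β3], fun x => ?_⟩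
    simp only [q3, Fin.sum_univ_three]
    push_cast
    rw [h]

end
end MF

namespace MF
open Module MeasureTheory Filter Topology Submodule

section
variable {ι : Type} [Fintype ι] [DecidableEq ι]

/-- inclusion of integer vectors -/
def icast (ι : Type) : (ι → ℤ) →+ (ι → ℝ) where
  toFun x i := x i
  map_zero' := by ext; simp
  map_add' x y := by ext; simp

theorem icast_inj : Function.Injective (icast ι) := by
  intro x y h
  ext i
  have := congrFun h i
  simpa [icast] using this

theorem minkZ {G : Type} [AddCommGroup G] [Finite G] (φ : (ι → ℤ) →+ G) {s : Set (ι → ℝ)}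
    (hs : ∀ x ∈ s, -x ∈ s) (hc : Convex ℝ s) (hv : (Nat.card G : ENNReal) * 2 ^ (Fintype.card ι) < volume s) :
    ∃ x : ι → ℤ, x ≠ 0 ∧ φ x = 0 ∧ icast ι x ∈ s := by
  set Λ0 : Submodule ℤ (ι → ℝ) := span ℤ (Set.range (Pi.basisFun ℝ ι)) with hΛ0
  set Λ : Submodule ℤ (ι → ℝ) := AddSubgroup.toIntSubmodule (φ.ker.map (icast ι)) with hΛ
  have h0 : Λ0.toAddSubgroup = (⊤ : AddSubgroup (ι → ℤ)).map (icast ι) := by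
    ext v
    rw [Submodule.mem_toAddSubgroup, hΛ0, Basis.mem_span_iff_repr_mem, AddSubgroup.mem_map]
    simp only [Pi.basisFun_repr]
    constructor
    · intro h
      choose f hf using h
      exact ⟨f, trivial, by ext i; simpa [icast] using hf i⟩
    · rintro ⟨f, -, rfl⟩ i
      exact ⟨f i, by simp [icast]⟩
  have h1 : Λ.toAddSubgroup = φ.ker.map (icast ι) := rfl
  have hle : Λ ≤ Λ0 := by
    intro v hv
    have : v ∈ Λ0.toAddSubgroup := by
      rw [h0]; exact AddSubgroup.map_mono le_top hv
    exact this
  have hdisc : DiscreteTopology Λ :=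
    DiscreteTopology.of_subset (s := (Λ0 : Set (ι → ℝ))) (inferInstance : DiscreteTopology Λ0) hle
  have htop : span ℝ (Λ : Set (ι → ℝ)) = ⊤ := by
    rw [eq_top_iff, ← (Pi.basisFun ℝ ι).span_eq, span_le]
    rintro _ ⟨i, rfl⟩
    have hn : (Nat.card G : ℝ) ≠ 0 := by exact_mod_cast Nat.card_pos.ne'
    have hm : icast ι (Nat.card G • Pi.single i 1) ∈ span ℝ (Λ : Set (ι → ℝ)) := by
      apply subset_span
      refine ⟨_, ?_, rfl⟩
      rw [SetLike.mem_coe, AddMonoidHom.mem_ker, map_nsmul]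
      exact card_nsmul_eq_zero'
    have e : Pi.basisFun ℝ ι i = (Nat.card G : ℝ)⁻¹ • icast ι (Nat.card G • Pi.single i 1) := by
      ext j
      rcases eq_or_ne j i with rfl | hj
      · simp [icast]
      · simp [icast, hj]
    rw [SetLike.mem_coe, e]; exact smul_mem _ _ hm
  have hz : IsZLattice ℝ Λ := ⟨htop⟩
  have hz0 : IsZLattice ℝ Λ0 := inferInstance
  have hcov0 : ZLattice.covolume Λ0 = 1 := by
    rw [ZLattice.covolume_eq_measure_fundamentalDomain Λ0 volume (ZSpan.isAddFundamentalDomain (Pi.basisFun ℝ ι) volume),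
      ZSpan.fundamentalDomain_pi_basisFun, measureReal_def, Real.volume_pi_Ico]
    simp
  have hidx : Λ.toAddSubgroup.relIndex Λ0.toAddSubgroup ≤ Nat.card G := by
    rw [h0, h1, AddSubgroup.relIndex_map_map_of_injective _ _ icast_inj, AddSubgroup.relIndex_top_right, AddSubgroup.index_ker]
    exact Nat.card_le_card_of_injective _ Subtype.val_injective
  have hcov : ZLattice.covolume Λ ≤ Nat.card G := by
    have := ZLattice.covolume_div_covolume_eq_relIndex Λ Λ0 hle
    rw [hcov0, div_one] at this
    rw [this]; exact_mod_cast hidx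
  have fund := ZLattice.isAddFundamentalDomain (IsZLattice.basis Λ) (volume : Measure (ι → ℝ))
  rw [ZLattice.covolume_eq_measure_fundamentalDomain Λ volume fund] at hcov
  have hne : volume (ZSpan.fundamentalDomain ((IsZLattice.basis Λ).ofZLatticeBasis ℝ)) ≠ ⊤ :=
    (Bornology.IsBounded.measure_lt_top (ZSpan.fundamentalDomain_isBounded _)).ne
  have hle2 : volume (ZSpan.fundamentalDomain ((IsZLattice.basis Λ).ofZLatticeBasis ℝ)) ≤ (Nat.card G : ENNReal) := by
    rw [← ENNReal.ofReal_toReal hne, ← ENNReal.ofReal_natCast]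
    exact ENNReal.ofReal_le_ofReal hcov
  have : Countable Λ.toAddSubgroup := (inferInstance : Countable Λ)
  obtain ⟨x, hx0, hx⟩ := exists_ne_zero_mem_lattice_of_measure_mul_two_pow_lt_measure (s := s) (μ := volume)
    (L := Λ.toAddSubgroup) fund hs hc (by
      rw [Module.finrank_fintype_fun_eq_card]
      exact lt_of_le_of_lt (by gcongr) hv)
  obtain ⟨y, hy, hyx⟩ := x.2
  refine ⟨y, ?_, hy, by rw [hyx]; exact hx⟩
  rintro rfl
  apply hx0; ext1; rw [← hyx]; simp

theorem vol3 {f : Matrix (Fin 3) (Fin 3) ℝ} (hf : f.det ≠ 0) (S : Set (Fin 3 → ℝ)) :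
    volume {x | f.mulVec x ∈ S} = ENNReal.ofReal |f.det⁻¹| * volume S := by
  have h := Measure.addHaar_preimage_linearMap (μ := (volume : Measure (Fin 3 → ℝ))) (f := Matrix.toLin' f) (by rwa [LinearMap.det_toLin']) S
  rw [LinearMap.det_toLin'] at h
  exact h

theorem ball3 {r : ℝ} (hr : 0 < r) : volume {y : Fin 3 → ℝ | y 0 ^ 2 + y 1 ^ 2 + y 2 ^ 2 < r ^ 2} = ENNReal.ofReal (r ^ 3 * Real.pi * 4 / 3) := by
  have h := EuclideanSpace.volume_ball_fin_three 0 r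
  have e : {y : Fin 3 → ℝ | y 0 ^ 2 + y 1 ^ 2 + y 2 ^ 2 < r ^ 2} = (WithLp.toLp 2) ⁻¹' (Metric.ball (0 : EuclideanSpace ℝ (Fin 3)) r) := by
    ext y
    simp only [Set.mem_preimage, mem_ball_zero_iff, Set.mem_ofPred_eq]
    rw [EuclideanSpace.norm_eq, Real.sqrt_lt' hr, Fin.sum_univ_three]
    simp
  rw [e, (PiLp.volume_preserving_toLp (Fin 3)).measure_preimage measurableSet_ball.nullMeasurableSet, h,
    ← ENNReal.ofReal_pow hr.le, ← ENNReal.ofReal_mul (by positivity)]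
  congr 1; ring

theorem disc2 {r : ℝ} (hr : 0 < r) : volume {y : Fin 2 → ℝ | y 0 ^ 2 + y 1 ^ 2 < r ^ 2} = ENNReal.ofReal (r ^ 2 * Real.pi) := by
  have h := EuclideanSpace.volume_ball_fin_two 0 r
  have e : {y : Fin 2 → ℝ | y 0 ^ 2 + y 1 ^ 2 < r ^ 2} = (WithLp.toLp 2) ⁻¹' (Metric.ball (0 : EuclideanSpace ℝ (Fin 2)) r) := by
    ext y
    simp only [Set.mem_preimage, mem_ball_zero_iff, Set.mem_ofPred_eq]
    rw [EuclideanSpace.norm_eq, Real.sqrt_lt' hr, Fin.sum_univ_two]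
    simp
  rw [e, (PiLp.volume_preserving_toLp (Fin 2)).measure_preimage measurableSet_ball.nullMeasurableSet, h,
    ← ENNReal.ofReal_pow hr.le]
  rw [ENNReal.ofReal_mul (by positivity)]

theorem cyl3 {r A : ℝ} (hr : 0 < r) (hA : 0 < A) : volume {y : Fin 3 → ℝ | |y 0| < A ∧ y 1 ^ 2 + y 2 ^ 2 < r ^ 2} =
    ENNReal.ofReal (2 * A * (r ^ 2 * Real.pi)) := by
  have hm := volume_preserving_piFinSuccAbove (fun _ : Fin 3 => ℝ) 0
  have e : {y : Fin 3 → ℝ | |y 0| < A ∧ y 1 ^ 2 + y 2 ^ 2 < r ^ 2} = (MeasurableEquiv.piFinSuccAbove (fun _ : Fin 3 => ℝ) 0) ⁻¹'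
      (Set.Ioo (-A) A ×ˢ {y : Fin 2 → ℝ | y 0 ^ 2 + y 1 ^ 2 < r ^ 2}) := by
    ext y
    simp only [Set.mem_preimage, Set.mem_ofPred_eq, Set.mem_prod, Set.mem_Ioo, abs_lt]
    rfl
  rw [e, hm.measure_preimage_equiv, Measure.volume_eq_prod, Measure.prod_prod, disc2 hr, Real.volume_Ioo, ← ENNReal.ofReal_mul (by linarith)]
  congr 1; ring

theorem prodvol {S S' : Set (Fin 3 → ℝ)} (hS : MeasurableSet S) (hS' : MeasurableSet S') {h : (Fin 3 → ℝ) → Fin 3 → ℝ}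
    (hh : Measurable h) : volume {z : Fin 3 ⊕ Fin 3 → ℝ | (fun i => z (Sum.inl i)) ∈ S ∧
      (fun i => z (Sum.inr i)) - h (fun i => z (Sum.inl i)) ∈ S'} = volume S * volume S' := by
  have hm := volume_measurePreserving_sumPiEquivProdPi (fun _ : Fin 3 ⊕ Fin 3 => ℝ)
  set B : Set ((Fin 3 → ℝ) × (Fin 3 → ℝ)) := {z | z.1 ∈ S ∧ z.2 - h z.1 ∈ S'} with hB
  have e : {z : Fin 3 ⊕ Fin 3 → ℝ | (fun i => z (Sum.inl i)) ∈ S ∧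
      (fun i => z (Sum.inr i)) - h (fun i => z (Sum.inl i)) ∈ S'} = (MeasurableEquiv.sumPiEquivProdPi (fun _ : Fin 3 ⊕ Fin 3 => ℝ)) ⁻¹' B := rfl
  rw [e, hm.measure_preimage_equiv, Measure.volume_eq_prod]
  have hBm : MeasurableSet B := by
    refine (measurable_fst hS).inter ?_
    exact (measurable_snd.sub (hh.comp measurable_fst)) hS'
  rw [Measure.prod_apply hBm]
  have : ∀ x, volume (Prod.mk x ⁻¹' B) = S.indicator (fun _ => volume S') x := by
    intro x
    by_cases hx : x ∈ S
    · rw [Set.indicator_of_mem hx]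
      have : Prod.mk x ⁻¹' B = (fun y => y - h x) ⁻¹' S' := by
        ext y; simp [hB, hx]
      rw [this]
      simp only [sub_eq_add_neg]
      exact measure_preimage_add_right _ _ _
    · rw [Set.indicator_of_notMem hx]
      have : Prod.mk x ⁻¹' B = ∅ := by
        ext y; simp [hB, hx]
      rw [this]; simp
  simp_rw [this]
  rw [lintegral_indicator hS, lintegral_const, Measure.restrict_apply_univ, mul_comm]

end
end MF

namespace MF
open Module MeasureTheory Filter Topology Submodule

local notation "N" => Quaternion.normSq

theorem exists_co {p : ℕ} [Fact p.Prime] (t : TL p) (x0 : Fin 3 → ℤ) {α : ℝ} (hα : N (t.vec x0) = α ^ 2) :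
    ∃ g : Matrix (Fin 3) (Fin 3) ℝ, (∀ x : Fin 3 → ℤ, N (t.vec x) = g.mulVec (icast _ x) 0 ^ 2 + g.mulVec (icast _ x) 1 ^ 2
      + g.mulVec (icast _ x) 2 ^ 2) ∧ |g.det| = √(p : ℝ) / 2 ∧ g.mulVec (icast _ x0) = ![α, 0, 0] := by
  obtain ⟨y, hy0, hy1, hy2, hy3⟩ : ∃ y : H, y.re = 0 ∧ y.imI = α ∧ y.imJ = 0 ∧ y.imK = 0 := ⟨⟨0, α, 0, 0⟩, rfl, rfl, rfl, rfl⟩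
  obtain ⟨ε, u, he, hu, k, -⟩ := refl_ex (t.vec_re x0) hy0 (by rw [hα, Quaternion.normSq_def', hy0, hy1, hy2, hy3]; ring)
  obtain ⟨f, hf⟩ : ∃ f : H → H, f = rot ε u := ⟨_, rfl⟩
  have r1 : (f t.e1).re = 0 := by rw [hf]; exact rot_re ε t.h1
  have r2 : (f t.e2).re = 0 := by rw [hf]; exact rot_re ε t.h2
  have r3 : (f t.e3).re = 0 := by rw [hf]; exact rot_re ε t.h3
  have hv : ∀ x, f (t.vec x) = (x 0 : H) * f t.e1 + (x 1 : H) * f t.e2 + (x 2 : H) * f t.e3 := by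
    intro x
    rw [hf, TL.vec, rot_add, rot_add, rot_int, rot_int, rot_int]
  set g : Matrix (Fin 3) (Fin 3) ℝ := !![(f t.e1).imI, (f t.e2).imI, (f t.e3).imI; (f t.e1).imJ, (f t.e2).imJ, (f t.e3).imJ;
    (f t.e1).imK, (f t.e2).imK, (f t.e3).imK] with hg
  have hi : ∀ x, (f (t.vec x)).re = 0 ∧ (f (t.vec x)).imI = g.mulVec (icast _ x) 0 ∧ (f (t.vec x)).imJ = g.mulVec (icast _ x) 1 ∧
      (f (t.vec x)).imK = g.mulVec (icast _ x) 2 := by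
    intro x
    rw [hv]
    refine ⟨?_, ?_, ?_, ?_⟩
    · simp [r1, r2, r3]
    all_goals simp [hg, Matrix.mulVec, dotProduct, Fin.sum_univ_three, icast]; ring
  refine ⟨g, ?_, ?_, ?_⟩
  · intro x
    obtain ⟨a, b, c, d⟩ := hi x
    rw [← b, ← c, ← d, ← rot_N he hu (t.vec x), ← hf, Quaternion.normSq_def', a]; ring
  · have h1 : g.det = - (f t.e1 * f t.e2 * f t.e3).re := by
      rw [hg, Matrix.det_fin_three]
      simp [r1, r2, r3]; ring
    have h2 : (f t.e1 * f t.e2 * f t.e3).re = ε * (t.e1 * t.e2 * t.e3).re := by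
      rw [hf, TL.rot_mul he hu, rot, ← mul_assoc, ← real_comm, mul_assoc, re_coe_mul]
      rw [show u * (t.e1 * t.e2) * star u * (u * t.e3 * star u) = u * (t.e1 * t.e2 * (star u * u) * t.e3 * star u) by noncomm_ring,
        re_cycl, unit_l hu, mul_one, mul_assoc, unit_l hu, mul_one]
    have h3 : (t.e1 * t.e2 * t.e3).re = √(p : ℝ) / 2 := by have := t.hor; linarith
    rw [h1, h2, h3, abs_neg, abs_mul, abs_of_nonneg (by positivity : 0 ≤ √(p : ℝ) / 2)]
    have : |ε| = 1 := by
      rcases mul_self_eq_one_iff.1 he with h | h <;> simp [h]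
    rw [this, one_mul]
  · obtain ⟨a, b, c, d⟩ := hi x0
    rw [hf, k] at b c d
    ext i
    fin_cases i
    · simpa [hy1] using b.symm
    · simpa [hy2] using c.symm
    · simpa [hy3] using d.symm

theorem exists_phi {p : ℕ} [Fact p.Prime] (t t' : TL p) : ∃ φ : (Fin 3 ⊕ Fin 3 → ℤ) →+ ZMod p × ZMod p, ∀ z, φ z = 0 →
    ∃ m : ℤ, N (t.vec fun i => z (Sum.inl i)) - N (t'.vec fun i => z (Sum.inr i)) = p * m := by
  obtain ⟨δ, hδ⟩ := exists_plane (p := p)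
  obtain ⟨α, β, h1⟩ := hδ t
  obtain ⟨α', β', h2⟩ := hδ t'
  refine ⟨⟨⟨fun z => (∑ i, α i * (z (Sum.inl i) : ZMod p) - ∑ i, α' i * (z (Sum.inr i) : ZMod p),
    ∑ i, β i * (z (Sum.inl i) : ZMod p) - ∑ i, β' i * (z (Sum.inr i) : ZMod p)), ?_⟩, ?_⟩, ?_⟩
  · simp
  · intro x y
    ext
    · simp [mul_add, Finset.sum_add_distrib]; ring
    · simp [mul_add, Finset.sum_add_distrib]; ring
  · intro z hz
    have hz1 := congrArg Prod.fst hz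
    have hz2 := congrArg Prod.snd hz
    simp only [AddMonoidHom.coe_mk, ZeroHom.coe_mk, Prod.fst_zero, Prod.snd_zero] at hz1 hz2
    have k1 := h1 fun i => z (Sum.inl i)
    have k2 := h2 fun i => z (Sum.inr i)
    rw [sub_eq_zero.1 hz1, sub_eq_zero.1 hz2, ← k2] at k1
    have k3 := (ZMod.intCast_eq_intCast_iff_dvd_sub _ _ _).1 k1.symm
    obtain ⟨m, hm⟩ := k3
    refine ⟨m, ?_⟩
    rw [t.N_vec, t'.N_vec, ← Int.cast_sub, hm]; push_cast; ring

theorem mink6 {p : ℕ} [Fact p.Prime] (φ : (Fin 3 ⊕ Fin 3 → ℤ) →+ ZMod p × ZMod p) {g g' : Matrix (Fin 3) (Fin 3) ℝ}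
    (hg : |g.det| = √(p : ℝ) / 2) (hg' : |g'.det| = √(p : ℝ) / 2) {B B' : Set (Fin 3 → ℝ)} (hB : MeasurableSet B) (hB' : MeasurableSet B')
    (cB : Convex ℝ B) (cB' : Convex ℝ B') (sB : ∀ x ∈ B, -x ∈ B) (sB' : ∀ x ∈ B', -x ∈ B') (h : (Fin 3 → ℝ) →ₗ[ℝ] (Fin 3 → ℝ))
    {V V' : ℝ} (hV : volume B = ENNReal.ofReal V) (hV' : volume B' = ENNReal.ofReal V') (hV0 : 0 < V) (hV0' : 0 < V')
    (hlt : (p : ℝ) ^ 3 * 16 < V * V') :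
    ∃ z, z ≠ 0 ∧ φ z = 0 ∧ g.mulVec (icast _ fun i => z (Sum.inl i)) ∈ B ∧
      g'.mulVec ((icast _ fun i => z (Sum.inr i)) - h (icast _ fun i => z (Sum.inl i))) ∈ B' := by
  have hp0 : (0 : ℝ) < p := by exact_mod_cast (Fact.out : p.Prime).pos
  have hs : 0 < √(p : ℝ) := Real.sqrt_pos.2 hp0
  have hss : √(p : ℝ) * √(p : ℝ) = p := Real.mul_self_sqrt hp0.le
  have d1 : g.det ≠ 0 := by intro h0; rw [h0] at hg; simp at hg; linarith
  have d2 : g'.det ≠ 0 := by intro h0; rw [h0] at hg'; simp at hg'; linarith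
  have mS : MeasurableSet {x | g.mulVec x ∈ B} := (Matrix.toLin' g).continuous_of_finiteDimensional.measurable hB
  have mS' : MeasurableSet {x | g'.mulVec x ∈ B'} := (Matrix.toLin' g').continuous_of_finiteDimensional.measurable hB'
  have hvol := prodvol mS mS' h.continuous_of_finiteDimensional.measurable
  set pl : (Fin 3 ⊕ Fin 3 → ℝ) →ₗ[ℝ] (Fin 3 → ℝ) := LinearMap.funLeft ℝ ℝ Sum.inl with hpl
  set pr : (Fin 3 ⊕ Fin 3 → ℝ) →ₗ[ℝ] (Fin 3 → ℝ) := LinearMap.funLeft ℝ ℝ Sum.inr with hpr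
  set F : (Fin 3 ⊕ Fin 3 → ℝ) →ₗ[ℝ] (Fin 3 → ℝ) := (Matrix.toLin' g).comp pl with hF
  set F' : (Fin 3 ⊕ Fin 3 → ℝ) →ₗ[ℝ] (Fin 3 → ℝ) := (Matrix.toLin' g').comp (pr - h.comp pl) with hF'
  have hset : {z : Fin 3 ⊕ Fin 3 → ℝ | (fun i => z (Sum.inl i)) ∈ {x | g.mulVec x ∈ B} ∧
      (fun i => z (Sum.inr i)) - h (fun i => z (Sum.inl i)) ∈ {x | g'.mulVec x ∈ B'}} = F ⁻¹' B ∩ F' ⁻¹' B' := rfl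
  rw [hset, vol3 d1, vol3 d2, hV, hV', abs_inv, abs_inv, hg, hg'] at hvol
  obtain ⟨z, hz0, hz1, hz2⟩ := minkZ φ (s := F ⁻¹' B ∩ F' ⁻¹' B') (by
      rintro x ⟨h1, h2⟩
      refine ⟨?_, ?_⟩
      · show F (-x) ∈ B
        rw [map_neg]; exact sB _ h1
      · show F' (-x) ∈ B'
        rw [map_neg]; exact sB' _ h2) ((cB.linear_preimage F).inter (cB'.linear_preimage F')) (by
      rw [hvol, ← ENNReal.ofReal_mul (by positivity), ← ENNReal.ofReal_mul (by positivity), ← ENNReal.ofReal_mul (by positivity),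
        Nat.card_prod, Nat.card_zmod]
      have e : ((p * p : ℕ) : ENNReal) * 2 ^ Fintype.card (Fin 3 ⊕ Fin 3) = ENNReal.ofReal ((p : ℝ) * p * 64) := by
        rw [ENNReal.ofReal_mul (by positivity), ENNReal.ofReal_mul (by positivity), ENNReal.ofReal_natCast]
        simp; norm_num
      rw [e, ENNReal.ofReal_lt_ofReal_iff (by positivity)]
      have : (√(p : ℝ) / 2)⁻¹ * V * ((√(p : ℝ) / 2)⁻¹ * V') = 4 * (V * V') / p := by
        generalize √(p : ℝ) = s at *
        rw [← hss]; field_simp; ring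
      rw [this, lt_div_iff₀ hp0]
      nlinarith)
  exact ⟨z, hz0, hz1, hz2.1, hz2.2⟩

theorem conv_ball (r : ℝ) : Convex ℝ {y : Fin 3 → ℝ | y 0 ^ 2 + y 1 ^ 2 + y 2 ^ 2 < r} := by
  intro x hx y hy a b ha hb hab
  simp only [Set.mem_ofPred_eq, Pi.add_apply, Pi.smul_apply, smul_eq_mul] at *
  have h1 : b = 1 - a := by linarith
  have key : ∀ s t : ℝ, (a * s + b * t) ^ 2 = a * s ^ 2 + b * t ^ 2 - a * b * (s - t) ^ 2 := by intro s t; rw [h1]; ring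
  have hn : ∀ s t : ℝ, 0 ≤ a * b * (s - t) ^ 2 := fun s t => by positivity
  have k0 := hn (x 0) (y 0)
  have k1 := hn (x 1) (y 1)
  have k2 := hn (x 2) (y 2)
  rw [key, key, key]
  rcases ha.eq_or_lt with h | h
  · rw [← h] at *; nlinarith
  · nlinarith [mul_lt_mul_of_pos_left hx h, mul_le_mul_of_nonneg_left hy.le hb]

theorem conv_cyl (A r : ℝ) : Convex ℝ {y : Fin 3 → ℝ | |y 0| < A ∧ y 1 ^ 2 + y 2 ^ 2 < r} := by
  intro x hx y hy a b ha hb hab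
  simp only [Set.mem_ofPred_eq, Pi.add_apply, Pi.smul_apply, smul_eq_mul] at *
  have h1 : b = 1 - a := by linarith
  have key : ∀ s t : ℝ, (a * s + b * t) ^ 2 = a * s ^ 2 + b * t ^ 2 - a * b * (s - t) ^ 2 := by intro s t; rw [h1]; ring
  have hn : ∀ s t : ℝ, 0 ≤ a * b * (s - t) ^ 2 := fun s t => by positivity
  obtain ⟨hx0, hx1⟩ := hx
  obtain ⟨hy0, hy1⟩ := hy
  rw [abs_lt] at *
  have k1 := hn (x 1) (y 1)
  have k2 := hn (x 2) (y 2)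
  rw [key, key]
  rcases ha.eq_or_lt with h | h
  · rw [← h] at *
    refine ⟨⟨?_, ?_⟩, ?_⟩ <;> nlinarith
  · have e : A = a * A + b * A := by rw [h1]; ring
    refine ⟨⟨?_, ?_⟩, ?_⟩
    · nlinarith [mul_lt_mul_of_pos_left hx0.1 h, mul_le_mul_of_nonneg_left hy0.1.le hb]
    · nlinarith [mul_lt_mul_of_pos_left hx0.2 h, mul_le_mul_of_nonneg_left hy0.2.le hb]
    · nlinarith [mul_lt_mul_of_pos_left hx1 h, mul_le_mul_of_nonneg_left hy1.le hb]

theorem small_mult {p : ℕ} {x : ℝ} {m : ℤ} (h : x = p * m) (h1 : x < p) (h2 : -p < x) : m = 0 := by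
  have hp : (0 : ℝ) < p := by linarith
  have a1 : (m : ℝ) < 1 := by
    by_contra hc
    push Not at hc
    nlinarith
  have a2 : (-1 : ℝ) < m := by
    by_contra hc
    push Not at hc
    nlinarith
  have a1' : m < 1 := by exact_mod_cast a1
  have a2' : -1 < m := by exact_mod_cast a2
  omega

theorem z_pos {p : ℕ} [Fact p.Prime] (t t' : TL p) {z : Fin 3 ⊕ Fin 3 → ℤ} (hz : z ≠ 0)
    (h : N (t.vec fun i => z (Sum.inl i)) = N (t'.vec fun i => z (Sum.inr i))) :
    ∃ n : ℕ, 0 < n ∧ N (t.vec fun i => z (Sum.inl i)) = n := by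
  obtain ⟨m, hm⟩ : ∃ m : ℤ, N (t.vec fun i => z (Sum.inl i)) = m := ⟨_, t.N_vec _⟩
  have h0 : (0 : ℝ) ≤ m := by rw [← hm]; exact Quaternion.normSq_nonneg
  have h0' : 0 ≤ m := by exact_mod_cast h0
  have h1 : m ≠ 0 := by
    rintro rfl
    rw [Int.cast_zero] at hm
    have k1 := t.vec_zero (Quaternion.normSq_eq_zero.1 hm)
    have k2 := t'.vec_zero (Quaternion.normSq_eq_zero.1 (h ▸ hm))
    apply hz
    ext i
    rcases i with i | i
    · exact congrFun k1 i
    · exact congrFun k2 i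
  refine ⟨m.toNat, by omega, ?_⟩
  rw [hm]
  have : ((m.toNat : ℤ) : ℝ) = m := by rw [Int.toNat_of_nonneg h0']
  rw [← this]; exact Int.cast_natCast _

theorem exists_first {p : ℕ} [Fact p.Prime] (t t' : TL p) (φ : (Fin 3 ⊕ Fin 3 → ℤ) →+ ZMod p × ZMod p)
    (hφ : ∀ z, φ z = 0 → ∃ m : ℤ, N (t.vec fun i => z (Sum.inl i)) - N (t'.vec fun i => z (Sum.inr i)) = p * m) :
    ∃ n : ℕ, 0 < n ∧ ∃ z, φ z = 0 ∧ N (t.vec fun i => z (Sum.inl i)) = n ∧ N (t'.vec fun i => z (Sum.inr i)) = n := by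
  have hp0 : (0 : ℝ) < p := by exact_mod_cast (Fact.out : p.Prime).pos
  have hs : 0 < √(p : ℝ) := Real.sqrt_pos.2 hp0
  have hss : √(p : ℝ) ^ 2 = p := Real.sq_sqrt hp0.le
  obtain ⟨g, hg1, hg2, -⟩ := exists_co t 0 (α := 0) (by simp [TL.vec])
  obtain ⟨g', hg1', hg2', -⟩ := exists_co t' 0 (α := 0) (by simp [TL.vec])
  have hm : MeasurableSet {y : Fin 3 → ℝ | y 0 ^ 2 + y 1 ^ 2 + y 2 ^ 2 < √(p : ℝ) ^ 2} :=
    (isOpen_lt (by fun_prop) (by fun_prop)).measurableSet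
  have hpi := Real.pi_gt_three
  obtain ⟨z, hz0, hz1, hz2, hz3⟩ := mink6 φ hg2 hg2' hm hm (conv_ball _) (conv_ball _) (by intro x hx; simpa using hx)
    (by intro x hx; simpa using hx) 0 (ball3 hs) (ball3 hs) (by positivity) (by positivity) (by
      have : √(p : ℝ) ^ 3 * Real.pi * 4 / 3 * (√(p : ℝ) ^ 3 * Real.pi * 4 / 3) = (√(p : ℝ) ^ 2) ^ 3 * (16 * Real.pi ^ 2 / 9) := by ring
      rw [this, hss]
      apply mul_lt_mul_of_pos_left _ (by positivity)
      nlinarith)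
  simp only [LinearMap.zero_apply, sub_zero, Set.mem_ofPred_eq, ← hg1, ← hg1', hss] at hz2 hz3
  obtain ⟨m, hm⟩ := hφ z hz1
  have h1 : 0 ≤ N (t.vec fun i => z (Sum.inl i)) := Quaternion.normSq_nonneg
  have h2 : 0 ≤ N (t'.vec fun i => z (Sum.inr i)) := Quaternion.normSq_nonneg
  have hm0 := small_mult hm (by linarith) (by linarith)
  rw [hm0, Int.cast_zero, mul_zero, sub_eq_zero] at hm
  obtain ⟨n, hn, hn'⟩ := z_pos t t' hz0 hm
  exact ⟨n, hn, z, hz1, hn', hm ▸ hn'⟩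

theorem meas_cyl (r A : ℝ) : MeasurableSet {y : Fin 3 → ℝ | |y 0| < A ∧ y 1 ^ 2 + y 2 ^ 2 < r} := by
  have h1 : IsOpen {y : Fin 3 → ℝ | |y 0| < A} := isOpen_lt (by fun_prop) (by fun_prop)
  have h2 : IsOpen {y : Fin 3 → ℝ | y 1 ^ 2 + y 2 ^ 2 < r} := isOpen_lt (by fun_prop) (by fun_prop)
  exact (h1.inter h2).measurableSet

set_option maxHeartbeats 1000000 in
theorem exists_pair {p : ℕ} [Fact p.Prime] (t t' : TL p) : ∃ x0 x1 y0 y1 : Fin 3 → ℤ, N (t.vec x0) = N (t'.vec y0) ∧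
    N (t.vec x1) = N (t'.vec y1) ∧ T2 (t.vec x0) (t.vec x1) = T2 (t'.vec y0) (t'.vec y1) ∧
    0 < 4 * N (t.vec x0) * N (t.vec x1) - T2 (t.vec x0) (t.vec x1) ^ 2 := by
  classical
  have hp0 : (0 : ℝ) < p := by exact_mod_cast (Fact.out : p.Prime).pos
  have hs : 0 < √(p : ℝ) := Real.sqrt_pos.2 hp0
  have hss : √(p : ℝ) ^ 2 = p := Real.sq_sqrt hp0.le
  obtain ⟨φ, hφ⟩ := exists_phi t t'
  have hex := exists_first t t' φ hφ
  obtain ⟨hn0, z0, hz0, hzl, hzr⟩ := Nat.find_spec hex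
  have hmin := fun m => Nat.find_min hex (m := m)
  generalize Nat.find hex = n at *
  have hn : (0 : ℝ) < n := by exact_mod_cast hn0
  obtain ⟨α, hα, hα2⟩ : ∃ α : ℝ, 0 < α ∧ α ^ 2 = n := ⟨√n, Real.sqrt_pos.2 hn, Real.sq_sqrt hn.le⟩
  obtain ⟨g, hg1, hg2, hg3⟩ := exists_co t (fun i => z0 (Sum.inl i)) (by rw [hzl, hα2])
  obtain ⟨g', hg1', hg2', hg3'⟩ := exists_co t' (fun i => z0 (Sum.inr i)) (by rw [hzr, hα2])
  have hm := meas_cyl (√(p : ℝ) ^ 2)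
  have hpi := Real.pi_gt_three
  have hA' : 0 < p / (2 * α) := by positivity
  obtain ⟨z, hz0', hz1, hz2, hz3⟩ := mink6 φ hg2 hg2' (hm α) (hm (p / (2 * α))) (conv_cyl _ _) (conv_cyl _ _) (by intro x hx; simpa using hx)
    (by intro x hx; simpa using hx) (((LinearMap.proj 0).comp (Matrix.toLin' g)).smulRight (α⁻¹ • icast _ fun i => z0 (Sum.inr i)))
    (cyl3 hs hα) (cyl3 hs hA') (by positivity) (by positivity) (by
      rw [hss]
      have : 2 * α * (p * Real.pi) * (2 * (p / (2 * α)) * (p * Real.pi)) = (p : ℝ) ^ 3 * (2 * Real.pi ^ 2) := by field_simp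
      rw [this]
      apply mul_lt_mul_of_pos_left _ (by positivity)
      nlinarith)
  simp only [LinearMap.smulRight_apply, LinearMap.comp_apply, LinearMap.proj_apply, Matrix.toLin'_apply, Matrix.mulVec_sub, Matrix.mulVec_smul,
    hg3', Set.mem_ofPred_eq, hss, Pi.sub_apply, Pi.smul_apply, smul_eq_mul] at hz2 hz3
  have b1 := hg1 fun i => z (Sum.inl i)
  have b2 := hg1' fun i => z (Sum.inr i)
  have b3 := hg1 fun i => (z0 + z) (Sum.inl i)
  have b4 := hg1' fun i => (z0 + z) (Sum.inr i)
  have c1 : (fun i => (z0 + z) (Sum.inl i)) = (fun i => z0 (Sum.inl i)) + (fun i => z (Sum.inl i)) := rfl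
  have c2 : (fun i => (z0 + z) (Sum.inr i)) = (fun i => z0 (Sum.inr i)) + (fun i => z (Sum.inr i)) := rfl
  obtain ⟨m1, d1⟩ := hφ z hz1
  obtain ⟨m2, d2⟩ := hφ (z0 + z) (by rw [map_add, hz0, hz1, add_zero])
  have e1 := T2_polar (t.vec_re fun i => z0 (Sum.inl i)) (t.vec_re fun i => z (Sum.inl i))
  have e2 := T2_polar (t'.vec_re fun i => z0 (Sum.inr i)) (t'.vec_re fun i => z (Sum.inr i))
  rw [← TL.vec_add, ← c1] at e1
  rw [← TL.vec_add, ← c2] at e2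
  rw [c1, map_add, Matrix.mulVec_add, hg3] at b3
  rw [c2, map_add, Matrix.mulVec_add, hg3'] at b4
  rw [← c1] at b3
  rw [← c2] at b4
  have hzp := fun h => z_pos t t' hz0' h
  refine ⟨fun i => z0 (Sum.inl i), fun i => z (Sum.inl i), fun i => z0 (Sum.inr i), fun i => z (Sum.inr i), by rw [hzl, hzr], ?_⟩
  have hmin' : ∀ m : ℕ, 0 < m → m < n → ¬ (N (t.vec fun i => z (Sum.inl i)) = m ∧ N (t'.vec fun i => z (Sum.inr i)) = m) := by
    intro m h1 h2 h3
    exact hmin m h2 ⟨h1, z, hz1, h3.1, h3.2⟩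
  simp only [Pi.add_apply, Matrix.cons_val_zero, Matrix.cons_val_one, Matrix.cons_val, mul_zero, sub_zero, zero_add] at b1 b2 b3 b4 hz2 hz3
  generalize g.mulVec (icast (Fin 3) fun i => z (Sum.inl i)) = X at *
  generalize g'.mulVec (icast (Fin 3) fun i => z (Sum.inr i)) = Z at *
  generalize N (t.vec fun i => (z0 + z) (Sum.inl i)) = n3 at *
  generalize N (t'.vec fun i => (z0 + z) (Sum.inr i)) = n4 at *
  generalize N (t.vec fun i => z (Sum.inl i)) = n1 at *
  generalize N (t'.vec fun i => z (Sum.inr i)) = n2 at *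
  rw [hzl] at e1 ⊢
  rw [hzr] at e2
  rw [e1, e2]
  rw [show X 0 * (α⁻¹ * α) = X 0 by field_simp] at hz3
  obtain ⟨a1, a2⟩ := hz2
  obtain ⟨a3, a4⟩ := hz3
  have hd : 2 * α * (X 0 - Z 0) = p * ((m2 - m1 : ℤ) : ℝ) := by push_cast; linear_combination d2 - d1 - b3 + b4 + b1 - b2
  rw [abs_lt] at a1 a3
  have q1 : 2 * α * (p / (2 * α)) = p := by field_simp
  have q2 := mul_lt_mul_of_pos_left a3.1 (by positivity : 0 < 2 * α)
  have q3 := mul_lt_mul_of_pos_left a3.2 (by positivity : 0 < 2 * α)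
  have hd0 := small_mult hd (by nlinarith) (by nlinarith)
  rw [hd0, Int.cast_zero, mul_zero, mul_eq_zero, or_iff_right (by positivity), sub_eq_zero] at hd
  have hm1 := small_mult (show n1 - n2 = p * m1 from d1) (by rw [b1, b2, hd]; nlinarith [sq_nonneg (Z 1), sq_nonneg (Z 2)])
    (by rw [b1, b2, hd]; nlinarith [sq_nonneg (X 1), sq_nonneg (X 2)])
  rw [hm1, Int.cast_zero, mul_zero, sub_eq_zero] at d1
  have hm2 : m2 = 0 := by omega
  rw [hm2, Int.cast_zero, mul_zero, sub_eq_zero] at d2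
  refine ⟨d1, by rw [d1, d2], ?_⟩
  have hD : 4 * (n : ℝ) * n1 - (n3 - n - n1) ^ 2 = 4 * α ^ 2 * (X 1 ^ 2 + X 2 ^ 2) := by
    rw [b1, b3, ← hα2]; ring
  rw [hD]
  by_contra hc
  have hX : X 1 ^ 2 + X 2 ^ 2 ≤ 0 := by
    by_contra hc'
    push Not at hc'
    exact hc (by positivity)
  obtain ⟨k, hk, hk'⟩ := hzp d1
  refine hmin' k hk ?_ ⟨hk', by rw [← d1, hk']⟩
  have : (k : ℝ) < n := by
    rw [← hk', b1, ← hα2]; nlinarith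
  exact_mod_cast this

end MF

namespace MF
open Module MeasureTheory Filter Topology Submodule

local notation "N" => Quaternion.normSq

theorem id_basis {a b x : H} (ha : a.re = 0) (hb : b.re = 0) (hx : x.re = 0) :
    ((4 * N a * N b - T2 a b ^ 2 : ℝ) : H) * x = ((2 * N b * T2 x a - T2 a b * T2 x b : ℝ) : H) * a +
      ((2 * N a * T2 x b - T2 a b * T2 x a : ℝ) : H) * b + ((T2 x (a * b - b * a) / 2 : ℝ) : H) * (a * b - b * a) := by
  rw [Quaternion.coe_mul_eq_smul, Quaternion.coe_mul_eq_smul, Quaternion.coe_mul_eq_smul, Quaternion.coe_mul_eq_smul]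
  ext <;> simp [T2, ha, hb, hx, Quaternion.normSq_def'] <;> first | ring1 | (right; ring1) | (left; ring1)

theorem TL.T_int {p : ℕ} [Fact p.Prime] (t : TL p) {x y : H} (hx : x ∈ t.L) (hy : y ∈ t.L) : ∃ m : ℤ, T2 x y = m := by
  obtain ⟨a, rfl⟩ := t.mem_L'.1 hx
  obtain ⟨b, rfl⟩ := t.mem_L'.1 hy
  exact ⟨_, t.T_vec a b⟩

theorem TL.N_int {p : ℕ} [Fact p.Prime] (t : TL p) {x : H} (hx : x ∈ t.L) : ∃ m : ℤ, N x = m := by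
  obtain ⟨a, rfl⟩ := t.mem_L'.1 hx
  exact ⟨_, t.N_vec a⟩

theorem T2_coe (r : ℝ) (x y : H) : T2 x ((r : H) * y) = r * T2 x y := by
  simp only [T2]
  rw [← mul_assoc, ← real_comm, mul_assoc, re_coe_mul]; ring

theorem exists_common {p : ℕ} [hp : Fact p.Prime] (t t' : TL p) : ∃ (ε : ℝ) (u : H) (m : ℕ), ε * ε = 1 ∧ N u = 1 ∧ 0 < m ∧ m.Coprime p ∧
    ∀ x ∈ t'.L, (m : H) * rot ε u x ∈ t.L := by
  have hp0 : (0 : ℝ) < p := by exact_mod_cast hp.out.pos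
  obtain ⟨x0, x1, y0, y1, h0, h1, hT, hD⟩ := exists_pair t t'
  have ma : t.vec x0 ∈ t.L := t.mem_L'.2 ⟨_, rfl⟩
  have mb : t.vec x1 ∈ t.L := t.mem_L'.2 ⟨_, rfl⟩
  have ma' : t'.vec y0 ∈ t'.L := t'.mem_L'.2 ⟨_, rfl⟩
  have mb' : t'.vec y1 ∈ t'.L := t'.mem_L'.2 ⟨_, rfl⟩
  generalize t.vec x0 = a at *
  generalize t.vec x1 = b at *
  generalize t'.vec y0 = a' at *
  generalize t'.vec y1 = b' at *
  obtain ⟨ε, u, he, hu, ka, kb⟩ := ROT2 (t'.L_re ma') (t'.L_re mb') (t.L_re ma) (t.L_re mb) h0.symm h1.symm hT.symm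
  obtain ⟨na, hna⟩ := t.N_int ma
  obtain ⟨nb, hnb⟩ := t.N_int mb
  obtain ⟨τ, hτ⟩ := t.T_int ma mb
  set D : ℤ := 4 * na * nb - τ ^ 2 with hDdef
  have hD1 : 4 * N a * N b - T2 a b ^ 2 = D := by rw [hna, hnb, hτ, hDdef]; push_cast; ring
  have hD0 : 0 < D := by rw [hD1] at hD; exact_mod_cast hD
  have hm0 : 0 < (2 * p * D.toNat : ℕ) := by
    have := hp.out.pos
    have : 0 < D.toNat := by omega
    positivity
  have hDn : ((D.toNat : ℕ) : ℝ) = D := by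
    rw [← Int.cast_natCast, Int.toNat_of_nonneg hD0.le]
  have cL := t.cross_L ma mb
  have cL' := t'.cross_L ma' mb'
  have hc : a * b - b * a = u * (a' * b' - b' * a') * star u := by
    rw [← ka, ← kb, TL.rot_mul he hu, TL.rot_mul he hu]; noncomm_ring
  have hc2 : a * b - b * a = (ε : H) * rot ε u (a' * b' - b' * a') := by
    rw [rot, ← mul_assoc, ← Quaternion.coe_mul, he, Quaternion.coe_one, one_mul, hc]
  have hme : ∃ s : ℤ, ε = s := by
    rcases mul_self_eq_one_iff.1 he with h | h
    · exact ⟨1, by rw [h]; simp⟩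
    · exact ⟨-1, by rw [h]; simp⟩
  have main : ∀ x ∈ t'.L, ((2 * p * D.toNat : ℕ) : H) * rot ε u x ∈ t.L := by
    intro x hx
    have hid := id_basis (t.L_re ma) (t.L_re mb) (rot_re ε (u := u) (t'.L_re hx))
    have e1 : T2 (rot ε u x) a = T2 x a' := by rw [← ka, rot_T he hu]
    have e2 : T2 (rot ε u x) b = T2 x b' := by rw [← kb, rot_T he hu]
    have e3 : T2 (rot ε u x) (a * b - b * a) = ε * T2 x (a' * b' - b' * a') := by rw [hc2, T2_coe, rot_T he hu]
    obtain ⟨i1, hi1⟩ := t'.T_int hx ma'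
    obtain ⟨i2, hi2⟩ := t'.T_int hx mb'
    obtain ⟨i3, hi3⟩ := t'.T_int hx cL'
    obtain ⟨s, hs⟩ := hme
    rw [T2_coe] at hi3
    rw [hD1, e1, e2, e3, hi1, hi2, hna, hnb, hτ] at hid
    have k : ((2 * p * D.toNat : ℕ) : H) * rot ε u x = ((2 * p * (2 * nb * i1 - τ * i2) : ℤ) : H) * a + ((2 * p * (2 * na * i2 - τ * i1) : ℤ) : H) * b
        + ((s * i3 : ℤ) : H) * (((√(p : ℝ) : ℝ) : H) * (a * b - b * a)) := by
      have j0 : ((2 * p * D.toNat : ℕ) : H) * rot ε u x = ((2 * p : ℝ) : H) * (((D : ℝ) : H) * rot ε u x) := by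
        rw [← mul_assoc, ← Quaternion.coe_mul, ← ncoe]
        congr 2
        push_cast; rw [hDn]
      rw [j0, hid, ← icoe, ← icoe, ← icoe, ← mul_assoc ((_ : ℝ) : H) ((√(p : ℝ) : ℝ) : H), ← Quaternion.coe_mul, mul_add, mul_add,
        ← mul_assoc, ← mul_assoc, ← mul_assoc, ← Quaternion.coe_mul, ← Quaternion.coe_mul, ← Quaternion.coe_mul]
      congr 3
      · congr 2; push_cast; ring
      · congr 1; push_cast; ring
      · push_cast; rw [← hi3, ← hs]
        have := sqrtp_sq p
        linear_combination (-ε * T2 x (a' * b' - b' * a')) * this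
    rw [k]
    exact add_mem (add_mem (int_mul_mem _ ma) (int_mul_mem _ mb)) (int_mul_mem _ cL)
  generalize (2 * p * D.toNat : ℕ) = m0 at *
  obtain ⟨k, m, hm, hmk⟩ := Nat.exists_eq_pow_mul_and_not_dvd hm0.ne' p hp.out.ne_one
  refine ⟨ε, u, m, he, hu, ?_, ((Nat.Prime.coprime_iff_not_dvd hp.out).2 hm).symm, ?_⟩
  · rcases Nat.eq_zero_or_pos m with h | h
    · rw [h] at hm; simp at hm
    · exact h
  · rw [hmk] at main
    clear hmk hm
    induction k with
    | zero => simpa using main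
    | succ k ih =>
      apply ih
      intro x hx
      have h := main x hx
      obtain ⟨i, hi⟩ := t'.N_int hx
      have e : ((p ^ (k + 1) * m : ℕ) : H) * rot ε u x = (p : H) * (((p ^ k * m : ℕ) : H) * rot ε u x) := by
        push_cast; rw [pow_succ']; noncomm_ring
      rw [e] at h
      obtain ⟨y, hy, hxy⟩ := t.anP h (n := (p ^ k * m : ℕ) ^ 2 * i) (by
        rw [← ncoe, ← ncoe, map_mul, map_mul, normSq_coe', normSq_coe', rot_N he hu, hi]; push_cast; ring)
      have hp' : (p : H) ≠ 0 := by rw [← ncoe]; exact coeH_ne hp0.ne'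
      rw [mul_left_cancel₀ hp' hxy]; exact hy

theorem common_O {p : ℕ} [hp : Fact p.Prime] (t t' : TL p) {ε : ℝ} {u : H} {m : ℕ} (he : ε * ε = 1) (hu : N u = 1)
    (h : ∀ x ∈ t'.L, (m : H) * rot ε u x ∈ t.L) {x : H} (hx : x ∈ cn u t'.O) : (((m * m : ℕ) : ℤ) : H) * x ∈ t.O := by
  rw [mem_cn hu] at hx
  obtain ⟨n0, n1, n2, n3, hy⟩ := t'.mem_O.1 hx
  have hx' : x = u * (star u * x * u) * star u := by
    calc x = (u * star u) * x * (u * star u) := by rw [unit_r hu]; simp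
      _ = _ := by noncomm_ring
  have hL : ∀ {y z : H}, y ∈ t'.L → z ∈ t'.L → (((m * m : ℕ) : ℤ) : H) * (u * (y * z) * star u) ∈ t.O := by
    intro y z hy hz
    rw [← TL.rot_mul he hu, ← t.ord.CC]
    have : (((m * m : ℕ) : ℤ) : H) * (rot ε u y * rot ε u z) = (m * rot ε u y) * (m * rot ε u z) := by
      rw [Nat.cast_comm m (rot ε u z)]
      have := Nat.cast_comm m ((rot ε u y) * (rot ε u z))
      push_cast
      calc _ = (m : H) * (m * (rot ε u y * rot ε u z)) := by noncomm_ring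
        _ = _ := by rw [this]; noncomm_ring
    rw [this]
    exact mul_mem_mul (t.L_le_C (h y hy)) (t.L_le_C (h z hz))
  rw [hx', hy]
  have e : ∀ (n : ℤ) (y : H), u * (n * y) * star u = n * (u * y * star u) := by
    intro n y
    rw [← mul_assoc u, ← Int.cast_comm]; noncomm_ring
  have e' : ∀ (n : ℤ) (y : H), (((m * m : ℕ) : ℤ) : H) * (n * y) = n * ((((m * m : ℕ) : ℤ) : H) * y) := by
    intro n y
    rw [← mul_assoc, Int.cast_comm, mul_assoc]
  have e1 : u * 1 * star u = 1 := by rw [mul_one, unit_r hu]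
  rw [mul_add u, mul_add u, mul_add u, add_mul, add_mul, add_mul, e, e, e, e, mul_add, mul_add, mul_add, e', e', e', e', e1]
  refine add_mem (add_mem (add_mem ?_ ?_) ?_) ?_
  · exact int_mul_mem _ (int_mul_mem _ t.one_O)
  · exact int_mul_mem _ (hL t'.e2_L t'.e3_L)
  · exact int_mul_mem _ (hL t'.e3_L t'.e1_L)
  · exact int_mul_mem _ (hL t'.e1_L t'.e2_L)

theorem exists_conn {p : ℕ} [hp : Fact p.Prime] (t t' : TL p) : ∃ K, Conn t.O t'.O K := by
  obtain ⟨ε, u, m, he, hu, hm, hmp, hL⟩ := exists_common t t'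
  have ho := t.ord
  have ho' := t'.ord
  have hO2 := fun x hx => common_O t t' he hu hL (x := x) hx
  have one2 : (1 : H) ∈ cn u t'.O := by rw [mem_cn hu, mul_one, unit_l hu]; exact t'.one_O
  have mul2 : ∀ y ∈ cn u t'.O, ∀ z ∈ cn u t'.O, y * z ∈ cn u t'.O := by
    intro y hy z hz
    rw [mem_cn hu] at *
    have : star u * (y * z) * u = (star u * y * u) * (star u * z * u) := by
      calc _ = star u * y * 1 * z * u := by noncomm_ring
        _ = star u * y * (u * star u) * z * u := by rw [unit_r hu]
        _ = _ := by noncomm_ring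
    rw [this]; exact ho'.mulO hy hz
  obtain ⟨J, hJ⟩ : ∃ J : Submodule ℤ H, ∀ x, x ∈ J ↔ x ∈ t.O ∧ ∀ y ∈ cn u t'.O, x * y ∈ t.O := by
    refine ⟨⟨⟨⟨{x | x ∈ t.O ∧ ∀ y ∈ cn u t'.O, x * y ∈ t.O}, ?_⟩, ?_⟩, ?_⟩, fun x => Iff.rfl⟩
    · rintro a b ⟨h1, h2⟩ ⟨h3, h4⟩
      exact ⟨add_mem h1 h3, fun y hy => by rw [add_mul]; exact add_mem (h2 y hy) (h4 y hy)⟩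
    · exact ⟨zero_mem _, fun y _ => by rw [zero_mul]; exact zero_mem _⟩
    · rintro c x ⟨h1, h2⟩
      exact ⟨t.O.smul_mem c h1, fun y hy => by rw [smul_mul_assoc]; exact t.O.smul_mem c (h2 y hy)⟩
  have hle : J ≤ t.O := fun x hx => ((hJ x).1 hx).1
  have hOJ : t.O * J = J := by
    apply le_antisymm
    · rw [Submodule.mul_le]
      intro o h x hx
      obtain ⟨h1, h2⟩ := (hJ x).1 hx
      exact (hJ _).2 ⟨ho.mulO h h1, fun y hy => by rw [mul_assoc]; exact ho.mulO h (h2 y hy)⟩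
    · intro x hx
      have := mul_mem_mul t.one_O hx
      rwa [one_mul] at this
  have hJO : ∀ x ∈ J, ∀ y ∈ cn u t'.O, x * y ∈ J := by
    intro x hx y hy
    obtain ⟨h1, h2⟩ := (hJ x).1 hx
    exact (hJ _).2 ⟨h2 y hy, fun z hz => by rw [mul_assoc]; exact h2 _ (mul2 y hy z hz)⟩
  have hN0 : (((m * m : ℕ) : ℤ) : H) ∈ J := by
    refine (hJ _).2 ⟨?_, hO2⟩
    have := int_mul_mem ((m * m : ℕ) : ℤ) t.one_O
    rwa [mul_one] at this
  have hmm : 0 < m * m := Nat.mul_pos hm hm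
  have hcm : Nat.Coprime (m * m) p := Nat.Coprime.mul_left hmp hmp
  obtain ⟨hh⟩ := t.exists_HP ((m * m) * (m * m)) (Nat.mul_pos hmm hmm) (Nat.Coprime.mul_left hcm hcm)
  obtain ⟨a, b, d, ha, hd, -, -, had, hdd, hJb⟩ := hh.ideal ho hle hOJ (N0 := ((m * m : ℕ) : ℤ)) (by exact_mod_cast hmm) (by push_cast; ring) hN0
  obtain ⟨k, hk⟩ := hh.nbe a b d
  have had0 : 0 < a * d := mul_pos ha hd
  obtain ⟨n, hn⟩ := Int.eq_ofNat_of_zero_le had0.le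
  have hn0 : 0 < n := by rw [hn] at had0; exact_mod_cast had0
  have hJJ : JJ t.O n J := by
    rw [hJb]
    refine Jb_JJ ho (hh.beO ho a b d) (k := k) (by rw [hk, hn]) ?_ (by rw [← hJb]; exact hN0) (by push_cast; ring)
    rw [← hn]
    have := mul_dvd_mul had hdd
    push_cast at this ⊢
    exact this
  have hnR : (0 : ℝ) < n := by exact_mod_cast hn0
  have g := hJJ.conn hn0 t.one_O (s := √n) (Real.sqrt_pos.2 hnR).ne' (Real.mul_self_sqrt hnR.le)
  have hor := ho.conn g
  have hsub : cn u t'.O ≤ RO n J := by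
    intro y hy
    rw [RO, mem_sp_mul]
    refine ⟨n * y, ?_, ?_⟩
    · have h1 : (n : H) * y ∈ (cj J * J) * cn u t'.O := mul_mem_mul hJJ.mem hy
      rw [mul_assoc] at h1
      refine mul_le_mul_right (?_ : J * cn u t'.O ≤ J) (cj J) h1
      rw [Submodule.mul_le]; exact hJO
    · rw [← ncoe, ← mul_assoc, ← Quaternion.coe_mul, inv_mul_cancel₀ hnR.ne', Quaternion.coe_one, one_mul]
  have hlat := cn_lat hu ho'.lat
  have heq := IsLat.eq_of_cov hlat.1 hor.lat hsub (by rw [hlat.2, ho'.covO, hor.covO])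
  rw [← heq] at g
  have hu' : N (star u) = 1 := by rw [Quaternion.normSq_star, hu]
  have g2 := g.cn hu'
  rw [TL.cn_symm hu rfl] at g2
  exact ⟨_, g2⟩

end MF

namespace MF
open Module MeasureTheory Filter Topology Submodule

theorem exists_aux {p : ℕ} [hp : Fact p.Prime] (h1 : p % 4 = 1) : ∃ q : ℕ, q % 4 = 3 ∧ ∃ v d : ℤ, d * q - v ^ 2 = p := by
  obtain ⟨r, hr⟩ := FiniteField.exists_nonsquare (F := ZMod p) (by rw [ZMod.ringChar_zmod_n]; omega)
  have hco : Nat.Coprime 4 p := by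
    have : Nat.Coprime (2 ^ 2) p := Nat.Coprime.pow_left 2 ((Nat.coprime_primes Nat.prime_two hp.out).2 (by omega))
    exact this
  obtain ⟨a, ha1, ha2⟩ := Nat.chineseRemainder hco 3 r.val
  have hr0 : r ≠ 0 := by rintro rfl; exact hr (IsSquare.zero)
  have hac : a.Coprime (4 * p) := by
    apply Nat.Coprime.mul_right
    · rw [Nat.Coprime, ha1.gcd_eq]; decide
    · rw [Nat.Coprime, ha2.gcd_eq]
      apply ((Nat.Prime.coprime_iff_not_dvd hp.out).2 _).symm
      intro h
      have := Nat.eq_zero_of_dvd_of_lt h r.val_lt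
      exact hr0 ((ZMod.val_eq_zero r).1 this)
  obtain ⟨q, -, hq, hqa⟩ := Nat.forall_exists_prime_gt_and_modEq 0 (by have := hp.out.pos; positivity : 4 * p ≠ 0) hac
  haveI : Fact q.Prime := ⟨hq⟩
  have hq4 : q % 4 = 3 := (hqa.of_mul_right p).trans ha1
  have hqr : (q : ZMod p) = r := by
    have : q ≡ r.val [MOD p] := (hqa.of_mul_left 4).trans ha2
    rw [(ZMod.natCast_eq_natCast_iff _ _ _).2 this, ZMod.natCast_zmod_val]
  refine ⟨q, hq4, ?_⟩
  have hns : ¬ IsSquare (p : ZMod q) := by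
    rw [← ZMod.exists_sq_eq_prime_iff_of_mod_four_eq_one h1 (by omega), hqr]; exact hr
  have hn1 : ¬ IsSquare (-1 : ZMod q) := by
    rw [ZMod.exists_sq_eq_neg_one_iff]; omega
  have hp0 : (p : ZMod q) ≠ 0 := by intro h; rw [h] at hns; exact hns IsSquare.zero
  have hsq : IsSquare (-(p : ZMod q)) := by
    have e1 := (quadraticChar_neg_one_iff_not_isSquare).2 hns
    have e2 := (quadraticChar_neg_one_iff_not_isSquare).2 hn1
    rw [← quadraticChar_one_iff_isSquare (neg_ne_zero.2 hp0), ← neg_one_mul, map_mul, e1, e2]; rfl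
  obtain ⟨s, hs⟩ := hsq
  have hd : ((s.val ^ 2 + p : ℤ) : ZMod q) = 0 := by
    push_cast; rw [ZMod.natCast_zmod_val, pow_two, ← hs]; ring
  obtain ⟨d, hd⟩ := (ZMod.intCast_zmod_eq_zero_iff_dvd _ _).1 hd
  exact ⟨s.val, d, by linear_combination -hd⟩

theorem exists_TL (p : ℕ) [hp : Fact p.Prime] : Nonempty (TL p) := by
  have hp0 := hp.out.pos
  rcases hp.out.eq_two_or_odd with h2 | h2
  · obtain ⟨t, -⟩ := exists_q hp0 (A := 1) (B := 1) (C := 1) (U := 1) (V := 0) (W := 1) (by norm_num) (by norm_num) (by rw [h2]; norm_num)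
    exact ⟨t⟩
  rcases (by omega : p % 4 = 1 ∨ p % 4 = 3) with h | h
  · obtain ⟨q, hq, v, d, hd⟩ := exists_aux h
    obtain ⟨k, hk⟩ : ∃ k : ℕ, q = 4 * k + 3 := ⟨q / 4, by omega⟩
    obtain ⟨t, -⟩ := exists_q hp0 (A := 1) (B := k + 1) (C := d) (U := v) (V := 0) (W := 1) (by norm_num) (by push_cast; linarith) (by
      rw [hk] at hd; push_cast at hd; linear_combination hd)
    exact ⟨t⟩
  · obtain ⟨k, hk⟩ : ∃ k : ℕ, p = 4 * k + 3 := ⟨p / 4, by omega⟩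
    obtain ⟨t, -⟩ := exists_q hp0 (A := 1) (B := k + 1) (C := 1) (U := 0) (V := 0) (W := 1) (by norm_num) (by push_cast; linarith) (by
      rw [hk]; push_cast; ring)
    exact ⟨t⟩

theorem mass_real {p : ℕ} [hp : Fact p.Prime] {S : Finset (Matrix (Fin 3) (Fin 3) ℤ)} {T : Matrix (Fin 3) (Fin 3) ℤ → TL p}
    (h : SD p S T) (t : TL p) : ∑ a ∈ S, (1 : ℝ) / Nat.card (AutGrp a) = ((p : ℝ) - 1) / 48 := by
  have hp0 : (0 : ℝ) < p := by exact_mod_cast hp.out.pos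
  have hp1 : (1 : ℝ) < p := by exact_mod_cast hp.out.one_lt
  have l1 := sigma_lim (p := p)
  have l2 : Tendsto (fun X : ℕ => ∑ a ∈ S, (1 : ℝ) / Nat.card (AutGrp a) *
      ((∑ n ∈ IX p X, (Nat.card {q // PB t.O (T a).O n q} : ℝ)) / (X : ℝ) ^ 2)) atTop
      (𝓝 (∑ a ∈ S, (1 : ℝ) / Nat.card (AutGrp a) * (4 * Real.pi ^ 2 / p * (1 - 1 / p ^ 2)))) := by
    apply tendsto_finset_sum
    intro a ha
    obtain ⟨K, g⟩ := exists_conn t (T a)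
    exact (sum_PB_lim t.ord g).const_mul _
  have e : (fun X : ℕ => ∑ a ∈ S, (1 : ℝ) / Nat.card (AutGrp a) *
      ((∑ n ∈ IX p X, (Nat.card {q // PB t.O (T a).O n q} : ℝ)) / (X : ℝ) ^ 2)) =
      fun X : ℕ => (∑ n ∈ IX p X, ∑ d ∈ n.divisors, (d : ℝ)) / (X : ℝ) ^ 2 := by
    funext X
    have : ∑ n ∈ IX p X, ∑ d ∈ n.divisors, (d : ℝ) = ∑ n ∈ IX p X, ∑ a ∈ S, (Nat.card {q // PB t.O (T a).O n q} : ℝ) / Nat.card (AutGrp a) := by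
      apply Finset.sum_congr rfl
      intro n hn
      rw [mem_IX] at hn
      rw [h.sum_n t (by omega) hn.2]
    rw [this, Finset.sum_comm, Finset.sum_div]
    apply Finset.sum_congr rfl
    intro a ha
    rw [← Finset.sum_div]; ring
  rw [e] at l2
  have := tendsto_nhds_unique l1 l2
  rw [← Finset.sum_mul] at this
  generalize ∑ a ∈ S, (1 : ℝ) / Nat.card (AutGrp a) = M at *
  have hpi := Real.pi_pos
  have hne : (1 - 1 / (p : ℝ) ^ 2) ≠ 0 := by
    have : 1 / (p : ℝ) ^ 2 < 1 := by rw [div_lt_one (by positivity)]; nlinarith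
    linarith
  generalize (1 - 1 / (p : ℝ) ^ 2) = c at *
  have h2 : Real.pi ^ 2 * c * ((p : ℝ) - 1) = Real.pi ^ 2 * c * (48 * M) := by
    have hi : (p : ℝ) * (1 / p) = 1 := by field_simp
    rw [show 4 * Real.pi ^ 2 / (p : ℝ) = 4 * Real.pi ^ 2 * (1 / p) by ring] at this
    linear_combination (12 * (p : ℝ)) * this + (Real.pi ^ 2 * c + 48 * M * Real.pi ^ 2 * c) * hi
  have h3 := mul_left_cancel₀ (by positivity) h2
  linarith

end MF

theorem mass_formula_ternary (p : ℕ) (hp : p.Prime)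
    (S : Finset (Matrix (Fin 3) (Fin 3) ℤ))
    (hS : ∀ a ∈ S, PosDef a ∧ HasDisc a (p : ℤ))
    (hcomplete : ∀ b : Matrix (Fin 3) (Fin 3) ℤ, PosDef b → HasDisc b (p : ℤ) →
      ∃ a ∈ S, FormEquiv (Qform b) (Qform a))
    (hirredundant : ∀ a ∈ S, ∀ b ∈ S, FormEquiv (Qform a) (Qform b) → a = b) :
    ∑ a ∈ S, (1 : ℚ) / (Nat.card (AutGrp a)) = ((p : ℚ) - 1) / 48 := by
  haveI : Fact p.Prime := ⟨hp⟩
  obtain ⟨t⟩ := MF.exists_TL p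
  have hT : ∀ a : Matrix (Fin 3) (Fin 3) ℤ, ∃ t : MF.TL p, a ∈ S → t.Rep a := by
    intro a
    by_cases ha : a ∈ S
    · obtain ⟨s, hs⟩ := MF.exists_Rep hp.pos (hS a ha).1 (hS a ha).2
      exact ⟨s, fun _ => hs⟩
    · exact ⟨t, fun h => absurd h ha⟩
  choose T hT using hT
  have h := MF.mass_real (T := T) ⟨hT, hcomplete, hirredundant⟩ t
  have h2 : ((∑ a ∈ S, (1 : ℚ) / (Nat.card (AutGrp a)) : ℚ) : ℝ) = ((((p : ℚ) - 1) / 48 : ℚ) : ℝ) := by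
    push_cast; exact h
  exact_mod_cast h2
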